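/- Let m, n ≥ 0 be integers, let p, q ∈ ℂ with 0 < |p| < 1 and 0 < |q| < 1, let Z ∈ ℂ be nonzero, and let t_0,...,t_{m+n+1}, u_0,...,u_{m+n+1} ∈ ℂ be nonzero with ∏_{r=0}^{m+n+1} t_r u_r = (pq)^{m+1}. Set T = ∏_r t_r and U = ∏_r u_r, and let τ, υ ∈ ℂ be nonzero with τ^{m+1} = T, υ^{m+1} = U and τ·υ = pq. Assume |u_r| < |Z|^{1/(n+1)} < 1/|t_r| for all r, and |υ/u_r| < |Z|^{1/(m+1)} < |t_r|/|τ| for all r. For an integer N ≥ 0, an integer k ≥ 0, and nonzero parameters s_0,...,s_{k+N+1}, v_0,...,v_{k+N+1}, define I^{(k)}_{A_N}(Z | s; v; p,q) := ((p;p)_∞ (q;q)_∞)^N/(N+1)! · (1/(2π)^N) ∫_{[0,2π]^N} ∏_{i=0}^{N} ∏_{r=0}^{k+N+1} Γ(s_r z_i;p,q) Γ(v_r/z_i;p,q) / ∏_{0≤i<j≤N} Γ(z_i/z_j;p,q) Γ(z_j/z_i;p,q) dθ_1⋯dθ_N, where z_i = |Z|^{1/(N+1)} e^{iθ_i} for 1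 ≤ i ≤ N and z_0 = Z/(z_1⋯z_N). Then I^{(m)}_{A_n}(Z | t_0,...,t_{m+n+1}; u_0,...,u_{m+n+1}; p,q) = ∏_{r=0}^{m+n+1} ∏_{s=0}^{m+n+1} Γ(t_r u_s;p,q) · I^{(n)}_{A_m}(Z | τ/t_0,...,τ/t_{m+n+1}; υ/u_0,...,υ/u_{m+n+1}; p,q). -/

import Mathlib

open scoped BigOperators Real
open MeasureTheory

/-- The elliptic Gamma function `Γ(x;p,q)`. -/
noncomputable def ellGamma (x p q : ℂ) : ℂ :=
  ∏' jk : ℕ × ℕ, ((1 - p ^ (jk.1 + 1) * q ^ (jk.2 + 1) / x) / (1 - p ^ jk.1 * q ^ jk.2 * x))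

/-- `(p;p)_∞`. -/
noncomputable def qPoch (p : ℂ) : ℂ := ∏' k : ℕ, (1 - p ^ (k + 1))

/-- The `A_N` elliptic hypergeometric integral `I^{(k)}_{A_N}(Z | s; v; p,q)` with `d`
parameters of each kind (for `d = k+N+2`): the variables `z_1,…,z_N` run over the circle of
radius `|Z|^{1/(N+1)}`, and `z_0 = Z/(z_1⋯z_N)`. -/
noncomputable def I_A (N d : ℕ) (Z : ℂ) (s v : Fin d → ℂ) (p q : ℂ) : ℂ :=
  (qPoch p * qPoch q) ^ N / (((N + 1).factorial : ℕ) : ℂ) *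
    ((1 / (2 * Real.pi) : ℝ) : ℂ) ^ N *
    ∫ θ in Set.univ.pi fun _ : Fin N => Set.Icc (0 : ℝ) (2 * Real.pi),
      (fun z : Fin (N + 1) → ℂ =>
        (∏ i, ∏ r, ellGamma (s r * z i) p q * ellGamma (v r / z i) p q) /
          ∏ i, ∏ j, if i < j then ellGamma (z i / z j) p q * ellGamma (z j / z i) p q else 1)
      (Fin.cons
        (Z / ∏ j : Fin N,
          ((‖Z‖ ^ (((N : ℝ) + 1)⁻¹) : ℝ) : ℂ) * Complex.exp (Complex.I * θ j))
        (fun j => ((‖Z‖ ^ (((N : ℝ) + 1)⁻¹) : ℝ) : ℂ) * Complex.exp (Complex.I * θ j)))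

section Development

open Filter Topology Set

/-- The double infinite product `∏ (1 - p^j q^k x)`. -/
noncomputable def dPoch (x p q : ℂ) : ℂ := ∏' jk : ℕ × ℕ, (1 - p ^ jk.1 * q ^ jk.2 * x)

/-- The infinite product `(x;p)_∞`. -/
noncomputable def sPoch (x p : ℂ) : ℂ := ∏' k : ℕ, (1 - p ^ k * x)

/-- The modified theta function. -/
noncomputable def thetaF (x p : ℂ) : ℂ := sPoch x p * sPoch (p / x) p

lemma summable_pow_mul_pow {P Q : ℝ} (hP0 : 0 ≤ P) (hP : P < 1) (hQ0 : 0 ≤ Q) (hQ : Q < 1) (X : ℝ) :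
    Summable fun jk : ℕ × ℕ => P ^ jk.1 * Q ^ jk.2 * X :=
  ((summable_geometric_of_lt_one hP0 hP).mul_of_nonneg (summable_geometric_of_lt_one hQ0 hQ)
    (fun _ => by positivity) (fun _ => by positivity)).mul_right X

lemma summable_dPoch {p q : ℂ} (hp : ‖p‖ < 1) (hq : ‖q‖ < 1) (x : ℂ) :
    Summable fun jk : ℕ × ℕ => ‖-(p ^ jk.1 * q ^ jk.2 * x)‖ := by
  simpa using summable_pow_mul_pow (norm_nonneg p) hp (norm_nonneg q) hq ‖x‖

lemma multipliable_dPoch {p q : ℂ} (hp : ‖p‖ < 1) (hq : ‖q‖ < 1) (x : ℂ) :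
    Multipliable fun jk : ℕ × ℕ => 1 - p ^ jk.1 * q ^ jk.2 * x := by
  simpa [sub_eq_add_neg] using multipliable_one_add_of_summable (summable_dPoch hp hq x)

lemma summable_sPoch {p : ℂ} (hp : ‖p‖ < 1) (x : ℂ) :
    Summable fun j : ℕ => ‖-(p ^ j * x)‖ := by
  simpa using (summable_geometric_of_lt_one (norm_nonneg p) hp).mul_right ‖x‖

lemma multipliable_sPoch {p : ℂ} (hp : ‖p‖ < 1) (x : ℂ) :
    Multipliable fun j : ℕ => 1 - p ^ j * x := by
  simpa [sub_eq_add_neg] using multipliable_one_add_of_summable (summable_sPoch hp x)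

lemma dPoch_ne_zero {p q : ℂ} (hp : ‖p‖ < 1) (hq : ‖q‖ < 1) {x : ℂ}
    (h : ∀ j k : ℕ, 1 - p ^ j * q ^ k * x ≠ 0) : dPoch x p q ≠ 0 := by
  have := tprod_one_add_ne_zero_of_summable (f := fun jk : ℕ × ℕ => -(p ^ jk.1 * q ^ jk.2 * x))
    (fun i => by simpa [sub_eq_add_neg] using h i.1 i.2) (summable_dPoch hp hq x)
  simpa [dPoch, sub_eq_add_neg] using this

lemma sPoch_ne_zero {p : ℂ} (hp : ‖p‖ < 1) {x : ℂ}
    (h : ∀ j : ℕ, 1 - p ^ j * x ≠ 0) : sPoch x p ≠ 0 := by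
  have := tprod_one_add_ne_zero_of_summable (f := fun j : ℕ => -(p ^ j * x))
    (fun i => by simpa [sub_eq_add_neg] using h i) (summable_sPoch hp x)
  simpa [sPoch, sub_eq_add_neg] using this

lemma one_sub_ne_zero_of_norm_lt {x : ℂ} (h : ‖x‖ < 1) : 1 - x ≠ 0 := by
  intro h0
  have : x = 1 := by linear_combination -h0
  simp [this] at h

lemma norm_pow_mul_lt {p x : ℂ} (hp : ‖p‖ < 1) (hx : ‖x‖ < 1) (j : ℕ) : ‖p ^ j * x‖ < 1 := by
  rw [norm_mul, norm_pow]
  calc ‖p‖ ^ j * ‖x‖ ≤ 1 * ‖x‖ := by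
        gcongr
        exact pow_le_one₀ (norm_nonneg _) hp.le
    _ < 1 := by simpa using hx

lemma dPoch_ne_zero_of_norm_lt {p q : ℂ} (hp : ‖p‖ < 1) (hq : ‖q‖ < 1) {x : ℂ} (hx : ‖x‖ < 1) :
    dPoch x p q ≠ 0 := dPoch_ne_zero hp hq fun j k => one_sub_ne_zero_of_norm_lt (by
      rw [mul_assoc]; exact norm_pow_mul_lt hp (norm_pow_mul_lt hq hx k) j)

lemma sPoch_ne_zero_of_norm_lt {p : ℂ} (hp : ‖p‖ < 1) {x : ℂ} (hx : ‖x‖ < 1) :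
    sPoch x p ≠ 0 := sPoch_ne_zero hp fun j => one_sub_ne_zero_of_norm_lt (norm_pow_mul_lt hp hx j)

lemma sPoch_eq_one_sub_mul {p : ℂ} (hp : ‖p‖ < 1) (x : ℂ) :
    sPoch x p = (1 - x) * sPoch (p * x) p := by
  unfold sPoch
  rw [tprod_eq_zero_mul']
  · simp [pow_succ, mul_assoc]
  · simpa [pow_succ, mul_assoc] using multipliable_sPoch hp (p * x)

lemma sPoch_self (p : ℂ) : sPoch p p = qPoch p := by
  simp [sPoch, qPoch, pow_succ]

lemma dPoch_symm {p q : ℂ} (x : ℂ) : dPoch x p q = dPoch x q p := by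
  unfold dPoch
  rw [← (Equiv.prodComm ℕ ℕ).tprod_eq]
  simp [mul_comm (p ^ _)]

lemma dPoch_eq_tprod_sPoch {p q : ℂ} (hp : ‖p‖ < 1) (hq : ‖q‖ < 1) (x : ℂ) :
    HasProd (fun k => sPoch (q ^ k * x) p) (dPoch x p q) := by
  have h := (multipliable_dPoch hq hp x).hasProd.prod_fiberwise
    (g := fun k => sPoch (q ^ k * x) p) (fun k => by
      have := (multipliable_sPoch hp (q ^ k * x)).hasProd
      simpa [mul_left_comm, mul_assoc, sPoch] using this)
  rw [dPoch_symm]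
  exact h

lemma dPoch_eq_sPoch_mul {p q : ℂ} (hp : ‖p‖ < 1) (hq : ‖q‖ < 1) (x : ℂ) :
    dPoch x p q = sPoch x p * dPoch (q * x) p q := by
  rw [← (dPoch_eq_tprod_sPoch hp hq x).tprod_eq, tprod_eq_zero_mul',
    ← (dPoch_eq_tprod_sPoch hp hq (q * x)).tprod_eq]
  · simp [pow_succ, mul_assoc]
  · simpa [pow_succ, mul_assoc] using (dPoch_eq_tprod_sPoch hp hq (q * x)).multipliable

lemma dPoch_eq_sPoch_mul' {p q : ℂ} (hp : ‖p‖ < 1) (hq : ‖q‖ < 1) (x : ℂ) :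
    dPoch x p q = sPoch x q * dPoch (p * x) p q := by
  rw [dPoch_symm, dPoch_eq_sPoch_mul hq hp, dPoch_symm]

lemma ellGamma_eq_div {p q : ℂ} (hp : ‖p‖ < 1) (hq : ‖q‖ < 1) (x : ℂ) :
    ellGamma x p q = dPoch (p * q / x) p q / dPoch x p q := by
  have key : ∀ jk : ℕ × ℕ, (1 - p ^ (jk.1 + 1) * q ^ (jk.2 + 1) / x)
      = 1 - p ^ jk.1 * q ^ jk.2 * (p * q / x) := fun jk => by ring
  unfold ellGamma
  simp_rw [key]
  by_cases h : ∃ jk : ℕ × ℕ, 1 - p ^ jk.1 * q ^ jk.2 * x = 0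
  · obtain ⟨jk, h⟩ := h
    rw [tprod_of_exists_eq_zero ⟨jk, by rw [h, div_zero]⟩]
    unfold dPoch
    rw [tprod_of_exists_eq_zero (f := fun jk : ℕ × ℕ => 1 - p ^ jk.1 * q ^ jk.2 * x) ⟨jk, h⟩,
      div_zero]
  · push Not at h
    exact ((multipliable_dPoch hp hq _).hasProd.div₀ (multipliable_dPoch hp hq _).hasProd
      (dPoch_ne_zero hp hq fun j k => h (j, k))).tprod_eq

lemma ellGamma_symm {p q : ℂ} (hp : ‖p‖ < 1) (hq : ‖q‖ < 1) (x : ℂ) :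
    ellGamma x p q = ellGamma x q p := by
  rw [ellGamma_eq_div hp hq, ellGamma_eq_div hq hp, dPoch_symm, dPoch_symm x, mul_comm p q]

lemma continuousAt_dPoch {a : ℂ × ℂ × ℂ} (hp : ‖a.2.1‖ < 1) (hq : ‖a.2.2‖ < 1) :
    ContinuousAt (fun b : ℂ × ℂ × ℂ => dPoch b.1 b.2.1 b.2.2) a := by
  obtain ⟨P, hP1, hP2⟩ := exists_between hp
  obtain ⟨Q, hQ1, hQ2⟩ := exists_between hq
  have := tendsto_tprod_one_add_of_dominated_convergence
    (f := fun (b : ℂ × ℂ × ℂ) (jk : ℕ × ℕ) => -(b.2.1 ^ jk.1 * b.2.2 ^ jk.2 * b.1))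
    (g := fun (jk : ℕ × ℕ) => -(a.2.1 ^ jk.1 * a.2.2 ^ jk.2 * a.1)) (𝓕 := 𝓝 a)
    (summable_pow_mul_pow ((norm_nonneg _).trans hP1.le) hP2 ((norm_nonneg _).trans hQ1.le)
      hQ2 (‖a.1‖ + 1)) ?_ ?_
  · simpa [ContinuousAt, dPoch, sub_eq_add_neg] using this
  · intro k
    have : Continuous fun b : ℂ × ℂ × ℂ => -(b.2.1 ^ k.1 * b.2.2 ^ k.2 * b.1) := by fun_prop
    exact this.tendsto a
  · have h1 : ∀ᶠ b : ℂ × ℂ × ℂ in 𝓝 a, ‖b.2.1‖ < P :=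
      ContinuousAt.eventually_lt (f := fun b : ℂ × ℂ × ℂ => ‖b.2.1‖) (by fun_prop)
        continuousAt_const hP1
    have h2 : ∀ᶠ b : ℂ × ℂ × ℂ in 𝓝 a, ‖b.2.2‖ < Q :=
      ContinuousAt.eventually_lt (f := fun b : ℂ × ℂ × ℂ => ‖b.2.2‖) (by fun_prop)
        continuousAt_const hQ1
    have h3 : ∀ᶠ b : ℂ × ℂ × ℂ in 𝓝 a, ‖b.1‖ < ‖a.1‖ + 1 :=
      ContinuousAt.eventually_lt (f := fun b : ℂ × ℂ × ℂ => ‖b.1‖) (by fun_prop)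
        continuousAt_const (by linarith)
    have hP0 : 0 ≤ P := (norm_nonneg _).trans hP1.le
    have hQ0 : 0 ≤ Q := (norm_nonneg _).trans hQ1.le
    filter_upwards [h1, h2, h3] with b h1 h2 h3 jk
    simp only [norm_neg, norm_mul, norm_pow]
    gcongr

lemma ContinuousOn.dPoch {X : Type*} [TopologicalSpace X] {s : Set X} {x p q : X → ℂ}
    (hx : ContinuousOn x s) (hp : ContinuousOn p s) (hq : ContinuousOn q s)
    (hp1 : ∀ a ∈ s, ‖p a‖ < 1) (hq1 : ∀ a ∈ s, ‖q a‖ < 1) :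
    ContinuousOn (fun a => dPoch (x a) (p a) (q a)) s := fun a ha =>
  (continuousAt_dPoch (a := (x a, p a, q a)) (hp1 a ha) (hq1 a ha)).comp_continuousWithinAt
    (f := fun a => (x a, p a, q a)) ((hx a ha).prodMk ((hp a ha).prodMk (hq a ha)))

lemma sPoch_eq_dPoch (x p : ℂ) (hp : ‖p‖ < 1) : sPoch x p = dPoch x p 0 := by
  rw [dPoch_eq_sPoch_mul hp (by simp)]
  simp [dPoch]

lemma ContinuousOn.sPoch {X : Type*} [TopologicalSpace X] {s : Set X} {x p : X → ℂ}
    (hx : ContinuousOn x s) (hp : ContinuousOn p s)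
    (hp1 : ∀ a ∈ s, ‖p a‖ < 1) :
    ContinuousOn (fun a => sPoch (x a) (p a)) s := by
  refine (hx.dPoch hp (continuousOn_const (c := 0)) hp1 (by simp)).congr fun a ha => ?_
  exact sPoch_eq_dPoch _ _ (hp1 a ha)

lemma DifferentiableOn.dPoch {U : Set ℂ} (hU : IsOpen U) {x p q : ℂ → ℂ}
    (hx : DifferentiableOn ℂ x U) (hp : DifferentiableOn ℂ p U) (hq : DifferentiableOn ℂ q U)
    (hp1 : ∀ a ∈ U, ‖p a‖ < 1) (hq1 : ∀ a ∈ U, ‖q a‖ < 1) :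
    DifferentiableOn ℂ (fun a => dPoch (x a) (p a) (q a)) U := by
  intro a ha
  refine DifferentiableAt.differentiableWithinAt ?_
  obtain ⟨P, hP1, hP2⟩ := exists_between (hp1 a ha)
  obtain ⟨Q, hQ1, hQ2⟩ := exists_between (hq1 a ha)
  have hcx := (hx.differentiableAt (hU.mem_nhds ha)).continuousAt
  have hcp := (hp.differentiableAt (hU.mem_nhds ha)).continuousAt
  have hcq := (hq.differentiableAt (hU.mem_nhds ha)).continuousAt
  have h1 : ∀ᶠ b in 𝓝 a, ‖p b‖ < P := hcp.norm.eventually_lt continuousAt_const hP1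
  have h2 : ∀ᶠ b in 𝓝 a, ‖q b‖ < Q := hcq.norm.eventually_lt continuousAt_const hQ1
  have h3 : ∀ᶠ b in 𝓝 a, ‖x b‖ < ‖x a‖ + 1 := hcx.norm.eventually_lt continuousAt_const (by simp)
  obtain ⟨V, hV, hVo, haV⟩ := eventually_nhds_iff.1 ((h1.and h2).and (h3.and (hU.mem_nhds ha)))
  have hVU : V ⊆ U := fun b hb => (hV b hb).2.2
  have hterm : ∀ jk : ℕ × ℕ, DifferentiableOn ℂ (fun b => -(p b ^ jk.1 * q b ^ jk.2 * x b)) V :=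
    fun jk => ((((hp.mono hVU).fun_pow _).fun_mul ((hq.mono hVU).fun_pow _)).fun_mul (hx.mono hVU)).fun_neg
  have key := Summable.hasProdLocallyUniformlyOn_one_add (K := V)
    (f := fun (jk : ℕ × ℕ) b => -(p b ^ jk.1 * q b ^ jk.2 * x b)) hVo
    (summable_pow_mul_pow ((norm_nonneg _).trans hP1.le) hP2 ((norm_nonneg _).trans hQ1.le)
      hQ2 (‖x a‖ + 1)) (Eventually.of_forall fun jk b hb => by
        simp only [norm_neg, norm_mul, norm_pow]
        have := hV b hb
        have hP0 : 0 ≤ P := (norm_nonneg _).trans hP1.le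
        have hQ0 : 0 ≤ Q := (norm_nonneg _).trans hQ1.le
        have h1 := this.1.1.le
        have h2 := this.1.2.le
        have h3 := this.2.1.le
        gcongr) (fun jk => (hterm jk).continuousOn)
  have hd : DifferentiableOn ℂ (fun b => ∏' jk : ℕ × ℕ, (1 + -(p b ^ jk.1 * q b ^ jk.2 * x b))) V := by
    refine key.differentiableOn (.of_forall fun s => ?_) hVo
    simpa [Finset.prod_fn] using
      DifferentiableOn.fun_finsetProd (fun jk _ => (hterm jk).const_add 1)
  have := hd.differentiableAt (hVo.mem_nhds haV)
  simpa [_root_.dPoch, sub_eq_add_neg] using this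

lemma DifferentiableOn.sPoch {U : Set ℂ} (hU : IsOpen U) {x p : ℂ → ℂ}
    (hx : DifferentiableOn ℂ x U) (hp : DifferentiableOn ℂ p U)
    (hp1 : ∀ a ∈ U, ‖p a‖ < 1) :
    DifferentiableOn ℂ (fun a => sPoch (x a) (p a)) U := by
  refine (hx.dPoch hU hp (differentiableOn_const (0 : ℂ)) hp1 (by simp)).congr fun a ha => ?_
  exact sPoch_eq_dPoch _ _ (hp1 a ha)

lemma sPoch_ne_zero_of_norm_le {p : ℂ} (hp : ‖p‖ < 1) {x : ℂ} (hx : ‖x‖ ≤ 1) (h1 : x ≠ 1) :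
    sPoch x p ≠ 0 := by
  rw [sPoch_eq_one_sub_mul hp]
  refine mul_ne_zero (sub_ne_zero.2 (Ne.symm h1)) (sPoch_ne_zero_of_norm_lt hp ?_)
  rw [norm_mul]
  nlinarith [norm_nonneg x, norm_nonneg p]

lemma dPoch_ne_zero_of_norm_le {p q : ℂ} (hp : ‖p‖ < 1) (hq : ‖q‖ < 1) {x : ℂ} (hx : ‖x‖ ≤ 1)
    (h1 : x ≠ 1) : dPoch x p q ≠ 0 := by
  rw [dPoch_eq_sPoch_mul hp hq]
  refine mul_ne_zero (sPoch_ne_zero_of_norm_le hp hx h1) (dPoch_ne_zero_of_norm_lt hp hq ?_)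
  rw [norm_mul]
  nlinarith [norm_nonneg x, norm_nonneg q]

lemma sPoch_one {p : ℂ} (hp : ‖p‖ < 1) : sPoch 1 p = 0 := by
  rw [sPoch_eq_one_sub_mul hp]; simp

lemma thetaF_one {p : ℂ} (hp : ‖p‖ < 1) : thetaF 1 p = 0 := by
  simp [thetaF, sPoch_one hp]

lemma thetaF_mul_left {p : ℂ} (hp : ‖p‖ < 1) (hp0 : p ≠ 0) {x : ℂ} (hx : x ≠ 0) :
    thetaF (p * x) p = -x⁻¹ * thetaF x p := by
  unfold thetaF
  rw [sPoch_eq_one_sub_mul hp x, show p / (p * x) = 1 / x by field_simp,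
    sPoch_eq_one_sub_mul hp (1 / x), mul_one_div]
  field_simp
  ring

lemma thetaF_inv {p : ℂ} (hp : ‖p‖ < 1) {x : ℂ} (hx : x ≠ 0) :
    thetaF x⁻¹ p = -x⁻¹ * thetaF x p := by
  unfold thetaF
  rw [sPoch_eq_one_sub_mul hp x, sPoch_eq_one_sub_mul hp x⁻¹, div_inv_eq_mul, ← div_eq_mul_inv]
  field_simp
  ring

lemma thetaF_div {p : ℂ} (hp0 : p ≠ 0) {x : ℂ} :
    thetaF (p / x) p = thetaF x p := by
  unfold thetaF
  rw [mul_comm, div_div_cancel₀ hp0]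

/-- Zeros of the theta function. -/
lemma exists_zpow_of_thetaF_eq_zero {p : ℂ} (hp : ‖p‖ < 1) (hp0 : p ≠ 0) {x : ℂ} (hx : x ≠ 0)
    (h : thetaF x p = 0) : ∃ k : ℤ, x = p ^ k := by
  have key : ∀ y : ℂ, sPoch y p = 0 → ∃ k : ℕ, p ^ k * y = 1 := by
    intro y hy
    by_contra! hcon
    exact sPoch_ne_zero hp (fun j => sub_ne_zero.2 (hcon j).symm) hy
  rcases mul_eq_zero.1 h with h | h
  · obtain ⟨k, hk⟩ := key _ h
    refine ⟨-k, ?_⟩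
    rw [zpow_neg, zpow_natCast]
    exact eq_inv_of_mul_eq_one_right hk
  · obtain ⟨k, hk⟩ := key _ h
    refine ⟨k + 1, ?_⟩
    have : p ^ k * p = x := by field_simp at hk; linear_combination hk
    rw [zpow_add_one₀ hp0, zpow_natCast, this]

lemma thetaF_ne_zero {p : ℂ} (hp : ‖p‖ < 1) {x : ℂ} (hx : ‖x‖ < 1) (hpx : ‖p‖ < ‖x‖) :
    thetaF x p ≠ 0 := by
  refine mul_ne_zero (sPoch_ne_zero_of_norm_lt hp hx) (sPoch_ne_zero_of_norm_lt hp ?_)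
  rw [norm_div, div_lt_one ((norm_nonneg _).trans_lt hpx)]
  exact hpx

lemma thetaF_ne_zero_of_norm_eq_one {p : ℂ} (hp : ‖p‖ < 1) {x : ℂ} (hx : ‖x‖ = 1) (h1 : x ≠ 1) :
    thetaF x p ≠ 0 := by
  refine mul_ne_zero (sPoch_ne_zero_of_norm_le hp hx.le h1) (sPoch_ne_zero_of_norm_lt hp ?_)
  rw [norm_div, hx, div_one]
  exact hp

section ellGamma
variable {p q : ℂ}

lemma ellGamma_p_mul (hp : ‖p‖ < 1) (hq : ‖q‖ < 1) (hp0 : p ≠ 0) {x : ℂ}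
    (h : sPoch x q ≠ 0) : ellGamma (p * x) p q = thetaF x q * ellGamma x p q := by
  rw [ellGamma_eq_div hp hq, ellGamma_eq_div hp hq, dPoch_eq_sPoch_mul' hp hq x,
    show p * q / (p * x) = q / x by field_simp, dPoch_eq_sPoch_mul' hp hq (q / x), thetaF,
    mul_div_assoc]
  field_simp

lemma ellGamma_q_mul (hp : ‖p‖ < 1) (hq : ‖q‖ < 1) (hq0 : q ≠ 0) {x : ℂ}
    (h : sPoch x p ≠ 0) : ellGamma (q * x) p q = thetaF x p * ellGamma x p q := by
  rw [ellGamma_symm hp hq, ellGamma_p_mul hq hp hq0 h, ellGamma_symm hp hq]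

lemma ellGamma_mul_reflect (hp : ‖p‖ < 1) (hq : ‖q‖ < 1) {x y : ℂ} (hxy : x * y = p * q)
    (hpq : p * q ≠ 0) (hx : dPoch x p q ≠ 0) (hy : dPoch y p q ≠ 0) :
    ellGamma x p q * ellGamma y p q = 1 := by
  rw [ellGamma_eq_div hp hq, ellGamma_eq_div hp hq]
  have hx0 : x ≠ 0 := by rintro rfl; simp at hxy; simp_all
  have hy0 : y ≠ 0 := by rintro rfl; simp at hxy; simp_all
  rw [show p * q / x = y by rw [← hxy]; field_simp, show p * q / y = x by rw [← hxy]; field_simp]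
  field_simp

lemma ellGamma_mul_reflect' (hp : ‖p‖ < 1) (hq : ‖q‖ < 1) {x y : ℂ} (hxy : x * y = p * q)
    (hx : ‖x‖ < 1) (hy : ‖y‖ < 1) (hpq : p * q ≠ 0) :
    ellGamma x p q * ellGamma y p q = 1 :=
  ellGamma_mul_reflect hp hq hxy hpq (dPoch_ne_zero_of_norm_lt hp hq hx)
    (dPoch_ne_zero_of_norm_lt hp hq hy)

/-- The kernel replacing the reciprocal of two elliptic Gamma functions. -/
noncomputable def chiF (x p q : ℂ) : ℂ := sPoch x p * sPoch (q * x) q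

lemma inv_ellGamma_mul (hp : ‖p‖ < 1) (hq : ‖q‖ < 1) {x : ℂ} (hx : ‖x‖ = 1) :
    (ellGamma x p q * ellGamma x⁻¹ p q)⁻¹ = chiF x p q * chiF x⁻¹ p q := by
  have hpq : ‖p * q‖ < 1 := by
    rw [norm_mul]; nlinarith [norm_nonneg p, norm_nonneg q]
  have h1 : dPoch (p * q * x) p q ≠ 0 := dPoch_ne_zero_of_norm_lt hp hq (by
    rw [norm_mul, hx, mul_one]; exact hpq)
  have h2 : dPoch (p * q * x⁻¹) p q ≠ 0 := dPoch_ne_zero_of_norm_lt hp hq (by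
    rw [norm_mul, norm_inv, hx, inv_one, mul_one]; exact hpq)
  have h3 : ∀ y, dPoch y p q = chiF y p q * dPoch (p * q * y) p q := fun y => by
    rw [dPoch_eq_sPoch_mul hp hq, dPoch_eq_sPoch_mul' hp hq (q * y), chiF, mul_assoc, ← mul_assoc p]
  rw [ellGamma_eq_div hp hq, ellGamma_eq_div hp hq, div_inv_eq_mul, div_eq_mul_inv (p * q) x,
    h3 x, h3 x⁻¹, mul_inv, inv_div, inv_div]
  rw [div_mul_div_comm, mul_comm (dPoch (p * q * x⁻¹) p q), mul_mul_mul_comm,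
    mul_div_assoc, div_self (mul_ne_zero h1 h2), mul_one]

lemma chiF_mul_inv (hp : ‖p‖ < 1) (hq : ‖q‖ < 1) (x : ℂ) :
    chiF x p q * chiF x⁻¹ p q = thetaF x q * thetaF x⁻¹ p := by
  unfold chiF thetaF
  rw [sPoch_eq_one_sub_mul hp x, sPoch_eq_one_sub_mul hp x⁻¹, sPoch_eq_one_sub_mul hq x,
    div_inv_eq_mul, ← div_eq_mul_inv, ← div_eq_mul_inv]
  ring

lemma chiF_eq (hp : ‖p‖ < 1) (x : ℂ) :
    chiF x p q = (1 - x) * (sPoch (p * x) p * sPoch (q * x) q) := by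
  rw [chiF, sPoch_eq_one_sub_mul hp x, mul_assoc]

/-- The elliptic Gamma function with its pole at `1` removed. -/
noncomputable def regGamma (x p q : ℂ) : ℂ :=
  dPoch (p * q / x) p q / (sPoch (p * x) p * dPoch (q * x) p q)

lemma ellGamma_eq_regGamma (hp : ‖p‖ < 1) (hq : ‖q‖ < 1) (x : ℂ) :
    ellGamma x p q = regGamma x p q / (1 - x) := by
  rw [ellGamma_eq_div hp hq, regGamma, div_div, dPoch_eq_sPoch_mul hp hq x,
    sPoch_eq_one_sub_mul hp x]
  congr 1; ring

lemma regGamma_one (hp : ‖p‖ < 1) (hq : ‖q‖ < 1) :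
    regGamma 1 p q = (qPoch p * qPoch q)⁻¹ := by
  have hpq : dPoch (p * q) p q ≠ 0 := dPoch_ne_zero_of_norm_lt hp hq (by
    rw [norm_mul]; nlinarith [norm_nonneg p, norm_nonneg q])
  rw [regGamma, mul_one, mul_one, div_one, dPoch_eq_sPoch_mul' hp hq q, sPoch_self, sPoch_self]
  field_simp

lemma qPoch_ne_zero (hp : ‖p‖ < 1) : qPoch p ≠ 0 := by
  rw [← sPoch_self]; exact sPoch_ne_zero_of_norm_lt hp hp

end ellGamma

lemma ContinuousOn.thetaF {X : Type*} [TopologicalSpace X] {s : Set X} {x p : X → ℂ}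
    (hx : ContinuousOn x s) (hp : ContinuousOn p s)
    (hp1 : ∀ a ∈ s, ‖p a‖ < 1) (hx0 : ∀ a ∈ s, x a ≠ 0) :
    ContinuousOn (fun a => thetaF (x a) (p a)) s :=
  (hx.sPoch hp hp1).mul ((hp.div hx hx0).sPoch hp hp1)

lemma DifferentiableOn.thetaF {U : Set ℂ} (hU : IsOpen U) {x p : ℂ → ℂ}
    (hx : DifferentiableOn ℂ x U) (hp : DifferentiableOn ℂ p U)
    (hp1 : ∀ a ∈ U, ‖p a‖ < 1) (hx0 : ∀ a ∈ U, x a ≠ 0) :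
    DifferentiableOn ℂ (fun a => thetaF (x a) (p a)) U :=
  (hx.sPoch hU hp hp1).mul ((hp.div hx hx0).sPoch hU hp hp1)

lemma ContinuousOn.chiF {X : Type*} [TopologicalSpace X] {s : Set X} {x p q : X → ℂ}
    (hx : ContinuousOn x s) (hp : ContinuousOn p s) (hq : ContinuousOn q s)
    (hp1 : ∀ a ∈ s, ‖p a‖ < 1) (hq1 : ∀ a ∈ s, ‖q a‖ < 1) :
    ContinuousOn (fun a => chiF (x a) (p a) (q a)) s :=
  (hx.sPoch hp hp1).mul ((hq.mul hx).sPoch hq hq1)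

lemma DifferentiableOn.chiF {U : Set ℂ} (hU : IsOpen U) {x p q : ℂ → ℂ}
    (hx : DifferentiableOn ℂ x U) (hp : DifferentiableOn ℂ p U) (hq : DifferentiableOn ℂ q U)
    (hp1 : ∀ a ∈ U, ‖p a‖ < 1) (hq1 : ∀ a ∈ U, ‖q a‖ < 1) :
    DifferentiableOn ℂ (fun a => chiF (x a) (p a) (q a)) U :=
  (hx.sPoch hU hp hp1).mul ((hq.mul hx).sPoch hU hq hq1)

lemma ContinuousOn.ellGamma {X : Type*} [TopologicalSpace X] {s : Set X} {x p q : X → ℂ}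
    (hx : ContinuousOn x s) (hp : ContinuousOn p s) (hq : ContinuousOn q s)
    (hp1 : ∀ a ∈ s, ‖p a‖ < 1) (hq1 : ∀ a ∈ s, ‖q a‖ < 1) (hx0 : ∀ a ∈ s, x a ≠ 0)
    (hx1 : ∀ a ∈ s, ‖x a‖ < 1) :
    ContinuousOn (fun a => ellGamma (x a) (p a) (q a)) s := by
  refine ((((hp.mul hq).div hx hx0).dPoch hp hq hp1 hq1).div (hx.dPoch hp hq hp1 hq1)
    fun a ha => dPoch_ne_zero_of_norm_lt (hp1 a ha) (hq1 a ha) (hx1 a ha)).congr fun a ha => ?_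
  rw [ellGamma_eq_div (hp1 a ha) (hq1 a ha)]
  rfl

lemma DifferentiableOn.ellGamma {U : Set ℂ} (hU : IsOpen U) {x p q : ℂ → ℂ}
    (hx : DifferentiableOn ℂ x U) (hp : DifferentiableOn ℂ p U) (hq : DifferentiableOn ℂ q U)
    (hp1 : ∀ a ∈ U, ‖p a‖ < 1) (hq1 : ∀ a ∈ U, ‖q a‖ < 1) (hx0 : ∀ a ∈ U, x a ≠ 0)
    (hx1 : ∀ a ∈ U, ‖x a‖ < 1) :
    DifferentiableOn ℂ (fun a => ellGamma (x a) (p a) (q a)) U := by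
  refine ((((hp.mul hq).div hx hx0).dPoch hU hp hq hp1 hq1).div (hx.dPoch hU hp hq hp1 hq1)
    fun a ha => dPoch_ne_zero_of_norm_lt (hp1 a ha) (hq1 a ha) (hx1 a ha)).congr fun a ha => ?_
  rw [ellGamma_eq_div (hp1 a ha) (hq1 a ha)]
  rfl

lemma ContinuousOn.regGamma {X : Type*} [TopologicalSpace X] {s : Set X} {x p q : X → ℂ}
    (hx : ContinuousOn x s) (hp : ContinuousOn p s) (hq : ContinuousOn q s)
    (hp1 : ∀ a ∈ s, ‖p a‖ < 1) (hq1 : ∀ a ∈ s, ‖q a‖ < 1) (hx0 : ∀ a ∈ s, x a ≠ 0)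
    (hx1 : ∀ a ∈ s, ‖x a‖ ≤ 1) :
    ContinuousOn (fun a => regGamma (x a) (p a) (q a)) s := by
  refine (((hp.mul hq).div hx hx0).dPoch hp hq hp1 hq1).div
    (((hp.mul hx).sPoch hp hp1).mul ((hq.mul hx).dPoch hp hq hp1 hq1)) fun a ha => ?_
  refine mul_ne_zero (sPoch_ne_zero_of_norm_lt (hp1 a ha) ?_)
    (dPoch_ne_zero_of_norm_lt (hp1 a ha) (hq1 a ha) ?_)
  · rw [norm_mul]; nlinarith [norm_nonneg (x a), norm_nonneg (p a), hp1 a ha, hx1 a ha]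
  · rw [norm_mul]; nlinarith [norm_nonneg (x a), norm_nonneg (q a), hq1 a ha, hx1 a ha]

instance fact_two_pi_pos : Fact (0 < 2 * Real.pi) := ⟨Real.two_pi_pos⟩

/-- The circle as an additive group. -/
abbrev TT := AddCircle (2 * Real.pi)

/-- The normalised Haar measure on the circle. -/
noncomputable abbrev muT : Measure TT := AddCircle.haarAddCircle

/-- The standard character of the circle. -/
noncomputable def eT (a : TT) : ℂ := (AddCircle.toCircle a : ℂ)

lemma eT_coe (x : ℝ) : eT (x : TT) = Complex.exp (Complex.I * x) := by
  rw [eT, AddCircle.toCircle_apply_mk, Circle.coe_exp, div_self Real.two_pi_pos.ne', one_mul,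
    mul_comm]

lemma eT_add (a b : TT) : eT (a + b) = eT a * eT b := by
  simp [eT, AddCircle.toCircle_add]

lemma eT_zero : eT 0 = 1 := by simp [eT]

lemma eT_neg (a : TT) : eT (-a) = (eT a)⁻¹ := by
  simp [eT, AddCircle.toCircle_neg]

@[simp] lemma norm_eT (a : TT) : ‖eT a‖ = 1 := Circle.norm_coe _

lemma eT_ne_zero (a : TT) : eT a ≠ 0 := by
  rw [← norm_pos_iff, norm_eT]; exact one_pos

lemma continuous_eT : Continuous eT :=
  continuous_subtype_val.comp AddCircle.continuous_toCircle

lemma exists_eT_eq {κ : ℂ} (h : ‖κ‖ = 1) : ∃ a, eT a = κ := by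
  refine ⟨((Complex.arg κ : ℝ) : TT), ?_⟩
  rw [eT_coe, mul_comm]
  have := Complex.norm_mul_exp_arg_mul_I κ
  rwa [h, Complex.ofReal_one, one_mul] at this

lemma eT_injective : Function.Injective eT := fun _ _ h =>
  AddCircle.injective_toCircle Real.two_pi_pos.ne' (Subtype.ext h)

lemma eT_zsmul (n : ℤ) (a : TT) : eT (n • a) = eT a ^ n := by
  simp [eT, AddCircle.toCircle_zsmul]

/-- Mean value over the circle through `c` centred at the origin. -/
noncomputable def cMean (f : ℂ → ℂ) (c : ℂ) : ℂ := ∫ a : TT, f (c * eT a) ∂muT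

lemma cMean_rotate (f : ℂ → ℂ) (c : ℂ) {κ : ℂ} (hκ : ‖κ‖ = 1) : cMean f (c * κ) = cMean f c := by
  obtain ⟨b, rfl⟩ := exists_eT_eq hκ
  unfold cMean
  rw [← integral_add_left_eq_self (μ := muT) (fun a => f (c * eT a)) b]
  simp_rw [eT_add, mul_assoc]

lemma integral_muT_eq (F : TT → ℂ) :
    ∫ a, F a ∂muT = ((2 * Real.pi)⁻¹ : ℝ) • ∫ x in (0 : ℝ)..2 * Real.pi, F x := by
  rw [AddCircle.integral_haarAddCircle]
  have := AddCircle.intervalIntegral_preimage (2 * Real.pi) 0 F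
  rw [zero_add] at this
  rw [this]

lemma cMean_eq_circleAverage (f : ℂ → ℂ) (r : ℝ) : cMean f r = Real.circleAverage f 0 r := by
  rw [cMean, integral_muT_eq, Real.circleAverage_def]
  congr 1
  refine intervalIntegral.integral_congr fun x _ => ?_
  simp [eT_coe, circleMap, mul_comm]

lemma cMean_eq_norm (f : ℂ → ℂ) {c : ℂ} (hc : c ≠ 0) : cMean f c = cMean f (‖c‖ : ℝ) := by
  have h : (‖c‖ : ℂ) ≠ 0 := by simpa using hc
  rw [← cMean_rotate f (‖c‖ : ℝ) (κ := c / ‖c‖)]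
  · rw [mul_div_cancel₀ _ h]
  · rw [norm_div, Complex.norm_real, norm_norm, div_self (by simpa using hc)]

lemma circleAverage_eq_of_differentiableOn {f : ℂ → ℂ} (hf : DifferentiableOn ℂ f {0}ᶜ) {r R : ℝ}
    (hr : 0 < r) (hR : r ≤ R) : Real.circleAverage f 0 R = Real.circleAverage f 0 r := by
  rw [Real.circleAverage_eq_circleIntegral hr.ne', Real.circleAverage_eq_circleIntegral (by linarith),
    Complex.circleIntegral_sub_center_inv_smul_eq_of_differentiable_on_annulus_off_countable hr hR
      (s := ∅) countable_empty]
  · refine hf.continuousOn.mono ?_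
    rintro z ⟨_, hz⟩ h0
    rw [mem_singleton_iff] at h0
    exact hz (by simpa [h0] using hr)
  · rintro z ⟨⟨_, hz⟩, _⟩
    refine hf.differentiableAt (isOpen_compl_singleton.mem_nhds ?_)
    rintro h0
    rw [mem_singleton_iff] at h0
    exact hz (by simpa [h0] using hr.le)

lemma cMean_eq_of_differentiableOn {f : ℂ → ℂ} (hf : DifferentiableOn ℂ f {0}ᶜ) {c d : ℂ}
    (hc : c ≠ 0) (hd : d ≠ 0) : cMean f c = cMean f d := by
  rw [cMean_eq_norm f hc, cMean_eq_norm f hd, cMean_eq_circleAverage, cMean_eq_circleAverage]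
  rcases le_total ‖c‖ ‖d‖ with h | h
  · exact (circleAverage_eq_of_differentiableOn hf (norm_pos_iff.2 hc) h).symm
  · exact circleAverage_eq_of_differentiableOn hf (norm_pos_iff.2 hd) h

/-- The Laurent coefficients of a function holomorphic on `ℂ \ {0}`. -/
noncomputable def laurentCoeff (f : ℂ → ℂ) (k : ℤ) : ℂ := cMean (fun z => f z * z ^ (-k)) 1

lemma laurentCoeff_eq_fourierCoeff (f : ℂ → ℂ) (k : ℤ) :
    laurentCoeff f k = fourierCoeff (fun a : TT => f (eT a)) k := by
  unfold laurentCoeff cMean fourierCoeff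
  refine integral_congr_ae (Eventually.of_forall fun a => ?_)
  simp only [one_mul, fourier_apply, smul_eq_mul]
  rw [mul_comm, ← eT_zsmul]; rfl

lemma eqOn_zero_of_laurentCoeff {f : ℂ → ℂ} (hf : DifferentiableOn ℂ f {0}ᶜ)
    (h : ∀ k, laurentCoeff f k = 0) {z : ℂ} (hz : z ≠ 0) : f z = 0 := by
  have hcont : Continuous fun a : TT => f (eT a) :=
    hf.continuousOn.comp_continuous continuous_eT fun a => eT_ne_zero a
  have h0 : ∀ a : TT, f (eT a) = 0 := by
    intro a
    have hfc : fourierCoeff (⟨_, hcont⟩ : C(TT, ℂ)) = 0 := by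
      ext k; exact (laurentCoeff_eq_fourierCoeff f k).symm.trans (h k)
    have := has_pointwise_sum_fourier_series_of_summable (f := (⟨_, hcont⟩ : C(TT, ℂ)))
      (by rw [hfc]; exact summable_zero) a
    rw [hfc] at this
    simpa using this.unique (by simp [hasSum_zero])
  have han : AnalyticOnNhd ℂ f {0}ᶜ := hf.analyticOnNhd isOpen_compl_singleton
  have hpre : IsPreconnected ({0}ᶜ : Set ℂ) :=
    (isConnected_compl_singleton_of_one_lt_rank (by simp) 0).isPreconnected
  refine han.eqOn_zero_of_preconnected_of_frequently_eq_zero hpre (z₀ := 1) (by simp) ?_ hz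
  have ht : Tendsto (fun x : ℝ => eT (x : TT)) (𝓝[≠] 0) (𝓝[≠] 1) := by
    refine tendsto_nhdsWithin_iff.2 ⟨?_, ?_⟩
    · have : Continuous fun x : ℝ => eT (x : TT) := by
        simp_rw [eT_coe]; fun_prop
      have h2 := (this.tendsto 0).mono_left (nhdsWithin_le_nhds (s := {0}ᶜ))
      simpa [eT_zero] using h2
    · have : ∀ᶠ x : ℝ in 𝓝[≠] 0, x ∈ Ioo (-Real.pi) Real.pi :=
        nhdsWithin_le_nhds (Ioo_mem_nhds (by linarith [Real.pi_pos]) Real.pi_pos)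
      filter_upwards [this, self_mem_nhdsWithin] with x hx hx0 h1
      have h1 : eT (x : TT) = eT ((0 : ℝ) : TT) := by
        rw [h1]; simp [eT_zero]
      rw [eT_coe, eT_coe, Complex.exp_eq_exp_iff_exists_int] at h1
      obtain ⟨n, hn⟩ := h1
      have hn' : x = n * (2 * Real.pi) := by
        have := congrArg Complex.im hn
        simpa using this
      have hn0 : n ≠ 0 := by
        rintro rfl; simp at hn'; exact hx0 hn'
      have : (1 : ℝ) ≤ |(n : ℝ)| := by exact_mod_cast Int.one_le_abs hn0
      have h3 : |x| < Real.pi := abs_lt.2 hx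
      rw [hn', abs_mul, abs_of_pos Real.two_pi_pos] at h3
      nlinarith [Real.pi_pos]
  exact ht.frequently (Frequently.of_forall fun x => h0 x)

/-- Holomorphic functions on `ℂ \ {0}` with a degree two multiplier are determined by two
Laurent coefficients. -/
lemma eq_zero_of_quasiperiodic {f : ℂ → ℂ} (hf : DifferentiableOn ℂ f {0}ᶜ) {p κ : ℂ} (hp0 : p ≠ 0)
    (hκ : κ ≠ 0) (hqp : ∀ z, z ≠ 0 → f (p * z) = κ * (z ^ 2)⁻¹ * f z)
    (h0 : laurentCoeff f 0 = 0) (h1 : laurentCoeff f 1 = 0) {z : ℂ} (hz : z ≠ 0) : f z = 0 := by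
  have hd : ∀ k : ℤ, DifferentiableOn ℂ (fun z => f z * z ^ (-k)) {0}ᶜ := fun k =>
    hf.mul (differentiableOn_zpow _ _ (Or.inl (by simp)))
  have hrec : ∀ k : ℤ, laurentCoeff f k = κ * p ^ (-k) * laurentCoeff f (k + 2) := by
    intro k
    unfold laurentCoeff
    rw [cMean_eq_of_differentiableOn (hd k) one_ne_zero hp0]
    unfold cMean
    rw [← integral_const_mul]
    refine integral_congr_ae (Eventually.of_forall fun a => ?_)
    have ha := eT_ne_zero a
    simp only [one_mul]
    rw [hqp _ ha, mul_zpow, show -(k + 2) = -k - 2 by ring, zpow_sub₀ ha]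
    simp only [zpow_ofNat]
    ring
  have hup : ∀ n : ℕ, laurentCoeff f n = 0 ∧ laurentCoeff f (n + 1) = 0 := by
    intro n
    induction n with
    | zero => simpa using ⟨h0, h1⟩
    | succ n ih =>
      refine ⟨by exact_mod_cast ih.2, ?_⟩
      have := hrec n
      rw [ih.1, eq_comm, mul_eq_zero] at this
      rcases this with h | h
      · exact absurd h (mul_ne_zero hκ (zpow_ne_zero _ hp0))
      · rw [← h]; push_cast; ring_nf
  have hdown : ∀ n : ℕ, laurentCoeff f (-n) = 0 ∧ laurentCoeff f (-n + 1) = 0 := by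
    intro n
    induction n with
    | zero => simpa using ⟨h0, h1⟩
    | succ n ih =>
      refine ⟨?_, ?_⟩
      · rw [hrec, show (-((n + 1 : ℕ) : ℤ) + 2) = -n + 1 by push_cast; ring, ih.2, mul_zero]
      · rw [← ih.1]; push_cast; ring_nf
  refine eqOn_zero_of_laurentCoeff hf (fun k => ?_) hz
  obtain ⟨n, rfl | rfl⟩ := k.eq_nat_or_neg
  · exact (hup n).1
  · exact (hdown n).1

lemma laurentCoeff_comb {f g h : ℂ → ℂ} (hf : ContinuousOn f {0}ᶜ) (hg : ContinuousOn g {0}ᶜ)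
    (hh : ContinuousOn h {0}ᶜ) (a b c : ℂ) (k : ℤ) :
    laurentCoeff (fun z => a * f z + b * g z + c * h z) k =
      a * laurentCoeff f k + b * laurentCoeff g k + c * laurentCoeff h k := by
  have hInt : ∀ F : ℂ → ℂ, ContinuousOn F {0}ᶜ →
      Integrable (fun t : TT => F (1 * eT t) * (1 * eT t) ^ (-k)) muT := by
    intro F hF
    refine Continuous.integrable_of_hasCompactSupport ?_ (HasCompactSupport.of_compactSpace _)
    simp only [one_mul]
    exact (hF.comp_continuous continuous_eT fun a => eT_ne_zero a).mul
      (continuous_eT.zpow₀ _ fun a => Or.inl (eT_ne_zero a))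
  unfold laurentCoeff cMean
  simp_rw [← integral_const_mul]
  rw [← integral_add ((hInt f hf).const_mul a) ((hInt g hg).const_mul b), ← integral_add]
  · refine integral_congr_ae (Eventually.of_forall fun t => ?_)
    simp only; ring
  · exact ((hInt f hf).const_mul a).add ((hInt g hg).const_mul b)
  · exact (hInt h hh).const_mul c

lemma differentiableOn_thetaF_mul {p : ℂ} (hp : ‖p‖ < 1) {a : ℂ} (ha : a ≠ 0) :
    DifferentiableOn ℂ (fun c => thetaF (c * a) p) {0}ᶜ :=
  DifferentiableOn.thetaF isOpen_compl_singleton (by fun_prop) (by fun_prop) (fun _ _ => hp)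
    fun _ hc => mul_ne_zero hc ha

/-- The three term relation for theta functions. -/
lemma theta_three_term {p : ℂ} (hp : ‖p‖ < 1) (hp0 : p ≠ 0) {a b e f c : ℂ} (ha : a ≠ 0)
    (hb : b ≠ 0) (he : e ≠ 0) (hf : f ≠ 0) (hc : c ≠ 0) (hab : a * b = e * f)
    (hta : thetaF a p ≠ 0) (htb : thetaF b p ≠ 0) :
    thetaF (c * a) p * thetaF (c * b) p * (thetaF e p * thetaF f p) -
      thetaF (c * e) p * thetaF (c * f) p * (thetaF a p * thetaF b p) =
    a * thetaF c p * thetaF (c * (a * b)) p * (thetaF (e / a) p * thetaF (f / a) p) := by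
  set E : ℂ → ℂ := fun c => thetaF (c * a) p * thetaF (c * b) p with hE
  set E' : ℂ → ℂ := fun c => thetaF (c * e) p * thetaF (c * f) p with hE'
  set D : ℂ → ℂ := fun c => thetaF (c * 1) p * thetaF (c * (a * b)) p with hD
  have habn := mul_ne_zero ha hb
  have dE : DifferentiableOn ℂ E {0}ᶜ :=
    (differentiableOn_thetaF_mul hp ha).mul (differentiableOn_thetaF_mul hp hb)
  have dE' : DifferentiableOn ℂ E' {0}ᶜ :=
    (differentiableOn_thetaF_mul hp he).mul (differentiableOn_thetaF_mul hp hf)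
  have dD : DifferentiableOn ℂ D {0}ᶜ :=
    (differentiableOn_thetaF_mul hp one_ne_zero).mul (differentiableOn_thetaF_mul hp habn)
  have qp : ∀ x y z : ℂ, x ≠ 0 → y ≠ 0 → z ≠ 0 → x * y = a * b →
      thetaF (p * z * x) p * thetaF (p * z * y) p =
        (a * b)⁻¹ * (z ^ 2)⁻¹ * (thetaF (z * x) p * thetaF (z * y) p) := by
    intro x y z hx hy hz hxy
    rw [mul_assoc p, mul_assoc p, thetaF_mul_left hp hp0 (mul_ne_zero hz hx),
      thetaF_mul_left hp hp0 (mul_ne_zero hz hy), ← hxy]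
    field_simp
  let L : (Fin 3 → ℂ) →ₗ[ℂ] (Fin 2 → ℂ) := Matrix.toLin' !![laurentCoeff E 0, laurentCoeff E' 0,
    laurentCoeff D 0; laurentCoeff E 1, laurentCoeff E' 1, laurentCoeff D 1]
  obtain ⟨k, hk0, hk⟩ := Submodule.exists_mem_ne_zero_of_ne_bot
    (LinearMap.ker_ne_bot_of_finrank_lt (f := L) (by simp))
  have hk1 := congrFun (LinearMap.mem_ker.1 hk0) 0
  have hk2 := congrFun (LinearMap.mem_ker.1 hk0) 1
  simp [L, Matrix.mulVec, dotProduct, Fin.sum_univ_three] at hk1 hk2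
  have hzero : ∀ z, z ≠ 0 → k 0 * E z + k 1 * E' z + k 2 * D z = 0 := by
    intro z hz
    refine eq_zero_of_quasiperiodic (f := fun z => k 0 * E z + k 1 * E' z + k 2 * D z)
      (((dE.const_mul _).add (dE'.const_mul _)).add (dD.const_mul _)) hp0 (inv_ne_zero habn)
      (fun z hz => ?_) ?_ ?_ hz
    · simp only [hE, hE', hD]
      rw [qp a b z ha hb hz rfl, qp e f z he hf hz hab.symm,
        qp 1 (a * b) z one_ne_zero habn hz (one_mul _)]
      ring
    · rw [laurentCoeff_comb dE.continuousOn dE'.continuousOn dD.continuousOn, ← hk1]; ring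
    · rw [laurentCoeff_comb dE.continuousOn dE'.continuousOn dD.continuousOn, ← hk2]; ring
  have h1 := hzero 1 one_ne_zero
  have h2 := hzero a⁻¹ (inv_ne_zero ha)
  have h3 := hzero c hc
  simp only [hE, hE', hD, one_mul, mul_one, thetaF_one hp, inv_mul_cancel₀ ha, zero_mul,
    inv_mul_cancel_left₀ ha, mul_zero, add_zero, zero_add] at h1 h2 h3
  rw [thetaF_inv hp ha, ← div_eq_inv_mul, ← div_eq_inv_mul] at h2
  have hk1 : k 1 ≠ 0 := by
    intro h
    rw [h] at h1 h2
    have e0 : k 0 = 0 := by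
      rw [zero_mul, add_zero] at h1
      exact (mul_eq_zero.1 h1).resolve_right (mul_ne_zero hta htb)
    have e2 : k 2 = 0 := by
      rw [zero_mul, zero_add] at h2
      refine (mul_eq_zero.1 h2).resolve_right (mul_ne_zero (mul_ne_zero ?_ hta) htb)
      exact neg_ne_zero.2 (inv_ne_zero ha)
    apply hk
    ext i; fin_cases i <;> simp [e0, h, e2]
  have h2' : k 2 * (thetaF a p * thetaF b p) = k 1 * a * (thetaF (e / a) p * thetaF (f / a) p) := by
    field_simp at h2
    linear_combination -h2
  apply mul_left_cancel₀ hk1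
  linear_combination (thetaF a p * thetaF b p) * (-h3) + thetaF (c * a) p * thetaF (c * b) p * h1
    + thetaF c p * thetaF (c * (a * b)) p * h2'

lemma Matrix.det_schur_zero {n : ℕ} (M : Matrix (Fin (n + 1)) (Fin (n + 1)) ℂ) (h : M 0 0 ≠ 0) :
    M.det = M 0 0 * (Matrix.of fun i j : Fin n =>
      M i.succ j.succ - M i.succ 0 * M 0 j.succ / M 0 0).det := by
  set B : Matrix (Fin (n + 1)) (Fin (n + 1)) ℂ := fun i j =>
    if i = 0 then M 0 j else M i j - M i 0 / M 0 0 * M 0 j with hB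
  have h1 : M.det = B.det := by
    refine Matrix.det_eq_of_forall_row_eq_smul_add_const (fun i => if i = 0 then 0 else M i 0 / M 0 0)
      0 (by simp) fun i j => ?_
    simp only [hB]
    by_cases hi : i = 0
    · simp [hi]
    · simp [hi]
  rw [h1, Matrix.det_succ_column_zero, Fin.sum_univ_succ]
  have h2 : ∀ i : Fin n, B i.succ 0 = 0 := by
    intro i; simp only [hB, Fin.succ_ne_zero, if_false]; field_simp; ring
  have h3 : B 0 0 = M 0 0 := by simp [hB]
  simp only [h2, h3, mul_zero, zero_mul, Finset.sum_const_zero, add_zero, Fin.val_zero, pow_zero,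
    one_mul]
  have h4 : ∀ (i : Fin n) j, B i.succ j = M i.succ j - M i.succ 0 / M 0 0 * M 0 j := by
    intro i j; simp [hB, Fin.succ_ne_zero]
  congr 2
  ext i j
  simp only [Matrix.submatrix_apply, Fin.succAbove_zero, h4, Matrix.of_apply]
  ring

/-- The theta function analogue of the Vandermonde product. -/
noncomputable def thetaV {n : ℕ} (p : ℂ) (z : Fin n → ℂ) : ℂ :=
  ∏ i, ∏ j, if i < j then z j * thetaF (z i / z j) p else 1

lemma thetaV_succ {n : ℕ} (p : ℂ) (z : Fin (n + 1) → ℂ) :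
    thetaV p z = (∏ j : Fin n, z j.succ * thetaF (z 0 / z j.succ) p) * thetaV p (fun j => z j.succ) := by
  unfold thetaV
  rw [Fin.prod_univ_succ]
  congr 1
  · rw [Fin.prod_univ_succ]; simp
  · refine Finset.prod_congr rfl fun i _ => ?_
    rw [Fin.prod_univ_succ]; simp

/-- Frobenius' determinant. -/
lemma frobenius_det {p : ℂ} (hp : ‖p‖ < 1) (hp0 : p ≠ 0) (n : ℕ) :
    ∀ (c : ℂ) (x z : Fin (n + 1) → ℂ), c ≠ 0 → (∀ k, x k ≠ 0) → (∀ k, z k ≠ 0) →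
      (∀ k i, thetaF (x k * z i) p ≠ 0) →
      (∀ S : Finset (Fin (n + 1)), thetaF (c * ∏ k ∈ S, x k * z k) p ≠ 0) →
      (Matrix.of fun k i => thetaF (c * (x k * z i)) p / thetaF (x k * z i) p).det =
        thetaF c p ^ n * thetaF (c * ∏ k, x k * z k) p * (thetaV p x * thetaV p z) /
          ∏ k, ∏ i, thetaF (x k * z i) p := by
  induction n with
  | zero =>
    intro c x z hc hx hz h hg
    simp [thetaV]
  | succ n ih =>
    intro c x z hc hx hz h hg
    have hg0 : thetaF (c * (x 0 * z 0)) p ≠ 0 := by simpa using hg {0}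
    have hM : thetaF (c * (x 0 * z 0)) p / thetaF (x 0 * z 0) p ≠ 0 := div_ne_zero hg0 (h 0 0)
    have hind := ih (c * (x 0 * z 0)) (fun k => x k.succ) (fun k => z k.succ)
      (mul_ne_zero hc (mul_ne_zero (hx 0) (hz 0))) (fun k => hx _) (fun k => hz _)
      (fun k i => h _ _) (fun S => by
        have := hg (insert 0 (S.map (Fin.succEmb _)))
        rw [Finset.prod_insert (by simp [Fin.succ_ne_zero])] at this
        simpa [mul_assoc] using this)
    rw [Matrix.det_schur_zero _ (by simpa using hM)]
    have hent : (Matrix.of fun k i : Fin (n + 1) =>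
        (Matrix.of fun k i => thetaF (c * (x k * z i)) p / thetaF (x k * z i) p) k.succ i.succ -
        (Matrix.of fun k i => thetaF (c * (x k * z i)) p / thetaF (x k * z i) p) k.succ 0 *
        (Matrix.of fun k i => thetaF (c * (x k * z i)) p / thetaF (x k * z i) p) 0 i.succ /
        (Matrix.of fun k i => thetaF (c * (x k * z i)) p / thetaF (x k * z i) p) 0 0) =
        (thetaF c p / thetaF (c * (x 0 * z 0)) p) • (Matrix.of fun k i : Fin (n + 1) =>
          (x k.succ * thetaF (x 0 / x k.succ) p / thetaF (x k.succ * z 0) p) *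
          ((Matrix.of fun k i : Fin (n + 1) =>
            (z i.succ * thetaF (z 0 / z i.succ) p / thetaF (x 0 * z i.succ) p) *
          (Matrix.of fun k i : Fin (n + 1) => thetaF (c * (x 0 * z 0) * (x k.succ * z i.succ)) p /
            thetaF (x k.succ * z i.succ) p) k i) k i)) := by
      ext k i
      simp only [Matrix.of_apply, Matrix.smul_apply, smul_eq_mul]
      have h3 := theta_three_term hp hp0 (c := c) (a := x k.succ * z i.succ) (b := x 0 * z 0)
        (e := x k.succ * z 0) (f := x 0 * z i.succ) (mul_ne_zero (hx _) (hz _))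
        (mul_ne_zero (hx _) (hz _)) (mul_ne_zero (hx _) (hz _)) (mul_ne_zero (hx _) (hz _))
        hc (by ring) (h _ _) (h _ _)
      rw [mul_div_mul_left _ _ (hx k.succ), mul_div_mul_right _ _ (hz i.succ),
        show c * (x k.succ * z i.succ * (x 0 * z 0)) = c * (x 0 * z 0) * (x k.succ * z i.succ) by
          ring] at h3
      have a1 := h k.succ i.succ
      have a2 := h 0 0
      have a3 := h k.succ 0
      have a4 := h 0 i.succ
      generalize thetaF (c * (x 0 * z 0) * (x k.succ * z i.succ)) p = A1 at *
      generalize thetaF (c * (x 0 * z 0)) p = A2 at *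
      generalize thetaF (c * (x k.succ * z i.succ)) p = A3 at *
      generalize thetaF (c * (x k.succ * z 0)) p = A4 at *
      generalize thetaF (c * (x 0 * z i.succ)) p = A5 at *
      generalize thetaF (x k.succ * z i.succ) p = A6 at *
      generalize thetaF (x 0 * z 0) p = A7 at *
      generalize thetaF (x k.succ * z 0) p = A8 at *
      generalize thetaF (x 0 * z i.succ) p = A9 at *
      field_simp
      linear_combination h3
    rw [hent, Matrix.det_smul, Matrix.det_mul_column, Matrix.det_mul_row, hind, thetaV_succ p x,
      thetaV_succ p z]
    simp only [Matrix.of_apply, Fintype.card_fin]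
    have hP0 : (∏ k : Fin (n + 1), ∏ i : Fin (n + 1), thetaF (x k.succ * z i.succ) p) ≠ 0 :=
      Finset.prod_ne_zero_iff.2 fun k _ => Finset.prod_ne_zero_iff.2 fun i _ => h _ _
    have hP1 : (∏ k : Fin (n + 1), thetaF (x k.succ * z 0) p) ≠ 0 :=
      Finset.prod_ne_zero_iff.2 fun k _ => h _ _
    have hP2 : (∏ k : Fin (n + 1), thetaF (x 0 * z k.succ) p) ≠ 0 :=
      Finset.prod_ne_zero_iff.2 fun k _ => h _ _
    have hPP : (∏ k : Fin (n + 2), ∏ i : Fin (n + 2), thetaF (x k * z i) p) =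
        thetaF (x 0 * z 0) p * (∏ k : Fin (n + 1), thetaF (x 0 * z k.succ) p) *
        ((∏ k : Fin (n + 1), thetaF (x k.succ * z 0) p) *
          ∏ k : Fin (n + 1), ∏ i : Fin (n + 1), thetaF (x k.succ * z i.succ) p) := by
      rw [Fin.prod_univ_succ, Fin.prod_univ_succ, ← Finset.prod_mul_distrib]
      congr 1
      exact Finset.prod_congr rfl fun k _ => Fin.prod_univ_succ _
    have hXZ : c * ∏ k : Fin (n + 2), x k * z k =
        c * (x 0 * z 0) * ∏ k : Fin (n + 1), x k.succ * z k.succ := by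
      rw [Fin.prod_univ_succ]; ring
    rw [hPP, hXZ, Finset.prod_div_distrib, Finset.prod_div_distrib]
    have a2 := h 0 0
    generalize thetaF (c * (x 0 * z 0)) p = A2 at *
    generalize thetaF (x 0 * z 0) p = A7 at *
    generalize (∏ k : Fin (n + 1), ∏ i : Fin (n + 1), thetaF (x k.succ * z i.succ) p) = B0 at *
    generalize (∏ k : Fin (n + 1), thetaF (x k.succ * z 0) p) = B1 at *
    generalize (∏ k : Fin (n + 1), thetaF (x 0 * z k.succ) p) = B2 at *
    generalize (∏ k : Fin (n + 1), x k.succ * z k.succ) = B3 at *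
    rw [div_pow]
    field_simp
    ring

/-- The normalised Haar measure on the torus. -/
noncomputable abbrev muP (N : ℕ) : Measure (Fin N → TT) := Measure.pi fun _ => muT

/-- The point of the torus with last coordinates `θ` and coordinate sum `ζ`. -/
noncomputable def torusVec {N : ℕ} (ζ : TT) (θ : Fin N → TT) : Fin (N + 1) → TT := Fin.cons (ζ - ∑ j, θ j) θ

/-- Integral over the coset of the torus with coordinate sum `ζ`. -/
noncomputable def torusInt (N : ℕ) (ζ : TT) (F : (Fin (N + 1) → TT) → ℂ) : ℂ :=
  ∫ θ, F (torusVec ζ θ) ∂muP N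

lemma sum_torusVec {N : ℕ} (ζ : TT) (θ : Fin N → TT) : ∑ i, torusVec ζ θ i = ζ := by
  simp [torusVec, Fin.sum_univ_succ]

lemma torusVec_tail {N : ℕ} (ζ : TT) (v : Fin (N + 1) → TT) (h : ∑ i, v i = ζ) :
    torusVec ζ (Fin.tail v) = v := by
  funext i
  refine Fin.cases ?_ (fun j => ?_) i
  · simp only [torusVec, Fin.cons_zero, Fin.tail]
    rw [← h, Fin.sum_univ_succ]; abel
  · simp [torusVec, Fin.tail]

lemma tail_torusVec {N : ℕ} (ζ : TT) (θ : Fin N → TT) : Fin.tail (torusVec ζ θ) = θ := by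
  simp [torusVec]

lemma torusVec_add {N : ℕ} (ζ ζ' : TT) (θ θ' : Fin N → TT) :
    torusVec (ζ + ζ') (θ + θ') = torusVec ζ θ + torusVec ζ' θ' := by
  funext i
  refine Fin.cases ?_ (fun j => ?_) i
  · simp only [torusVec, Fin.cons_zero, Pi.add_apply, Finset.sum_add_distrib]; abel
  · simp [torusVec]

lemma continuous_torusVec {N : ℕ} : Continuous fun x : TT × (Fin N → TT) => torusVec x.1 x.2 := by
  refine continuous_pi fun i => ?_
  refine Fin.cases ?_ (fun j => ?_) i
  · simp only [torusVec, Fin.cons_zero]; fun_prop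
  · simp only [torusVec, Fin.cons_succ]; fun_prop

lemma continuous_torusVec_right {N : ℕ} (ζ : TT) :
    Continuous fun θ : Fin N → TT => torusVec ζ θ :=
  continuous_torusVec.comp (Continuous.prodMk_right ζ)

lemma torusInt_add {N : ℕ} (ζ : TT) (κ : Fin (N + 1) → TT) (F : (Fin (N + 1) → TT) → ℂ) :
    torusInt N ζ (fun v => F (v + κ)) = torusInt N (ζ + ∑ i, κ i) F := by
  unfold torusInt
  rw [← integral_add_right_eq_self (μ := muP N) (fun θ => F (torusVec (ζ + ∑ i, κ i) θ))
    (Fin.tail κ)]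
  refine integral_congr_ae (Eventually.of_forall fun θ => ?_)
  simp only
  rw [torusVec_add, torusVec_tail _ κ rfl]

lemma measurePreserving_perm {N : ℕ} (ζ : TT) (σ : Equiv.Perm (Fin (N + 1))) :
    MeasurePreserving (fun θ : Fin N → TT => Fin.tail (torusVec ζ θ ∘ σ)) (muP N) (muP N) := by
  let f : (Fin N → TT) →+ (Fin N → TT) :=
    { toFun := fun θ => Fin.tail (torusVec 0 θ ∘ σ)
      map_zero' := by
        have : torusVec (0 : TT) (0 : Fin N → TT) = 0 := by
          have := torusVec_tail (0 : TT) (0 : Fin (N + 1) → TT) (by simp)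
          exact this
        rw [this]; rfl
      map_add' := fun θ θ' => by
        have := torusVec_add 0 0 θ θ'
        rw [add_zero] at this
        rw [this]; rfl }
  have hf : Continuous f := by
    change Continuous fun θ : Fin N → TT => Fin.tail (torusVec 0 θ ∘ σ)
    exact continuous_pi fun j => (continuous_apply _).comp (continuous_torusVec_right 0)
  have hs : Function.Surjective f := by
    intro θ'
    refine ⟨Fin.tail (torusVec 0 θ' ∘ σ.symm), ?_⟩
    change Fin.tail (torusVec 0 _ ∘ σ) = θ'
    rw [torusVec_tail]
    · have : (torusVec 0 θ' ∘ σ.symm) ∘ σ = torusVec 0 θ' := by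
        funext i; simp
      rw [this, tail_torusVec]
    · exact (Equiv.sum_comp σ.symm _).trans (sum_torusVec 0 θ')
  have h1 : MeasurePreserving f (muP N) (muP N) :=
    f.measurePreserving hf hs (by simp)
  have h2 := (measurePreserving_add_right (muP N) (Fin.tail (torusVec ζ (0 : Fin N → TT) ∘ σ))).comp h1
  convert h2 using 1
  funext θ
  change _ = Fin.tail (torusVec 0 θ ∘ σ) + _
  have : torusVec ζ θ = torusVec 0 θ + torusVec ζ 0 := by
    rw [← torusVec_add, zero_add, add_zero]
  rw [this]; rfl

lemma torusInt_perm {N : ℕ} (ζ : TT) (σ : Equiv.Perm (Fin (N + 1)))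
    {F : (Fin (N + 1) → TT) → ℂ} (hF : Continuous F) :
    torusInt N ζ (fun v => F (v ∘ σ)) = torusInt N ζ F := by
  unfold torusInt
  have h := measurePreserving_perm ζ σ
  have hc : Continuous fun θ => F (torusVec ζ θ) := hF.comp (continuous_torusVec_right ζ)
  have h3 := integral_map h.measurable.aemeasurable (f := fun θ => F (torusVec ζ θ))
    (by rw [h.map_eq]; exact hc.aestronglyMeasurable)
  rw [h.map_eq] at h3
  rw [h3]
  refine integral_congr_ae (Eventually.of_forall fun θ => ?_)
  simp only
  rw [torusVec_tail ζ (torusVec ζ θ ∘ σ) ((Equiv.sum_comp σ (torusVec ζ θ)).trans (sum_torusVec ζ θ))]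

lemma integrable_of_continuous_torus {N : ℕ} {G : (Fin N → TT) → ℂ} (hG : Continuous G) :
    Integrable G (muP N) :=
  hG.integrable_of_hasCompactSupport (HasCompactSupport.of_compactSpace _)

lemma integral_muP_succ {N : ℕ} {G : (Fin (N + 1) → TT) → ℂ} (hG : Continuous G) :
    ∫ θ, G θ ∂muP (N + 1) = ∫ a, ∫ θ', G (Fin.cons a θ') ∂muP N ∂muT := by
  have h := (measurePreserving_piFinSuccAbove (fun _ : Fin (N + 1) => muT) 0).symm
  rw [← h.integral_comp']
  have hc : Continuous fun x : TT × (Fin N → TT) => (Fin.cons x.1 x.2 : Fin (N + 1) → TT) := by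
    refine continuous_pi fun i => ?_
    refine Fin.cases ?_ (fun j => ?_) i
    · simp only [Fin.cons_zero]; fun_prop
    · simp only [Fin.cons_succ]; fun_prop
  rw [← integral_prod (f := fun x : TT × (Fin N → TT) => G (Fin.cons x.1 x.2))]
  · refine integral_congr_ae (Eventually.of_forall fun x => ?_)
    simp [MeasurableEquiv.piFinSuccAbove]
    rfl
  · exact (hG.comp hc).integrable_of_hasCompactSupport (HasCompactSupport.of_compactSpace _)

lemma torusInt_succ {N : ℕ} (ζ : TT) {F : (Fin (N + 2) → TT) → ℂ} (hF : Continuous F) :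
    torusInt (N + 1) ζ F = ∫ a, torusInt N (ζ - a) (fun y => F (Fin.cons a y)) ∂muT := by
  rw [← torusInt_perm ζ (Equiv.swap 0 1) hF]
  unfold torusInt
  rw [integral_muP_succ]
  · refine integral_congr_ae (Eventually.of_forall fun a => ?_)
    refine integral_congr_ae (Eventually.of_forall fun θ => ?_)
    simp only
    congr 1
    funext i
    refine Fin.cases ?_ (fun j => Fin.cases ?_ (fun k => ?_) j) i
    · simp [torusVec]
    · simp [torusVec, Fin.sum_univ_succ]; abel
    · have h1 : (k.succ.succ : Fin (N + 2)) ≠ 0 := Fin.succ_ne_zero _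
      have h2 : (k.succ.succ : Fin (N + 2)) ≠ 1 := by
        rw [← Fin.succ_zero_eq_one]; exact fun h => Fin.succ_ne_zero _ (Fin.succ_injective _ h)
      simp [torusVec, Equiv.swap_apply_of_ne_of_ne h1 h2]
  · exact hF.comp (continuous_pi fun i => (continuous_apply _).comp (continuous_torusVec_right ζ))

lemma torusInt_const_mul {N : ℕ} (ζ : TT) (c : ℂ) (F : (Fin (N + 1) → TT) → ℂ) :
    torusInt N ζ (fun v => c * F v) = c * torusInt N ζ F := integral_const_mul _ _

lemma torusInt_finset_sum {N : ℕ} (ζ : TT) {ι : Type*} (s : Finset ι)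
    {F : ι → (Fin (N + 1) → TT) → ℂ} (hF : ∀ i ∈ s, Continuous (F i)) :
    torusInt N ζ (fun v => ∑ i ∈ s, F i v) = ∑ i ∈ s, torusInt N ζ (F i) :=
  integral_finsetSum _ fun i hi =>
    integrable_of_continuous_torus ((hF i hi).comp (continuous_torusVec_right ζ))

lemma torusInt_congr {N : ℕ} (ζ : TT) {F G : (Fin (N + 1) → TT) → ℂ}
    (h : ∀ v, ∑ i, v i = ζ → F v = G v) : torusInt N ζ F = torusInt N ζ G :=
  integral_congr_ae (Eventually.of_forall fun θ => h _ (sum_torusVec ζ θ))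

instance nullSingletonClass_muT : NullSingletonClass muT := by
  refine ⟨fun b => ?_⟩
  have h : (volume : Measure TT) {b} = 0 := by
    rw [← Metric.closedBall_zero, AddCircle.volume_closedBall]
    simp [Real.two_pi_pos.le]
  rw [AddCircle.volume_eq_smul_haarAddCircle] at h
  rw [Measure.smul_apply, smul_eq_mul, mul_eq_zero] at h
  exact h.resolve_left (by simp [Real.pi_pos])

/-- Almost every point of the torus coset has a given coordinate outside a null set. -/
lemma ae_torusVec {N : ℕ} (hN : N ≠ 0) (ζ : TT) (i : Fin (N + 1)) (b : TT) :
    ∀ᵐ θ ∂muP N, torusVec ζ θ i ≠ b := by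
  have key : ∀ j : Fin N, ∀ᵐ θ ∂muP N, θ j ≠ b := by
    intro j
    exact (measurePreserving_eval (fun _ : Fin N => muT) j).quasiMeasurePreserving.ae
      (Measure.ae_ne muT b)
  obtain ⟨M, rfl⟩ := Nat.exists_eq_succ_of_ne_zero hN
  have h := (measurePreserving_perm ζ (Equiv.swap i 1)).quasiMeasurePreserving.ae (key 0)
  filter_upwards [h] with θ hθ
  simpa [Fin.tail] using hθ

lemma differentiableOn_integral_of_continuousOn {X : Type*} [TopologicalSpace X] [CompactSpace X]
    [MeasurableSpace X] [OpensMeasurableSpace X] [SecondCountableTopology X]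
    {μ : Measure X} [IsFiniteMeasure μ]
    {U : Set ℂ} (hU : IsOpen U) {f : ℂ → X → ℂ}
    (hf : ContinuousOn (fun x : ℂ × X => f x.1 x.2) (U ×ˢ univ))
    (hd : ∀ v, DifferentiableOn ℂ (fun s => f s v) U) :
    DifferentiableOn ℂ (fun s => ∫ v, f s v ∂μ) U := by
  intro s₀ hs₀
  obtain ⟨R, hR, hRU⟩ := Metric.nhds_basis_closedBall.mem_iff.1 (hU.mem_nhds hs₀)
  have hcont : ∀ s ∈ U, Continuous (f s) := fun s hs =>
    hf.comp_continuous (Continuous.prodMk_right s) fun v => ⟨hs, mem_univ _⟩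
  obtain ⟨M, hM⟩ := ((isCompact_closedBall s₀ R).prod (isCompact_univ (X := X))).exists_bound_of_continuousOn
    (hf.mono (prod_mono hRU subset_rfl))
  have hMn : ∀ s ∈ Metric.closedBall s₀ R, ∀ v, ‖f s v‖ ≤ max M 0 := fun s hs v =>
    (hM (s, v) ⟨hs, mem_univ _⟩).trans (le_max_left _ _)
  have hmem : ∀ n : ℕ, s₀ + (((R / (n + 1)) : ℝ) : ℂ) ∈ U := fun n => by
    apply hRU
    rw [Metric.mem_closedBall, dist_eq_norm, add_sub_cancel_left, Complex.norm_real,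
      Real.norm_of_nonneg (by positivity)]
    exact div_le_self hR.le (by linarith [n.cast_nonneg (α := ℝ)])
  have htend : Tendsto (fun n : ℕ => s₀ + (((R / (n + 1)) : ℝ) : ℂ)) atTop (𝓝[≠] s₀) := by
    refine tendsto_nhdsWithin_iff.2 ⟨?_, Eventually.of_forall fun n => ?_⟩
    · have h1 : Tendsto (fun n : ℕ => R / ((n : ℝ) + 1)) atTop (𝓝 0) :=
        tendsto_const_div_atTop_nhds_zero_nat R |>.comp (tendsto_add_atTop_nat 1) |>.congr
          fun n => by simp
      have h2 := (Complex.continuous_ofReal.tendsto 0).comp h1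
      simpa using h2.const_add s₀
    · simp only [mem_compl_iff, mem_singleton_iff, add_eq_left, Complex.ofReal_eq_zero]
      positivity
  have hderiv : ∀ v, HasDerivAt (fun s => f s v) (deriv (fun s => f s v) s₀) s₀ := fun v =>
    ((hd v).differentiableAt (hU.mem_nhds hs₀)).hasDerivAt
  refine (hasDerivAt_integral_of_dominated_loc_of_lip (F := f)
    (F' := fun v => deriv (fun s => f s v) s₀) (bound := fun _ => max M 0 / (R / 2))
    (Metric.ball_mem_nhds s₀ (half_pos hR)) ?_ ?_ ?_ ?_ (integrable_const _)
    (Eventually.of_forall hderiv)).2.differentiableAt.differentiableWithinAt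
  · filter_upwards [hU.mem_nhds hs₀] with s hs using (hcont s hs).aestronglyMeasurable
  · exact (hcont s₀ hs₀).integrable_of_hasCompactSupport (HasCompactSupport.of_compactSpace _)
  · refine aestronglyMeasurable_of_tendsto_ae atTop
      (f := fun (n : ℕ) v => slope (fun s => f s v) s₀ (s₀ + (((R / (n + 1)) : ℝ) : ℂ)))
      (fun n => ?_) (Eventually.of_forall fun v => (hderiv v).tendsto_slope.comp htend)
    simp only [slope_def_field]
    exact (((hcont _ (hmem n)).sub (hcont _ hs₀)).div_const _).aestronglyMeasurable
  · refine Eventually.of_forall fun v => ?_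
    refine (convex_ball s₀ (R / 2)).lipschitzOnWith_of_nnnorm_deriv_le (𝕜 := ℂ) (fun s hs => ?_)
      (fun s hs => ?_)
    · refine (hd v).differentiableAt (hU.mem_nhds (hRU ?_))
      exact Metric.ball_subset_closedBall (Metric.ball_subset_ball (by linarith) hs)
    · have hs' : dist s s₀ < R / 2 := hs
      have hsub : Metric.closedBall s (R / 2) ⊆ Metric.closedBall s₀ R := fun w hw => by
        have hw' : dist w s ≤ R / 2 := hw
        have := dist_triangle w s s₀
        rw [Metric.mem_closedBall]; linarith
      rw [← NNReal.coe_le_coe, coe_nnnorm, Real.coe_nnabs, abs_of_nonneg (by positivity)]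
      refine Complex.norm_deriv_le_of_forall_mem_sphere_norm_le (half_pos hR) ?_ fun w hw =>
        hMn w (hsub (Metric.sphere_subset_closedBall hw)) v
      exact ((hd v).mono (hsub.trans hRU)).diffContOnCl_ball subset_rfl

lemma differentiableOn_torusInt {N : ℕ} {U : Set ℂ} (hU : IsOpen U)
    {f : ℂ → (Fin (N + 1) → TT) → ℂ}
    (hf : ContinuousOn (fun x : ℂ × (Fin (N + 1) → TT) => f x.1 x.2) (U ×ˢ univ))
    (hd : ∀ v, DifferentiableOn ℂ (fun s => f s v) U) (ζ : TT) :
    DifferentiableOn ℂ (fun s => torusInt N ζ (f s)) U := by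
  refine differentiableOn_integral_of_continuousOn hU
    (f := fun s θ => f s (torusVec ζ θ)) ?_ fun θ => hd _
  exact hf.comp (f := fun x : ℂ × (Fin N → TT) => (x.1, torusVec ζ x.2))
    (continuous_fst.prodMk ((continuous_torusVec_right ζ).comp continuous_snd)).continuousOn
    fun x hx => ⟨hx.1, mem_univ _⟩

/-- The interaction factor of the integrand. -/
noncomputable def selKer (p q : ℂ) {N : ℕ} (v : Fin (N + 1) → TT) : ℂ :=
  ∏ i, ∏ j, if i = j then 1 else chiF (eT (v i - v j)) p q

/-- The normalised integral with one-body weight `w`. -/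
noncomputable def selInt (N : ℕ) (p q : ℂ) (ζ : TT) (w : ℂ → ℂ) : ℂ :=
  (qPoch p * qPoch q) ^ N / (((N + 1).factorial : ℕ) : ℂ) *
    torusInt N ζ fun v => (∏ i, w (eT (v i))) * selKer p q v

/-- The elliptic Gamma weight. -/
noncomputable def gamWt {ι : Type} [Fintype ι] (p q : ℂ) (t u : ι → ℂ) (z : ℂ) : ℂ :=
  ∏ r, ellGamma (t r * z) p q * ellGamma (u r / z) p q

/-- Admissible parameters (normalised to the unit torus). -/
structure TrDom {ι : Type} [Fintype ι] (m n : ℕ) (p q τ υ : ℂ) (t u : ι → ℂ) : Prop where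
  card : Fintype.card ι = m + n + 2
  hp0 : p ≠ 0
  hq0 : q ≠ 0
  hp : ‖p‖ < 1
  hq : ‖q‖ < 1
  ht : ∀ r, ‖t r‖ < 1
  hu : ∀ r, ‖u r‖ < 1
  hτt : ∀ r, ‖τ‖ < ‖t r‖
  hυu : ∀ r, ‖υ‖ < ‖u r‖
  hτ : τ ^ (m + 1) = ∏ r, t r
  hυ : υ ^ (m + 1) = ∏ r, u r
  hτυ : τ * υ = p * q

/-- The transformation for the given parameters. -/
def Tr {ι : Type} [Fintype ι] (m n : ℕ) (p q : ℂ) (ζ : TT) (τ υ : ℂ) (t u : ι → ℂ) : Prop :=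
  selInt n p q ζ (gamWt p q t u) = (∏ r, ∏ s, ellGamma (t r * u s) p q) *
    selInt m p q ζ (gamWt p q (fun r => τ / t r) fun r => υ / u r)

lemma norm_div_lt_one {a b : ℂ} (h : ‖a‖ < ‖b‖) : ‖a / b‖ < 1 := by
  rw [norm_div, div_lt_one ((norm_nonneg a).trans_lt h)]; exact h

lemma ne_zero_of_norm_lt {a b : ℂ} (h : ‖a‖ < ‖b‖) : b ≠ 0 :=
  norm_pos_iff.1 ((norm_nonneg a).trans_lt h)

lemma ContinuousOn.gamWt {ι : Type} [Fintype ι] {X : Type*} [TopologicalSpace X] {S : Set X}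
    {p q : X → ℂ} {t u : ι → X → ℂ} {z : X → ℂ}
    (hp : ContinuousOn p S) (hq : ContinuousOn q S) (ht : ∀ r, ContinuousOn (t r) S)
    (hu : ∀ r, ContinuousOn (u r) S) (hz : ContinuousOn z S)
    (hp1 : ∀ a ∈ S, ‖p a‖ < 1) (hq1 : ∀ a ∈ S, ‖q a‖ < 1)
    (ht0 : ∀ r, ∀ a ∈ S, t r a ≠ 0) (hu0 : ∀ r, ∀ a ∈ S, u r a ≠ 0)
    (ht1 : ∀ r, ∀ a ∈ S, ‖t r a‖ < 1) (hu1 : ∀ r, ∀ a ∈ S, ‖u r a‖ < 1)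
    (hz1 : ∀ a ∈ S, ‖z a‖ = 1) :
    ContinuousOn (fun a => gamWt (p a) (q a) (fun r => t r a) (fun r => u r a) (z a)) S := by
  have hz0 : ∀ a ∈ S, z a ≠ 0 := fun a ha => by
    rw [← norm_pos_iff, hz1 a ha]; exact one_pos
  refine continuousOn_finsetProd _ fun r _ => ?_
  refine (((ht r).mul hz).ellGamma hp hq hp1 hq1 (fun a ha => mul_ne_zero (ht0 r a ha) (hz0 a ha))
    fun a ha => ?_).mul (((hu r).div hz hz0).ellGamma hp hq hp1 hq1
      (fun a ha => div_ne_zero (hu0 r a ha) (hz0 a ha)) fun a ha => ?_)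
  · simpa [hz1 a ha] using ht1 r a ha
  · simpa [hz1 a ha] using hu1 r a ha

lemma DifferentiableOn.gamWt {ι : Type} [Fintype ι] {U : Set ℂ} (hU : IsOpen U)
    {p q : ℂ → ℂ} {t u : ι → ℂ → ℂ} {z : ℂ}
    (hp : DifferentiableOn ℂ p U) (hq : DifferentiableOn ℂ q U)
    (ht : ∀ r, DifferentiableOn ℂ (t r) U) (hu : ∀ r, DifferentiableOn ℂ (u r) U)
    (hp1 : ∀ a ∈ U, ‖p a‖ < 1) (hq1 : ∀ a ∈ U, ‖q a‖ < 1)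
    (ht0 : ∀ r, ∀ a ∈ U, t r a ≠ 0) (hu0 : ∀ r, ∀ a ∈ U, u r a ≠ 0)
    (ht1 : ∀ r, ∀ a ∈ U, ‖t r a‖ < 1) (hu1 : ∀ r, ∀ a ∈ U, ‖u r a‖ < 1) (hz1 : ‖z‖ = 1) :
    DifferentiableOn ℂ (fun a => gamWt (p a) (q a) (fun r => t r a) (fun r => u r a) z) U := by
  have hz0 : z ≠ 0 := by rw [← norm_pos_iff, hz1]; exact one_pos
  unfold _root_.gamWt
  refine DifferentiableOn.fun_finsetProd fun r _ => ?_
  refine (((ht r).mul_const z).ellGamma hU hp hq hp1 hq1 (fun a ha => mul_ne_zero (ht0 r a ha) hz0)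
    fun a ha => ?_).mul (((hu r).div_const z).ellGamma hU hp hq hp1 hq1
      (fun a ha => div_ne_zero (hu0 r a ha) hz0) fun a ha => ?_)
  · simpa [hz1] using ht1 r a ha
  · simpa [hz1] using hu1 r a ha

lemma ContinuousOn.selKer {X : Type*} [TopologicalSpace X] {S : Set X} {N : ℕ}
    {p q : X → ℂ} {v : X → Fin (N + 1) → TT} (hp : ContinuousOn p S) (hq : ContinuousOn q S)
    (hv : Continuous v) (hp1 : ∀ a ∈ S, ‖p a‖ < 1) (hq1 : ∀ a ∈ S, ‖q a‖ < 1) :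
    ContinuousOn (fun a => selKer (p a) (q a) (v a)) S := by
  unfold _root_.selKer
  refine continuousOn_finsetProd _ fun i _ => continuousOn_finsetProd _ fun j _ => ?_
  split_ifs
  · exact continuousOn_const
  · refine ContinuousOn.chiF (Continuous.continuousOn ?_) hp hq hp1 hq1
    exact continuous_eT.comp (((continuous_apply i).comp hv).sub ((continuous_apply j).comp hv))

lemma DifferentiableOn.selKer {U : Set ℂ} (hU : IsOpen U) {N : ℕ}
    {p q : ℂ → ℂ} (v : Fin (N + 1) → TT) (hp : DifferentiableOn ℂ p U)
    (hq : DifferentiableOn ℂ q U) (hp1 : ∀ a ∈ U, ‖p a‖ < 1) (hq1 : ∀ a ∈ U, ‖q a‖ < 1) :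
    DifferentiableOn ℂ (fun a => selKer (p a) (q a) v) U := by
  unfold _root_.selKer
  refine DifferentiableOn.fun_finsetProd fun i _ => DifferentiableOn.fun_finsetProd fun j _ => ?_
  split_ifs
  · exact differentiableOn_const _
  · exact DifferentiableOn.chiF hU (differentiableOn_const _) hp hq hp1 hq1

lemma continuous_selKer {N : ℕ} {p q : ℂ} (hp : ‖p‖ < 1) (hq : ‖q‖ < 1) :
    Continuous fun v : Fin (N + 1) → TT => selKer p q v := by
  rw [← continuousOn_univ]
  exact ContinuousOn.selKer continuousOn_const continuousOn_const continuous_id (fun _ _ => hp)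
    fun _ _ => hq

lemma DifferentiableOn.selInt {ι : Type} [Fintype ι] {U : Set ℂ} (hU : IsOpen U) {N : ℕ} (ζ : TT)
    {p q : ℂ → ℂ} {t u : ι → ℂ → ℂ}
    (hp : DifferentiableOn ℂ p U) (hq : DifferentiableOn ℂ q U)
    (ht : ∀ r, DifferentiableOn ℂ (t r) U) (hu : ∀ r, DifferentiableOn ℂ (u r) U)
    (hp1 : ∀ a ∈ U, ‖p a‖ < 1) (hq1 : ∀ a ∈ U, ‖q a‖ < 1)
    (ht0 : ∀ r, ∀ a ∈ U, t r a ≠ 0) (hu0 : ∀ r, ∀ a ∈ U, u r a ≠ 0)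
    (ht1 : ∀ r, ∀ a ∈ U, ‖t r a‖ < 1) (hu1 : ∀ r, ∀ a ∈ U, ‖u r a‖ < 1) :
    DifferentiableOn ℂ (fun a => selInt N (p a) (q a) ζ
      (_root_.gamWt (p a) (q a) (fun r => t r a) fun r => u r a)) U := by
  have hqP : ∀ {p : ℂ → ℂ}, DifferentiableOn ℂ p U → (∀ a ∈ U, ‖p a‖ < 1) →
      DifferentiableOn ℂ (fun a => qPoch (p a)) U := fun hp hp1 => by
    simp_rw [← sPoch_self]
    exact hp.sPoch hU hp hp1
  refine ((((hqP hp hp1).mul (hqP hq hq1)).pow N).div_const _).mul ?_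
  have h1 : ∀ {f : ℂ → ℂ}, DifferentiableOn ℂ f U →
      ContinuousOn (fun x : ℂ × (Fin (N + 1) → TT) => f x.1) (U ×ˢ univ) := fun hf =>
    hf.continuousOn.comp continuousOn_fst fun x hx => hx.1
  refine differentiableOn_torusInt hU ?_ (fun v => ?_) ζ
  · refine (continuousOn_finsetProd _ fun i _ => ?_).mul ?_
    · exact ContinuousOn.gamWt (h1 hp) (h1 hq) (fun r => h1 (ht r)) (fun r => h1 (hu r))
        (continuous_eT.comp ((continuous_apply i).comp continuous_snd)).continuousOn
        (fun x hx => hp1 _ hx.1) (fun x hx => hq1 _ hx.1) (fun r x hx => ht0 r _ hx.1)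
        (fun r x hx => hu0 r _ hx.1) (fun r x hx => ht1 r _ hx.1) (fun r x hx => hu1 r _ hx.1)
        fun x hx => norm_eT _
    · exact ContinuousOn.selKer (h1 hp) (h1 hq) continuous_snd (fun x hx => hp1 _ hx.1)
        (fun x hx => hq1 _ hx.1)
  · refine (DifferentiableOn.fun_finsetProd fun i _ => ?_).mul ?_
    · exact DifferentiableOn.gamWt hU hp hq ht hu hp1 hq1 ht0 hu0 ht1 hu1 (norm_eT _)
    · exact DifferentiableOn.selKer hU v hp hq hp1 hq1

namespace TrDom
variable {ι : Type} [Fintype ι] {m n : ℕ} {p q τ υ : ℂ} {t u : ι → ℂ}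

lemma ht0 (H : TrDom m n p q τ υ t u) (r : ι) : t r ≠ 0 := ne_zero_of_norm_lt (H.hτt r)
lemma hu0 (H : TrDom m n p q τ υ t u) (r : ι) : u r ≠ 0 := ne_zero_of_norm_lt (H.hυu r)
lemma hτ0 (H : TrDom m n p q τ υ t u) : τ ≠ 0 :=
  left_ne_zero_of_mul (H.hτυ ▸ mul_ne_zero H.hp0 H.hq0)
lemma hυ0 (H : TrDom m n p q τ υ t u) : υ ≠ 0 :=
  right_ne_zero_of_mul (H.hτυ ▸ mul_ne_zero H.hp0 H.hq0)

lemma norm_mul_lt (H : TrDom m n p q τ υ t u) (r s : ι) : ‖t r * u s‖ < 1 := by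
  rw [norm_mul]
  nlinarith [H.ht r, H.hu s, norm_nonneg (t r), norm_nonneg (u s)]

lemma lt_norm_mul (H : TrDom m n p q τ υ t u) (r s : ι) : ‖p * q‖ < ‖t r * u s‖ := by
  rw [← H.hτυ, norm_mul, norm_mul]
  exact mul_lt_mul'' (H.hτt r) (H.hυu s) (norm_nonneg _) (norm_nonneg _)

/-- The dual parameters are admissible. -/
lemma dual (H : TrDom m n p q τ υ t u) :
    TrDom n m p q τ υ (fun r => τ / t r) (fun r => υ / u r) := by
  have key : ∀ {a : ℂ} {f : ι → ℂ}, a ^ (m + 1) = ∏ r, f r → a ≠ 0 →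
      a ^ (n + 1) = ∏ r, a / f r := fun {a f} h ha => by
    rw [Finset.prod_div_distrib, Finset.prod_const, Finset.card_univ, H.card, ← h,
      show m + n + 2 = (n + 1) + (m + 1) by ring, pow_add a (n + 1) (m + 1),
      mul_div_cancel_right₀ _ (pow_ne_zero _ ha)]
  have lt : ∀ {a b : ℂ}, a ≠ 0 → ‖a‖ < ‖b‖ → ‖b‖ < 1 → ‖a‖ < ‖a / b‖ := fun {a b} ha h h1 => by
    rw [norm_div, lt_div_iff₀ ((norm_nonneg a).trans_lt h)]
    nlinarith [norm_pos_iff.2 ha]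
  exact ⟨by rw [H.card]; ring, H.hp0, H.hq0, H.hp, H.hq, fun r => norm_div_lt_one (H.hτt r),
    fun r => norm_div_lt_one (H.hυu r), fun r => lt H.hτ0 (H.hτt r) (H.ht r),
    fun r => lt H.hυ0 (H.hυu r) (H.hu r), key H.hτ H.hτ0, key H.hυ H.hυ0, H.hτυ⟩

end TrDom

lemma convex_norm_mul_exp_lt (c a : ℂ) : Convex ℝ {s : ℂ | ‖c * Complex.exp (a * s)‖ < 1} := by
  have h1 : ConvexOn ℝ univ fun s : ℂ => Real.exp (a * s).re := by
    have := convexOn_exp.comp_linearMap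
      (Complex.reLm ∘ₗ (LinearMap.mulLeft ℂ a).restrictScalars ℝ)
    exact this
  have h2 := (h1.smul (norm_nonneg c)).convex_lt 1
  simpa [norm_mul, Complex.norm_exp] using h2

section Identity
variable {ι : Type} [Fintype ι] {m n : ℕ} {p q τ υ h : ℂ} {t u a b : ι → ℂ}

/-- The path of parameters through `(p,τ,υ,t,u)` with exponential velocities. -/
def TrDomAt (m n : ℕ) (p q τ υ h : ℂ) (t u a b : ι → ℂ) (s : ℂ) : Prop :=
  TrDom m n (p * Complex.exp (h * s)) q (τ * Complex.exp ((∑ r, a r) / (m + 1) * s))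
    (υ * Complex.exp ((∑ r, b r) / (m + 1) * s)) (fun r => t r * Complex.exp (a r * s))
    fun r => u r * Complex.exp (b r * s)

/-- The transformation along the path. -/
def TrAt (m n : ℕ) (p q : ℂ) (ζ : TT) (τ υ h : ℂ) (t u a b : ι → ℂ) (s : ℂ) : Prop :=
  Tr m n (p * Complex.exp (h * s)) q ζ (τ * Complex.exp ((∑ r, a r) / (m + 1) * s))
    (υ * Complex.exp ((∑ r, b r) / (m + 1) * s)) (fun r => t r * Complex.exp (a r * s))
    fun r => u r * Complex.exp (b r * s)

lemma norm_mul_exp_lt_iff {x y a b s : ℂ} (hy : y ≠ 0) :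
    ‖x * Complex.exp (a * s)‖ < ‖y * Complex.exp (b * s)‖ ↔
      ‖x / y * Complex.exp ((a - b) * s)‖ < 1 := by
  have : x / y * Complex.exp ((a - b) * s) =
      (x * Complex.exp (a * s)) / (y * Complex.exp (b * s)) := by
    rw [sub_mul, Complex.exp_sub, div_mul_div_comm]
  rw [this, norm_div, div_lt_one (norm_pos_iff.2 (mul_ne_zero hy (Complex.exp_ne_zero _)))]

lemma trDomAt_iff (H : TrDom m n p q τ υ t u)
    (hs : ∑ r, a r + ∑ r, b r = (m + 1) * h) (s : ℂ) :
    TrDomAt m n p q τ υ h t u a b s ↔ s ∈ {s | ‖p * Complex.exp (h * s)‖ < 1} ∩ ⋂ r,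
      ({s | ‖t r * Complex.exp (a r * s)‖ < 1} ∩ {s | ‖u r * Complex.exp (b r * s)‖ < 1} ∩
       {s | ‖τ / t r * Complex.exp (((∑ r, a r) / (m + 1) - a r) * s)‖ < 1} ∩
       {s | ‖υ / u r * Complex.exp (((∑ r, b r) / (m + 1) - b r) * s)‖ < 1}) := by
  have hm : (m + 1 : ℂ) ≠ 0 := Nat.cast_add_one_ne_zero m
  have key : ∀ {x : ℂ} {f c : ι → ℂ}, x ^ (m + 1) = ∏ r, f r →
      (x * Complex.exp ((∑ r, c r) / (m + 1) * s)) ^ (m + 1) =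
        ∏ r, f r * Complex.exp (c r * s) := fun {x f c} hx => by
    rw [mul_pow, hx, Finset.prod_mul_distrib, ← Complex.exp_sum, ← Complex.exp_nat_mul]
    congr 2
    rw [← Finset.sum_mul]; push_cast; field_simp
  constructor
  · intro D
    refine ⟨D.hp, mem_iInter.2 fun r => ⟨⟨⟨D.ht r, D.hu r⟩, ?_⟩, ?_⟩⟩
    · exact (norm_mul_exp_lt_iff (H.ht0 r)).1 (D.hτt r)
    · exact (norm_mul_exp_lt_iff (H.hu0 r)).1 (D.hυu r)
  · rintro ⟨h1, h2⟩
    rw [mem_iInter] at h2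
    refine ⟨H.card, mul_ne_zero H.hp0 (Complex.exp_ne_zero _), H.hq0, h1, H.hq,
      fun r => (h2 r).1.1.1, fun r => (h2 r).1.1.2,
      fun r => (norm_mul_exp_lt_iff (H.ht0 r)).2 (h2 r).1.2,
      fun r => (norm_mul_exp_lt_iff (H.hu0 r)).2 (h2 r).2, key H.hτ, key H.hυ, ?_⟩
    have : h * s = (∑ r, a r) / (m + 1) * s + (∑ r, b r) / (m + 1) * s := by
      rw [← add_mul, ← add_div, hs, mul_div_cancel_left₀ _ hm]
    rw [this, Complex.exp_add, mul_mul_mul_comm, H.hτυ]; ring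

lemma isOpen_trDomAt (H : TrDom m n p q τ υ t u) (hs : ∑ r, a r + ∑ r, b r = (m + 1) * h) :
    IsOpen {s | TrDomAt m n p q τ υ h t u a b s} := by
  have key : ∀ c d : ℂ, IsOpen {s : ℂ | ‖c * Complex.exp (d * s)‖ < 1} := fun c d =>
    isOpen_lt (by fun_prop) continuous_const
  simp_rw [trDomAt_iff H hs]
  exact (key _ _).inter (isOpen_iInter_of_finite fun r =>
    (((key _ _).inter (key _ _)).inter (key _ _)).inter (key _ _))

lemma convex_trDomAt (H : TrDom m n p q τ υ t u) (hs : ∑ r, a r + ∑ r, b r = (m + 1) * h) :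
    Convex ℝ {s | TrDomAt m n p q τ υ h t u a b s} := by
  have key := convex_norm_mul_exp_lt
  simp_rw [trDomAt_iff H hs]
  exact (key _ _).inter (convex_iInter fun r =>
    (((key _ _).inter (key _ _)).inter (key _ _)).inter (key _ _))

/-- Analytic continuation of the transformation along exponential paths. -/
theorem tr_of_frequently (ζ : TT) (H : TrDom m n p q τ υ t u)
    (hs : ∑ r, a r + ∑ r, b r = (m + 1) * h) {z₀ : ℂ}
    (hz₀ : TrDomAt m n p q τ υ h t u a b z₀)
    (hfr : ∃ᶠ s in 𝓝[≠] z₀, TrAt m n p q ζ τ υ h t u a b s) : Tr m n p q ζ τ υ t u := by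
  set U := {s | TrDomAt m n p q τ υ h t u a b s} with hUdef
  have hU : IsOpen U := isOpen_trDomAt H hs
  have hpre : IsPreconnected U := (convex_trDomAt H hs).isPreconnected
  have hexp : ∀ c d : ℂ, DifferentiableOn ℂ (fun s => c * Complex.exp (d * s)) U := fun c d => by
    fun_prop
  have hpd := hexp p h
  have hqd : DifferentiableOn ℂ (fun _ => q) U := differentiableOn_const _
  have d1 := DifferentiableOn.selInt hU (N := n) ζ hpd hqd (fun r => hexp (t r) (a r))
    (fun r => hexp (u r) (b r)) (fun s D => D.hp) (fun s D => D.hq) (fun r s D => D.ht0 r)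
    (fun r s D => D.hu0 r) (fun r s D => D.ht r) (fun r s D => D.hu r)
  have d2 := DifferentiableOn.selInt hU (N := m) ζ hpd hqd
    (fun r => (hexp τ ((∑ r, a r) / (m + 1))).div (hexp (t r) (a r)) fun s D => D.ht0 r)
    (fun r => (hexp υ ((∑ r, b r) / (m + 1))).div (hexp (u r) (b r)) fun s D => D.hu0 r)
    (fun s D => D.hp) (fun s D => D.hq) (fun r s D => D.dual.ht0 r)
    (fun r s D => D.dual.hu0 r) (fun r s D => D.dual.ht r) (fun r s D => D.dual.hu r)
  have d3 : DifferentiableOn ℂ (fun s => ∏ r, ∏ r', ellGamma (t r * Complex.exp (a r * s) *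
      (u r' * Complex.exp (b r' * s))) (p * Complex.exp (h * s)) q) U :=
    DifferentiableOn.fun_finsetProd fun r _ => DifferentiableOn.fun_finsetProd fun r' _ =>
      ((hexp (t r) (a r)).mul (hexp (u r') (b r'))).ellGamma hU hpd hqd (fun s D => D.hp)
        (fun s D => D.hq) (fun s D => mul_ne_zero (D.ht0 r) (D.hu0 r')) fun s D => D.norm_mul_lt r r'
  have han := (d1.sub (d3.mul d2)).analyticOnNhd hU
  have h0 : (0 : ℂ) ∈ U := by
    change TrDom _ _ _ _ _ _ _ _
    simpa using H
  have := han.eqOn_zero_of_preconnected_of_frequently_eq_zero hpre hz₀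
    (hfr.mono fun s hs => sub_eq_zero.2 hs) h0
  have h2 := sub_eq_zero.1 this
  simpa [Tr] using h2

end Identity

section Base
variable {p q : ℂ}

lemma ellGamma_mul_q_div (hp : ‖p‖ < 1) (hq : ‖q‖ < 1) (hp0 : p ≠ 0) (hq0 : q ≠ 0) {w : ℂ}
    (hw : ‖w‖ ≤ 1) (hw1 : w ≠ 1) (hqw : ‖q‖ < ‖w‖) :
    ellGamma w p q * ellGamma (q / w) p q = (thetaF w q)⁻¹ := by
  have hw0 : w ≠ 0 := ne_zero_of_norm_lt hqw
  have h1 : ‖q / w‖ < 1 := norm_div_lt_one hqw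
  have h2 := ellGamma_p_mul hp hq hp0 (sPoch_ne_zero_of_norm_lt hq h1)
  rw [thetaF_div hq0] at h2
  have h3 := ellGamma_mul_reflect hp hq (x := w) (y := p * (q / w)) (by field_simp)
    (mul_ne_zero hp0 hq0) (dPoch_ne_zero_of_norm_le hp hq hw hw1)
    (dPoch_ne_zero_of_norm_lt hp hq (by
      rw [norm_mul]; nlinarith [norm_nonneg p, norm_nonneg (q / w)]))
  rw [h2] at h3
  refine eq_inv_of_mul_eq_one_right ?_
  rw [← h3]; ring

lemma ellGamma_mul_p_div (hp : ‖p‖ < 1) (hq : ‖q‖ < 1) (hp0 : p ≠ 0) (hq0 : q ≠ 0) {w : ℂ}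
    (hw : ‖w‖ ≤ 1) (hw1 : w ≠ 1) (hpw : ‖p‖ < ‖w‖) :
    ellGamma w p q * ellGamma (p / w) p q = (thetaF w p)⁻¹ := by
  rw [ellGamma_symm hp hq, ellGamma_symm hp hq (p / w)]
  exact ellGamma_mul_q_div hq hp hq0 hp0 hw hw1 hpw

lemma ellGamma_q_pair (hp : ‖p‖ < 1) (hq : ‖q‖ < 1) (hp0 : p ≠ 0) (hq0 : q ≠ 0) {w : ℂ}
    (hw : ‖w‖ = 1) (hw1 : w ≠ 1) :
    ellGamma (q * w) p q * ellGamma (q / w) p q = thetaF w p / thetaF w q := by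
  rw [ellGamma_q_mul hp hq hq0 (sPoch_ne_zero_of_norm_le hp hw.le hw1), mul_assoc,
    ellGamma_mul_q_div hp hq hp0 hq0 hw.le hw1 (hw.symm ▸ hq), div_eq_mul_inv]

lemma ellGamma_p_pair (hp : ‖p‖ < 1) (hq : ‖q‖ < 1) (hp0 : p ≠ 0) (hq0 : q ≠ 0) {w : ℂ}
    (hw : ‖w‖ = 1) (hw1 : w ≠ 1) :
    ellGamma (p * w) p q * ellGamma (p / w) p q = thetaF w q / thetaF w p := by
  rw [ellGamma_symm hp hq, ellGamma_symm hp hq (p / w)]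
  exact ellGamma_q_pair hq hp hq0 hp0 hw hw1

lemma prod_pairs {N : ℕ} {M : Type*} [CommMonoid M] (f : Fin N → Fin N → M) :
    (∏ i, ∏ j, if i = j then 1 else f i j) = ∏ i, ∏ j, if i < j then f i j * f j i else 1 := by
  have h1 : ∀ i j, (if i = j then 1 else f i j) =
      (if i < j then f i j else 1) * (if j < i then f i j else 1) := fun i j => by
    rcases lt_trichotomy i j with h | h | h
    · simp [h, h.ne, h.not_gt]
    · simp [h]
    · simp [h, h.ne', h.not_gt]
  have h2 : ∀ i j, (if i < j then f i j * f j i else 1) =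
      (if i < j then f i j else 1) * (if i < j then f j i else 1) := fun i j => by
    split_ifs <;> simp
  simp_rw [h1, h2, Finset.prod_mul_distrib]
  congr 1
  rw [Finset.prod_comm]

lemma thetaV_ne_zero (hp : ‖p‖ < 1) {N : ℕ} {x : Fin N → ℂ} {a : ℝ} (hx0 : ∀ k, x k ≠ 0)
    (hx : ∀ k, ‖x k‖ = a) (hi : Function.Injective x) : thetaV p x ≠ 0 := by
  unfold thetaV
  refine Finset.prod_ne_zero_iff.2 fun i _ => Finset.prod_ne_zero_iff.2 fun j _ => ?_
  split_ifs with h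
  · refine mul_ne_zero (hx0 j) (thetaF_ne_zero_of_norm_eq_one hp ?_ fun h1 => ?_)
    · rw [norm_div, hx, hx, div_self]
      rw [← hx i]; exact norm_ne_zero_iff.2 (hx0 i)
    · exact h.ne (hi ((div_eq_one_iff_eq (hx0 j)).1 h1))
  · exact one_ne_zero

/-- The sign and monomial relating `thetaV` products to the interaction factor. -/
noncomputable def pairSign (N : ℕ) (f : Fin N → ℂ) : ℂ :=
  ∏ i, ∏ j, if i < j then -(f i * f j) else 1

lemma pairSign_eq {N : ℕ} (f : Fin (N + 1) → ℂ) :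
    pairSign (N + 1) f = pairSign (N + 1) (fun _ => 1) * (∏ i, f i) ^ N := by
  have h1 : (∏ i, f i) ^ N = ∏ i : Fin (N + 1), ∏ j, if i = j then 1 else f i := by
    rw [← Finset.prod_pow]
    refine Finset.prod_congr rfl fun i _ => ?_
    rw [← Finset.prod_erase_mul _ _ (Finset.mem_univ i), if_pos rfl, mul_one,
      Finset.prod_congr rfl (g := fun _ => f i) fun j hj => if_neg (Finset.ne_of_mem_erase hj).symm]
    simp
  rw [h1, prod_pairs (fun i _ => f i)]
  unfold pairSign
  simp_rw [← Finset.prod_mul_distrib]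
  refine Finset.prod_congr rfl fun i _ => Finset.prod_congr rfl fun j _ => ?_
  split_ifs <;> ring

lemma eT_sum {ι : Type*} (s : Finset ι) (v : ι → TT) : eT (∑ i ∈ s, v i) = ∏ i ∈ s, eT (v i) := by
  classical
  induction s using Finset.induction_on with
  | empty => simp [eT_zero]
  | insert a s ha ih => rw [Finset.prod_insert ha, Finset.sum_insert ha, eT_add, ih]

lemma thetaV_mul_thetaV (hp : ‖p‖ < 1) (hq : ‖q‖ < 1) {n : ℕ} (v : Fin (n + 1) → TT) :
    thetaV q (fun i => eT (v i)) * thetaV p (fun i => eT (v i)) =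
      pairSign (n + 1) (fun _ => 1) * eT (∑ i, v i) ^ n * selKer p q v := by
  rw [eT_sum, ← pairSign_eq]
  unfold selKer
  rw [prod_pairs (fun i j => chiF (eT (v i - v j)) p q)]
  unfold thetaV pairSign
  simp_rw [← Finset.prod_mul_distrib]
  refine Finset.prod_congr rfl fun i _ => Finset.prod_congr rfl fun j _ => ?_
  split_ifs
  · have hi := eT_ne_zero (v i)
    have hj := eT_ne_zero (v j)
    have e1 : eT (v i - v j) = eT (v i) / eT (v j) := by
      rw [sub_eq_add_neg, eT_add, eT_neg, div_eq_mul_inv]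
    have e2 : eT (v j - v i) = (eT (v i) / eT (v j))⁻¹ := by
      rw [← e1, ← eT_neg, neg_sub]
    rw [e2, e1, chiF_mul_inv hp hq, thetaF_inv hp (div_ne_zero hi hj)]
    field_simp
  · simp

/-- The weight in the doubly determinantal case. -/
lemma gamWt_base (hp : ‖p‖ < 1) (hq : ‖q‖ < 1) (hp0 : p ≠ 0) (hq0 : q ≠ 0) {n : ℕ}
    {x y : Fin n → ℂ} (hx : ∀ k, ‖x k‖ < 1) (hqx : ∀ k, ‖q‖ < ‖x k‖)
    (hy : ∀ k, ‖y k‖ < 1) (hpy : ∀ k, ‖p‖ < ‖y k‖) {z : ℂ} (hz : ‖z‖ = 1) :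
    gamWt p q (Sum.elim x y) (Sum.elim (fun k => q / x k) fun k => p / y k) z =
      (∏ k, thetaF (x k * z) q)⁻¹ * (∏ k, thetaF (y k * z) p)⁻¹ := by
  unfold gamWt
  rw [Fintype.prod_sum_type]
  simp only [Sum.elim_inl, Sum.elim_inr, div_div, ← Finset.prod_inv_distrib]
  congr 1
  · refine Finset.prod_congr rfl fun k _ => ?_
    have h : ‖x k * z‖ = ‖x k‖ := by rw [norm_mul, hz, mul_one]
    refine ellGamma_mul_q_div hp hq hp0 hq0 (by rw [h]; exact (hx k).le) ?_ (by rw [h]; exact hqx k)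
    rintro h1; rw [h1, norm_one] at h; exact (hx k).ne h.symm
  · refine Finset.prod_congr rfl fun k _ => ?_
    have h : ‖y k * z‖ = ‖y k‖ := by rw [norm_mul, hz, mul_one]
    refine ellGamma_mul_p_div hp hq hp0 hq0 (by rw [h]; exact (hy k).le) ?_ (by rw [h]; exact hpy k)
    rintro h1; rw [h1, norm_one] at h; exact (hy k).ne h.symm

/-- The Frobenius–Cauchy kernel. -/
noncomputable def frobKer (c p w : ℂ) : ℂ := thetaF (c * w) p / thetaF w p

/-- The product of two Frobenius determinants. -/
noncomputable def frobDet (c c' p q : ℂ) {n : ℕ} (x y z : Fin n → ℂ) : ℂ :=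
  (Matrix.of fun k i => frobKer c q (x k * z i)).det *
    (Matrix.of fun k i => frobKer c' p (y k * z i)).det

lemma base_integrand (hp : ‖p‖ < 1) (hq : ‖q‖ < 1) (hp0 : p ≠ 0) (hq0 : q ≠ 0) {n : ℕ}
    {x y : Fin (n + 1) → ℂ} (hx : ∀ k, ‖x k‖ < 1) (hqx : ∀ k, ‖q‖ < ‖x k‖)
    (hy : ∀ k, ‖y k‖ < 1) (hpy : ∀ k, ‖p‖ < ‖y k‖) {c c' : ℂ} (hc0 : c ≠ 0) (hc0' : c' ≠ 0)
    (hc : ∀ (S : Finset (Fin (n + 1))) (κ : ℂ), ‖κ‖ = 1 → thetaF (c * ((∏ k ∈ S, x k) * κ)) q ≠ 0)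
    (hc' : ∀ (S : Finset (Fin (n + 1))) (κ : ℂ), ‖κ‖ = 1 → thetaF (c' * ((∏ k ∈ S, y k) * κ)) p ≠ 0)
    (v : Fin (n + 1) → TT) :
    (thetaF c q ^ n * thetaF (c * ((∏ k, x k) * eT (∑ i, v i))) q *
      (thetaF c' p ^ n * thetaF (c' * ((∏ k, y k) * eT (∑ i, v i))) p) *
      (pairSign (n + 1) (fun _ => 1) * eT (∑ i, v i) ^ n) * (thetaV q x * thetaV p y)) *
      ((∏ i, gamWt p q (Sum.elim x y) (Sum.elim (fun k => q / x k) fun k => p / y k) (eT (v i))) *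
        selKer p q v) = frobDet c c' p q x y fun i => eT (v i) := by
  have hnx : ∀ k i, thetaF (x k * eT (v i)) q ≠ 0 := fun k i =>
    thetaF_ne_zero hq (by simpa using hx k) (by simpa using hqx k)
  have hny : ∀ k i, thetaF (y k * eT (v i)) p ≠ 0 := fun k i =>
    thetaF_ne_zero hp (by simpa using hy k) (by simpa using hpy k)
  unfold frobDet frobKer
  rw [frobenius_det hq hq0 n c x _ hc0 (fun k => ne_zero_of_norm_lt (hqx k))
      (fun k => eT_ne_zero _) hnx fun S => ?_,
    frobenius_det hp hp0 n c' y _ hc0' (fun k => ne_zero_of_norm_lt (hpy k))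
      (fun k => eT_ne_zero _) hny fun S => ?_]
  · simp_rw [gamWt_base hp hq hp0 hq0 hx hqx hy hpy (norm_eT _)]
    have h := thetaV_mul_thetaV hp hq v
    rw [Finset.prod_mul_distrib, Finset.prod_mul_distrib, Finset.prod_mul_distrib, ← eT_sum,
      Finset.prod_inv_distrib, Finset.prod_inv_distrib,
      Finset.prod_comm (f := fun i k => thetaF (x k * eT (v i)) q),
      Finset.prod_comm (f := fun i k => thetaF (y k * eT (v i)) p)]
    generalize (∏ k, ∏ i, thetaF (x k * eT (v i)) q) = a
    generalize (∏ k, ∏ i, thetaF (y k * eT (v i)) p) = b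
    calc _ = thetaF c q ^ n * thetaF (c * ((∏ k, x k) * eT (∑ i, v i))) q *
        (thetaF c' p ^ n * thetaF (c' * ((∏ k, y k) * eT (∑ i, v i))) p) *
        (thetaV q x * thetaV p y) * (a⁻¹ * b⁻¹) *
        (pairSign (n + 1) (fun _ => 1) * eT (∑ i, v i) ^ n * selKer p q v) := by ring
      _ = _ := by rw [← h]; ring
  · rw [Finset.prod_mul_distrib, ← eT_sum]
    exact hc' S _ (norm_eT _)
  · rw [Finset.prod_mul_distrib, ← eT_sum]
    exact hc S _ (norm_eT _)

end Base

section Base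
variable {p q : ℂ}

lemma exists_generic (hq : ‖q‖ < 1) (hq0 : q ≠ 0) {a : ℝ} (ha : 0 < a) :
    ∃ c : ℂ, c ≠ 0 ∧ ∀ (j : ℕ) (w : ℂ), ‖w‖ = a ^ j → thetaF (c * w) q ≠ 0 := by
  have hcount : (range fun x : ℤ × ℕ => ‖q‖ ^ x.1 / a ^ x.2).Countable := countable_range _
  obtain ⟨r, hr, hr0⟩ := (hcount.dense_compl ℝ).exists_mem_open (isOpen_Ioi (a := (0 : ℝ))) ⟨1, mem_Ioi.2 one_pos⟩
  have hr0 : 0 < r := hr0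
  refine ⟨r, by exact_mod_cast hr0.ne', fun j w hw h => ?_⟩
  have hw0 : w ≠ 0 := by
    rw [← norm_pos_iff, hw]; positivity
  obtain ⟨k, hk⟩ := exists_zpow_of_thetaF_eq_zero hq hq0
    (mul_ne_zero (by exact_mod_cast hr0.ne') hw0) h
  refine hr ⟨(k, j), ?_⟩
  have := congrArg norm hk
  rw [norm_mul, Complex.norm_real, Real.norm_of_nonneg hr0.le, hw, norm_zpow] at this
  simp only
  rw [← this]; field_simp

lemma continuous_frobDet_term {n : ℕ} (hp : ‖p‖ < 1) (c : ℂ) (hc : c ≠ 0)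
    {x : Fin (n + 1) → ℂ}
    (hx : ∀ k, ‖x k‖ < 1) (hpx : ∀ k, ‖p‖ < ‖x k‖) (k i : Fin (n + 1)) :
    Continuous fun v : Fin (n + 1) → TT => frobKer c p (x k * eT (v i)) := by
  rw [← continuousOn_univ]
  have h1 : Continuous fun v : Fin (n + 1) → TT => x k * eT (v i) :=
    continuous_const.mul (continuous_eT.comp (continuous_apply i))
  have h0 : ∀ v : Fin (n + 1) → TT, x k * eT (v i) ≠ 0 := fun v =>
    mul_ne_zero (ne_zero_of_norm_lt (hpx k)) (eT_ne_zero _)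
  refine ContinuousOn.div ?_ ?_ fun v _ => ?_
  · exact ((continuous_const.mul h1).continuousOn).thetaF continuousOn_const (fun _ _ => hp)
      fun v _ => mul_ne_zero hc (h0 v)
  · exact h1.continuousOn.thetaF continuousOn_const (fun _ _ => hp) fun v _ => h0 v
  · exact thetaF_ne_zero hp (by simpa using hx k) (by simpa using hpx k)

lemma frobDet_expand {n : ℕ} (c c' : ℂ) (x y z : Fin n → ℂ) :
    frobDet c c' p q x y z = ∑ ϖ : Equiv.Perm (Fin n), ∑ σ : Equiv.Perm (Fin n),
      ((Equiv.Perm.sign ϖ : ℤ) : ℂ) * ((Equiv.Perm.sign σ : ℤ) : ℂ) *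
        ∏ i, (frobKer c q (x (ϖ i) * z i) * frobKer c' p (y (σ i) * z i)) := by
  unfold frobDet
  rw [Matrix.det_apply', Matrix.det_apply', Finset.sum_mul_sum]
  refine Finset.sum_congr rfl fun ϖ _ => Finset.sum_congr rfl fun σ _ => ?_
  rw [Finset.prod_mul_distrib]
  simp only [Matrix.of_apply]
  ring

lemma torusInt_frobDet {n : ℕ} (hp : ‖p‖ < 1) (hq : ‖q‖ < 1)
    {x y : Fin (n + 1) → ℂ} {τ : ℂ} {a b : ℝ} (hx : ∀ k, ‖x k‖ < 1) (hqx : ∀ k, ‖q‖ < ‖x k‖)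
    (hy : ∀ k, ‖y k‖ < 1) (hpy : ∀ k, ‖p‖ < ‖y k‖)
    (hxa : ∀ k, ‖x k‖ = a) (hyb : ∀ k, ‖y k‖ = b) (hτab : ‖τ‖ = a * b)
    (hτ : τ ^ (n + 1) = (∏ k, x k) * ∏ k, y k)
    {c c' : ℂ} (hc : c ≠ 0) (hc' : c' ≠ 0) (ζ : TT) :
    torusInt n ζ (fun v => frobDet c c' p q x y fun i => eT (v i)) =
      torusInt n ζ (fun v => frobDet c c' p q (fun k => τ / y k) (fun k => τ / x k)
        fun i => eT (v i)) := by
  have hx0 : ∀ k, x k ≠ 0 := fun k => ne_zero_of_norm_lt (hqx k)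
  have hy0 : ∀ k, y k ≠ 0 := fun k => ne_zero_of_norm_lt (hpy k)
  have ha : 0 < a := by rw [← hxa 0]; exact norm_pos_iff.2 (hx0 0)
  have hb : 0 < b := by rw [← hyb 0]; exact norm_pos_iff.2 (hy0 0)
  have hτ0 : τ ≠ 0 := by rw [← norm_pos_iff, hτab]; positivity
  have hτy : ∀ k, ‖τ / y k‖ = a := fun k => by rw [norm_div, hτab, hyb]; field_simp
  have hτx : ∀ k, ‖τ / x k‖ = b := fun k => by rw [norm_div, hτab, hxa]; field_simp
  have cont : ∀ {x y : Fin (n + 1) → ℂ}, (∀ k, ‖x k‖ = a) → (∀ k, ‖y k‖ = b) →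
      ∀ ϖ σ : Equiv.Perm (Fin (n + 1)), Continuous fun v : Fin (n + 1) → TT =>
      ((Equiv.Perm.sign ϖ : ℤ) : ℂ) * ((Equiv.Perm.sign σ : ℤ) : ℂ) *
        ∏ i, (frobKer c q (x (ϖ i) * eT (v i)) * frobKer c' p (y (σ i) * eT (v i))) := by
    intro x' y' hx' hy' ϖ σ
    refine continuous_const.mul (continuous_finsetProd _ fun i _ => ?_)
    exact (continuous_frobDet_term hq c hc (fun k => by rw [hx' k, ← hxa k]; exact hx k)
      (fun k => by rw [hx' k, ← hxa k]; exact hqx k) _ i).mul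
      (continuous_frobDet_term hp c' hc' (fun k => by rw [hy' k, ← hyb k]; exact hy k)
      (fun k => by rw [hy' k, ← hyb k]; exact hpy k) _ i)
  simp_rw [frobDet_expand]
  rw [torusInt_finset_sum _ _ fun ϖ _ => continuous_finsetSum _ fun σ _ => cont hxa hyb ϖ σ,
    torusInt_finset_sum _ _ fun ϖ _ => continuous_finsetSum _ fun σ _ => cont hτy hτx ϖ σ,
    Finset.sum_congr rfl fun ϖ _ => torusInt_finset_sum _ _ fun σ _ => cont hxa hyb ϖ σ,
    Finset.sum_congr rfl fun ϖ _ => torusInt_finset_sum _ _ fun σ _ => cont hτy hτx ϖ σ,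
    Finset.sum_comm]
  refine Finset.sum_congr rfl fun σ _ => Finset.sum_congr rfl fun ϖ _ => ?_
  have hκ : ∀ i, ∃ κ, eT κ = τ / (x (ϖ i) * y (σ i)) := fun i => exists_eT_eq (by
    rw [norm_div, norm_mul, hxa, hyb, hτab, div_self (by positivity)])
  choose κ hκ using hκ
  have hκs : ∑ i, κ i = 0 := eT_injective (by
    rw [eT_sum, eT_zero]
    simp_rw [hκ]
    rw [Finset.prod_div_distrib, Finset.prod_mul_distrib, Equiv.prod_comp ϖ x,
      Equiv.prod_comp σ y, ← hτ, Finset.prod_const, Finset.card_univ, Fintype.card_fin,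
      div_self (pow_ne_zero _ hτ0)])
  have := torusInt_add ζ κ fun v => ((Equiv.Perm.sign ϖ : ℤ) : ℂ) * ((Equiv.Perm.sign σ : ℤ) : ℂ) *
        ∏ i, (frobKer c q (x (ϖ i) * eT (v i)) * frobKer c' p (y (σ i) * eT (v i)))
  rw [hκs, add_zero] at this
  rw [← this]
  congr 1
  funext v
  rw [mul_comm ((Equiv.Perm.sign ϖ : ℤ) : ℂ)]
  congr 1
  refine Finset.prod_congr rfl fun i _ => ?_
  have e1 : x (ϖ i) * eT ((v + κ) i) = τ / y (σ i) * eT (v i) := by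
    rw [Pi.add_apply, eT_add, hκ]; field_simp [hx0, hy0]
  have e2 : y (σ i) * eT ((v + κ) i) = τ / x (ϖ i) * eT (v i) := by
    rw [Pi.add_apply, eT_add, hκ]; field_simp [hx0, hy0]
  rw [e1, e2]

/-- The Gamma prefactor of the doubly determinantal case. -/
lemma base_prefactor {n : ℕ} (hp : ‖p‖ < 1) (hq : ‖q‖ < 1) (hp0 : p ≠ 0) (hq0 : q ≠ 0)
    {x y : Fin (n + 1) → ℂ} {τ : ℂ} {a b : ℝ} (hx : ∀ k, ‖x k‖ < 1) (hqx : ∀ k, ‖q‖ < ‖x k‖)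
    (hy : ∀ k, ‖y k‖ < 1) (hpy : ∀ k, ‖p‖ < ‖y k‖)
    (hxa : ∀ k, ‖x k‖ = a) (hyb : ∀ k, ‖y k‖ = b)
    (hix : Function.Injective x) (hiy : Function.Injective y)
    (hτ0 : τ ≠ 0) (hτ : τ ^ (n + 1) = (∏ k, x k) * ∏ k, y k) :
    (∏ r : Fin (n + 1) ⊕ Fin (n + 1), ∏ s : Fin (n + 1) ⊕ Fin (n + 1),
      ellGamma (Sum.elim x y r * Sum.elim (fun k => q / x k) (fun k => p / y k) s) p q) *
      (thetaV q x * thetaV p y) = thetaV q (fun k => τ / y k) * thetaV p (fun k => τ / x k) := by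
  have hx0 : ∀ k, x k ≠ 0 := fun k => ne_zero_of_norm_lt (hqx k)
  have hy0 : ∀ k, y k ≠ 0 := fun k => ne_zero_of_norm_lt (hpy k)
  have hpq : p * q ≠ 0 := mul_ne_zero hp0 hq0
  simp only [Fintype.prod_sum_type, Sum.elim_inl, Sum.elim_inr, Finset.prod_mul_distrib]
  have cross : (∏ k, ∏ l, ellGamma (x k * (p / y l)) p q) *
      (∏ l, ∏ k, ellGamma (y l * (q / x k)) p q) = 1 := by
    rw [Finset.prod_comm (f := fun l k => ellGamma (y l * (q / x k)) p q)]
    simp_rw [← Finset.prod_mul_distrib]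
    refine Finset.prod_eq_one fun k _ => Finset.prod_eq_one fun l _ => ?_
    refine ellGamma_mul_reflect' hp hq ?_ ?_ ?_ hpq
    · have := hx0 k; have := hy0 l; field_simp
    · have := norm_div_lt_one (hpy l)
      rw [norm_mul]; nlinarith [hx k, norm_nonneg (x k), norm_nonneg (p / y l)]
    · have := norm_div_lt_one (hqx k)
      rw [norm_mul]; nlinarith [hy l, norm_nonneg (y l), norm_nonneg (q / x k)]
  have diag : ∀ (e : ℂ) (x : Fin (n + 1) → ℂ), (∀ k, x k ≠ 0) →
      (∏ k, ∏ l, ellGamma (x k * (e / x l)) p q) = ellGamma e p q ^ (n + 1) *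
        ∏ k, ∏ l, if k < l then ellGamma (e * (x k / x l)) p q * ellGamma (e / (x k / x l)) p q
          else 1 := by
    intro e x hx0
    have h1 : ∀ k l, ellGamma (x k * (e / x l)) p q = (if k = l then ellGamma e p q else 1) *
        (if k = l then 1 else ellGamma (e * (x k / x l)) p q) := fun k l => by
      split_ifs with h
      · rw [h, mul_div_cancel₀ _ (hx0 l), mul_one]
      · rw [one_mul]; congr 1; field_simp
    simp_rw [h1, Finset.prod_mul_distrib]
    rw [prod_pairs (fun k l => ellGamma (e * (x k / x l)) p q)]
    congr 1
    · simp
    · refine Finset.prod_congr rfl fun k _ => Finset.prod_congr rfl fun l _ => ?_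
      have := hx0 k; have := hx0 l
      rw [show e * (x l / x k) = e / (x k / x l) by field_simp]
  have hΓ : ellGamma q p q * ellGamma p p q = 1 :=
    ellGamma_mul_reflect' hp hq (mul_comm _ _) hq hp hpq
  have hPW : (∏ k : Fin (n + 1), ∏ l, if k < l then τ ^ 2 / (x k * x l * (y k * y l)) else 1) = 1 := by
    have h2 : (∏ k : Fin (n + 1), τ / (x k * y k)) ^ n = 1 := by
      rw [Finset.prod_div_distrib, Finset.prod_mul_distrib, ← hτ, Finset.prod_const,
        Finset.card_univ, Fintype.card_fin, div_self (pow_ne_zero _ hτ0), one_pow]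
    have h3 := pairSign_eq (fun k : Fin (n + 1) => τ / (x k * y k))
    rw [h2, mul_one] at h3
    have h4 : pairSign (n + 1) (fun _ => 1) * pairSign (n + 1) (fun _ => 1) = 1 := by
      unfold pairSign
      simp_rw [← Finset.prod_mul_distrib]
      refine Finset.prod_eq_one fun k _ => Finset.prod_eq_one fun l _ => ?_
      split_ifs <;> ring
    calc _ = pairSign (n + 1) (fun k => τ / (x k * y k)) * pairSign (n + 1) (fun _ => 1) := by
          unfold pairSign
          simp_rw [← Finset.prod_mul_distrib]
          refine Finset.prod_congr rfl fun k _ => Finset.prod_congr rfl fun l _ => ?_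
          split_ifs
          · have := hx0 k; have := hy0 k; have := hx0 l; have := hy0 l
            field_simp
          · ring
      _ = 1 := by rw [h3, h4]
  rw [diag q x hx0, diag p y hy0]
  have main : (∏ k, ∏ l, if k < l then ellGamma (q * (x k / x l)) p q *
        ellGamma (q / (x k / x l)) p q else 1) *
      (∏ k, ∏ l, if k < l then ellGamma (p * (y k / y l)) p q *
        ellGamma (p / (y k / y l)) p q else 1) * (thetaV q x * thetaV p y) =
      thetaV q (fun k => τ / y k) * thetaV p (fun k => τ / x k) := by
    calc _ = _ * ∏ k : Fin (n + 1), ∏ l,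
          if k < l then τ ^ 2 / (x k * x l * (y k * y l)) else 1 := by rw [hPW, mul_one]
      _ = _ := ?_
    unfold thetaV
    simp_rw [← Finset.prod_mul_distrib]
    refine Finset.prod_congr rfl fun k _ => Finset.prod_congr rfl fun l _ => ?_
    split_ifs with h
    · have h1 := hx0 k; have h2 := hy0 k; have h3 := hx0 l; have h4 := hy0 l
      have nx : ‖x k / x l‖ = 1 := by
        rw [norm_div, hxa, hxa, div_self]; rw [← hxa k]; exact norm_ne_zero_iff.2 h1
      have ny : ‖y k / y l‖ = 1 := by
        rw [norm_div, hyb, hyb, div_self]; rw [← hyb k]; exact norm_ne_zero_iff.2 h2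
      have ix : x k / x l ≠ 1 := fun e => h.ne (hix ((div_eq_one_iff_eq h3).1 e))
      have iy : y k / y l ≠ 1 := fun e => h.ne (hiy ((div_eq_one_iff_eq h4).1 e))
      have tx := thetaF_ne_zero_of_norm_eq_one hq nx ix
      have ty := thetaF_ne_zero_of_norm_eq_one hp ny iy
      rw [ellGamma_q_pair hp hq hp0 hq0 nx ix, ellGamma_p_pair hp hq hp0 hq0 ny iy,
        show τ / y k / (τ / y l) = (y k / y l)⁻¹ by field_simp,
        show τ / x k / (τ / x l) = (x k / x l)⁻¹ by field_simp,
        thetaF_inv hq (div_ne_zero h2 h4), thetaF_inv hp (div_ne_zero h1 h3)]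
      field_simp
    · simp
  rw [← main]
  calc _ = (ellGamma q p q * ellGamma p p q) ^ (n + 1) *
        ((∏ k, ∏ l, ellGamma (x k * (p / y l)) p q) *
      (∏ l, ∏ k, ellGamma (y l * (q / x k)) p q)) * ((∏ k, ∏ l, if k < l then
        ellGamma (q * (x k / x l)) p q * ellGamma (q / (x k / x l)) p q else 1) *
      (∏ k, ∏ l, if k < l then ellGamma (p * (y k / y l)) p q *
        ellGamma (p / (y k / y l)) p q else 1) * (thetaV q x * thetaV p y)) := by ring
    _ = _ := by rw [hΓ, cross]; ring

end Base

section Base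
variable {p q : ℂ}

/-- The constant relating the doubly determinantal integral to its determinants. -/
noncomputable def basePref (c c' p q X Y κ : ℂ) (n : ℕ) : ℂ :=
  thetaF c q ^ n * thetaF (c * (X * κ)) q * (thetaF c' p ^ n * thetaF (c' * (Y * κ)) p) *
    (pairSign (n + 1) (fun _ => 1) * κ ^ n)

lemma base_integral (hp : ‖p‖ < 1) (hq : ‖q‖ < 1) (hp0 : p ≠ 0) (hq0 : q ≠ 0) {n : ℕ}
    {x y : Fin (n + 1) → ℂ} (hx : ∀ k, ‖x k‖ < 1) (hqx : ∀ k, ‖q‖ < ‖x k‖)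
    (hy : ∀ k, ‖y k‖ < 1) (hpy : ∀ k, ‖p‖ < ‖y k‖) {c c' : ℂ} (hc0 : c ≠ 0) (hc0' : c' ≠ 0)
    (hc : ∀ (S : Finset (Fin (n + 1))) (κ : ℂ), ‖κ‖ = 1 → thetaF (c * ((∏ k ∈ S, x k) * κ)) q ≠ 0)
    (hc' : ∀ (S : Finset (Fin (n + 1))) (κ : ℂ), ‖κ‖ = 1 → thetaF (c' * ((∏ k ∈ S, y k) * κ)) p ≠ 0)
    (ζ : TT) :
    basePref c c' p q (∏ k, x k) (∏ k, y k) (eT ζ) n * (thetaV q x * thetaV p y) *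
      torusInt n ζ (fun v => (∏ i, gamWt p q (Sum.elim x y)
        (Sum.elim (fun k => q / x k) fun k => p / y k) (eT (v i))) * selKer p q v) =
      torusInt n ζ fun v => frobDet c c' p q x y fun i => eT (v i) := by
  rw [← torusInt_const_mul]
  refine torusInt_congr _ fun v hv => ?_
  rw [← base_integrand hp hq hp0 hq0 hx hqx hy hpy hc0 hc0' hc hc' v, hv, basePref]

/-- The transformation in the doubly determinantal case. -/
lemma tr_base {n : ℕ} {x y : Fin (n + 1) → ℂ} {τ υ : ℂ} {a b : ℝ} {ζ : TT}
    (H : TrDom n n p q τ υ (Sum.elim x y) (Sum.elim (fun k => q / x k) fun k => p / y k))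
    (hxa : ∀ k, ‖x k‖ = a) (hyb : ∀ k, ‖y k‖ = b)
    (hqa : ‖q‖ = a * a) (hpb : ‖p‖ = b * b)
    (hix : Function.Injective x) (hiy : Function.Injective y) :
    Tr n n p q ζ τ υ (Sum.elim x y) (Sum.elim (fun k => q / x k) fun k => p / y k) := by
  have hp := H.hp
  have hq := H.hq
  have hp0 := H.hp0
  have hq0 := H.hq0
  have hx : ∀ k, ‖x k‖ < 1 := fun k => H.ht (Sum.inl k)
  have hy : ∀ k, ‖y k‖ < 1 := fun k => H.ht (Sum.inr k)
  have hx0 : ∀ k, x k ≠ 0 := fun k => H.ht0 (Sum.inl k)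
  have hy0 : ∀ k, y k ≠ 0 := fun k => H.ht0 (Sum.inr k)
  have ha : 0 < a := by rw [← hxa 0]; exact norm_pos_iff.2 (hx0 0)
  have hb : 0 < b := by rw [← hyb 0]; exact norm_pos_iff.2 (hy0 0)
  have ha1 : a < 1 := by rw [← hxa 0]; exact hx 0
  have hb1 : b < 1 := by rw [← hyb 0]; exact hy 0
  have hqa' : ‖q‖ < a := by rw [hqa]; nlinarith
  have hpb' : ‖p‖ < b := by rw [hpb]; nlinarith
  have hτ : τ ^ (n + 1) = (∏ k, x k) * ∏ k, y k := by
    rw [H.hτ, Fintype.prod_sum_type]; simp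
  have hτ0 := H.hτ0
  have hτab : ‖τ‖ = a * b := by
    refine (pow_left_inj₀ (norm_nonneg _) (by positivity) n.succ_ne_zero).1 ?_
    rw [← norm_pow, hτ, norm_mul, norm_prod, norm_prod]
    simp [hxa, hyb, mul_pow]
  have hτy : ∀ k, ‖τ / y k‖ = a := fun k => by rw [norm_div, hτab, hyb]; field_simp
  have hτx : ∀ k, ‖τ / x k‖ = b := fun k => by rw [norm_div, hτab, hxa]; field_simp
  obtain ⟨c, hc0, hc⟩ := exists_generic hq hq0 ha
  obtain ⟨c', hc0', hc'⟩ := exists_generic hp hp0 hb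
  have gen : ∀ {c p : ℂ} {a : ℝ} {x : Fin (n + 1) → ℂ}, (∀ k, ‖x k‖ = a) →
      (∀ (j : ℕ) (w : ℂ), ‖w‖ = a ^ j → thetaF (c * w) p ≠ 0) →
      ∀ (S : Finset (Fin (n + 1))) (κ : ℂ), ‖κ‖ = 1 →
        thetaF (c * ((∏ k ∈ S, x k) * κ)) p ≠ 0 := by
    intro c p a x hx hc S κ hκ
    refine hc S.card _ ?_
    rw [norm_mul, hκ, mul_one, norm_prod, Finset.prod_congr rfl fun k _ => hx k, Finset.prod_const]
  have I1 := base_integral hp hq hp0 hq0 hx (fun k => by rwa [hxa]) hy (fun k => by rwa [hyb])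
    hc0 hc0' (gen hxa hc) (gen hyb hc') ζ
  have I2 := base_integral hp hq hp0 hq0 (fun k => by rwa [hτy]) (fun k => by rwa [hτy])
    (fun k => by rwa [hτx]) (fun k => by rwa [hτx])
    hc0 hc0' (gen hτy hc) (gen hτx hc') ζ
  have e1 : ∏ k, τ / y k = ∏ k, x k := by
    rw [Finset.prod_div_distrib, Finset.prod_const, Finset.card_univ, Fintype.card_fin, hτ,
      mul_div_cancel_right₀ _ (Finset.prod_ne_zero_iff.2 fun k _ => hy0 k)]
  have e2 : ∏ k, τ / x k = ∏ k, y k := by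
    rw [Finset.prod_div_distrib, Finset.prod_const, Finset.card_univ, Fintype.card_fin, hτ,
      mul_div_cancel_left₀ _ (Finset.prod_ne_zero_iff.2 fun k _ => hx0 k)]
  rw [e1, e2, ← torusInt_frobDet hp hq hx (fun k => by rwa [hxa]) hy (fun k => by rwa [hyb]) hxa hyb
    hτab hτ hc0 hc0', ← I1] at I2
  have hB : basePref c c' p q (∏ k, x k) (∏ k, y k) (eT ζ) n ≠ 0 := by
    have g := gen hxa hc
    have g' := gen hyb hc'
    have s1 : thetaF c q ≠ 0 := by simpa using g ∅ 1 (by simp)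
    have s1' : thetaF c' p ≠ 0 := by simpa using g' ∅ 1 (by simp)
    have s2 := g Finset.univ (eT ζ) (by simp)
    have s2' := g' Finset.univ (eT ζ) (by simp)
    have s3 : pairSign (n + 1) (fun _ => 1) ≠ 0 := by
      unfold pairSign
      refine Finset.prod_ne_zero_iff.2 fun i _ => Finset.prod_ne_zero_iff.2 fun j _ => ?_
      split_ifs <;> simp
    exact mul_ne_zero (mul_ne_zero (mul_ne_zero (pow_ne_zero _ s1) s2)
      (mul_ne_zero (pow_ne_zero _ s1') s2')) (mul_ne_zero s3 (pow_ne_zero _ (eT_ne_zero _)))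
  have hV : thetaV q x * thetaV p y ≠ 0 :=
    mul_ne_zero (thetaV_ne_zero hq hx0 hxa hix) (thetaV_ne_zero hp hy0 hyb hiy)
  have hP := base_prefactor hp hq hp0 hq0 hx (fun k => by rwa [hxa]) hy (fun k => by rwa [hyb])
    hxa hyb hix hiy hτ0 hτ
  rw [← hP] at I2
  have cancel : ∀ {B V P J J' : ℂ}, B ≠ 0 → V ≠ 0 → B * (P * V) * J' = B * V * J → J = P * J' :=
    fun hB hV h => mul_left_cancel₀ (mul_ne_zero hB hV) (by rw [← h]; ring)
  have I3 := cancel hB hV I2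
  unfold Tr selInt
  rw [I3]
  have hw : gamWt p q (fun r => τ / Sum.elim x y r)
      (fun r => υ / Sum.elim (fun k => q / x k) (fun k => p / y k) r) =
      gamWt p q (Sum.elim (fun k => τ / y k) fun k => τ / x k)
        (Sum.elim (fun k => q / (τ / y k)) fun k => p / (τ / x k)) := by
    funext z
    unfold gamWt
    simp only [Fintype.prod_sum_type, Sum.elim_inl, Sum.elim_inr]
    rw [mul_comm]
    have f1 : ∀ k, υ / (p / y k) = q / (τ / y k) := fun k => by
      have := hy0 k
      field_simp; linear_combination H.hτυ
    have f2 : ∀ k, υ / (q / x k) = p / (τ / x k) := fun k => by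
      have := hx0 k
      field_simp; linear_combination H.hτυ
    simp_rw [f1, f2]
  rw [hw]
  ring

lemma TrDom.congr_equiv {ι κ : Type} [Fintype ι] [Fintype κ] (e : κ ≃ ι) {m n : ℕ} {τ υ : ℂ}
    {t u : ι → ℂ} (H : TrDom m n p q τ υ t u) : TrDom m n p q τ υ (t ∘ e) (u ∘ e) :=
  ⟨by rw [Fintype.card_congr e, H.card], H.hp0, H.hq0, H.hp, H.hq, fun r => H.ht _, fun r => H.hu _,
    fun r => H.hτt _, fun r => H.hυu _, by rw [H.hτ]; exact (Equiv.prod_comp e t).symm,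
    by rw [H.hυ]; exact (Equiv.prod_comp e u).symm, H.hτυ⟩

lemma tr_congr_equiv {ι κ : Type} [Fintype ι] [Fintype κ] (e : κ ≃ ι) {m n : ℕ} {ζ : TT} {τ υ : ℂ}
    {t u : ι → ℂ} : Tr m n p q ζ τ υ (t ∘ e) (u ∘ e) ↔ Tr m n p q ζ τ υ t u := by
  have h : ∀ t u : ι → ℂ, gamWt p q (t ∘ e) (u ∘ e) = gamWt p q t u := fun t u => by
    funext z
    exact Equiv.prod_comp e fun r => ellGamma (t r * z) p q * ellGamma (u r / z) p q
  have h2 : (∏ r, ∏ s, ellGamma ((t ∘ e) r * (u ∘ e) s) p q) =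
      ∏ r, ∏ s, ellGamma (t r * u s) p q := by
    rw [← Equiv.prod_comp e]
    refine Finset.prod_congr rfl fun r _ => ?_
    exact Equiv.prod_comp e fun s => ellGamma (t (e r) * u s) p q
  unfold Tr
  rw [h, h2, show (fun r => τ / (t ∘ e) r) = (fun r => τ / t r) ∘ e from rfl,
    show (fun r => υ / (u ∘ e) r) = (fun r => υ / u r) ∘ e from rfl, h]

end Base

section Pinch

/-- The squared distance from `1` to `ρ e(a)`. -/
noncomputable def pD (ρ : ℝ) (a : TT) : ℝ := ‖1 - ρ * eT a‖ ^ 2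

lemma pD_nonneg (ρ : ℝ) (a : TT) : 0 ≤ pD ρ a := sq_nonneg _

lemma conj_eT (a : TT) : (starRingEnd ℂ) (eT a) = (eT a)⁻¹ := by
  rw [Complex.inv_def, Complex.normSq_eq_norm_sq, norm_eT]; simp

lemma ofReal_pD (ρ : ℝ) (a : TT) : (pD ρ a : ℂ) = (1 - ρ * eT a) * (1 - ρ * (eT a)⁻¹) := by
  rw [pD, Complex.ofReal_pow, ← Complex.mul_conj', map_sub, map_one, map_mul, Complex.conj_ofReal,
    conj_eT]

lemma one_sub_mul_eT_ne_zero {ρ : ℝ} (h0 : 0 ≤ ρ) (h1 : ρ < 1) (a : TT) : 1 - ρ * eT a ≠ 0 := by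
  intro h
  have := congrArg norm (sub_eq_zero.1 h)
  rw [norm_one, norm_mul, norm_eT, mul_one, Complex.norm_real, Real.norm_of_nonneg h0] at this
  exact h1.ne this.symm

lemma pD_pos {ρ : ℝ} (h0 : 0 ≤ ρ) (h1 : ρ < 1) (a : TT) : 0 < pD ρ a :=
  pow_pos (norm_pos_iff.2 (one_sub_mul_eT_ne_zero h0 h1 a)) 2

lemma pD_one_pos {a : TT} (ha : a ≠ 0) : 0 < pD 1 a := by
  refine pow_pos (norm_pos_iff.2 fun h => ha (eT_injective ?_)) 2
  rw [eT_zero, ← sub_eq_zero, ← neg_eq_zero, ← h]; push_cast; ring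

lemma continuous_pD_right (ρ : ℝ) : Continuous (pD ρ) := by
  have h : Continuous fun a : TT => ‖1 - (ρ : ℂ) * eT a‖ ^ 2 :=
    ((continuous_const.sub (continuous_const.mul continuous_eT)).norm).pow 2
  exact h

lemma integral_geom {ρ : ℝ} (h0 : 0 ≤ ρ) (h1 : ρ < 1) :
    ∫ a, (1 - ρ * eT a)⁻¹ ∂muT = 1 := by
  have h := cMean_eq_circleAverage (fun z => (1 - ρ * z)⁻¹) 1
  simp only [cMean, Complex.ofReal_one, one_mul] at h
  rw [h, DiffContOnCl.circleAverage]
  · simp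
  · rw [abs_one]
    refine DifferentiableOn.diffContOnCl_ball (U := Metric.closedBall 0 1) ?_ le_rfl
    intro z hz
    have hz : ‖z‖ ≤ 1 := by simpa using hz
    refine DifferentiableAt.differentiableWithinAt ?_
    refine DifferentiableAt.inv (by fun_prop) fun h => ?_
    have := congrArg norm (sub_eq_zero.1 h)
    rw [norm_one, norm_mul, Complex.norm_real, Real.norm_of_nonneg h0] at this
    nlinarith

lemma integral_poisson {ρ : ℝ} (h0 : 0 ≤ ρ) (h1 : ρ < 1) :
    ∫ a, (1 - ρ ^ 2) / pD ρ a ∂muT = 1 := by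
  have hc : Continuous fun a => (1 - ρ * eT a)⁻¹ :=
    (continuous_const.sub (continuous_const.mul continuous_eT)).inv₀
      (one_sub_mul_eT_ne_zero h0 h1)
  have hi : ∀ {f : TT → ℂ}, Continuous f → Integrable f muT := fun hf =>
    hf.integrable_of_hasCompactSupport (HasCompactSupport.of_compactSpace _)
  have hc' : Continuous fun a => (1 - ρ * eT (-a))⁻¹ := hc.comp continuous_neg
  have key : ∀ a, (((1 - ρ ^ 2) / pD ρ a : ℝ) : ℂ) =
      (1 - ρ * eT a)⁻¹ + (1 - ρ * eT (-a))⁻¹ - 1 := by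
    intro a
    have e1 := one_sub_mul_eT_ne_zero h0 h1 a
    have e2 := one_sub_mul_eT_ne_zero h0 h1 (-a)
    rw [eT_neg] at e2
    rw [Complex.ofReal_div, ofReal_pD, eT_neg, div_eq_iff (mul_ne_zero e1 e2), sub_mul, add_mul,
      inv_mul_cancel_left₀ e1, mul_comm (1 - ρ * eT a), inv_mul_cancel_left₀ e2]
    have := eT_ne_zero a
    push_cast; field_simp; ring
  have : ((∫ a, (1 - ρ ^ 2) / pD ρ a ∂muT : ℝ) : ℂ) = 1 := by
    rw [← integral_complex_ofReal]
    simp_rw [key]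
    rw [integral_sub (f := fun a => (1 - ρ * eT a)⁻¹ + (1 - ρ * eT (-a))⁻¹) ((hi hc).add (hi hc'))
      (hi continuous_const), integral_add (hi hc) (hi hc'),
      integral_neg_eq_self (fun a => (1 - ρ * eT a)⁻¹) muT, integral_geom h0 h1]
    simp
  exact_mod_cast this

lemma exists_le_pD {U : Set TT} (hU : U ∈ 𝓝 0) :
    ∃ c : ℝ, 0 < c ∧ ∀ᶠ ρ : ℝ in 𝓝[<] 1, ∀ a ∉ U, c ≤ pD ρ a := by
  obtain ⟨V, hV, hVo, hV0⟩ := mem_nhds_iff.1 hU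
  have hcp : IsCompact Vᶜ := hVo.isClosed_compl.isCompact
  have hcont : ContinuousOn (fun a => ‖1 - eT a‖) Vᶜ :=
    ((continuous_const.sub continuous_eT).norm).continuousOn
  obtain ⟨c, hc0, hc⟩ := hcp.exists_forall_le' hcont (a := 0) fun b hb => norm_pos_iff.2 fun h =>
    hb (by
      have : b = 0 := eT_injective (by rw [eT_zero, ← sub_eq_zero.1 h])
      rwa [this])
  have hev : ∀ᶠ ρ : ℝ in 𝓝[<] 1, 1 - ρ < c / 2 := by
    refine eventually_nhdsWithin_of_eventually_nhds ?_
    exact (continuous_const.sub continuous_id).continuousAt.eventually_lt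
      continuousAt_const (by simpa using hc0)
  refine ⟨(c / 2) ^ 2, by positivity, ?_⟩
  filter_upwards [hev, self_mem_nhdsWithin] with ρ h hρ1 a ha
  have hρ1 : ρ < 1 := hρ1
  have e : ‖1 - eT a‖ ≤ ‖1 - ρ * eT a‖ + (1 - ρ) := by
    have : 1 - eT a = (1 - ρ * eT a) - ((1 - ρ : ℝ) : ℂ) * eT a := by push_cast; ring
    rw [this]
    refine (norm_sub_le _ _).trans (add_le_add le_rfl ?_)
    rw [norm_mul, norm_eT, mul_one, Complex.norm_real, Real.norm_of_nonneg (by linarith)]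
  have := hc a fun h => ha (hV h)
  unfold pD
  exact pow_le_pow_left₀ (by positivity) (by linarith) 2

lemma norm_poisson_sub_le {ρ : ℝ} (hρ0 : 0 ≤ ρ) (hρ1 : ρ < 1) {K : TT → ℂ} (hK : Continuous K)
    {k : ℂ} {ε c C : ℝ} (hε : 0 ≤ ε) (hc : 0 < c) (hC : ∀ a, ‖K a‖ ≤ C)
    (h : ∀ a, ‖K a - k‖ ≤ ε ∨ c ≤ pD ρ a) :
    ‖(∫ a, (((1 - ρ ^ 2) / pD ρ a : ℝ) : ℂ) * K a ∂muT) - k‖ ≤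
      ε + (1 - ρ ^ 2) / c * (C + ‖k‖) := by
  have hpc := continuous_pD_right ρ
  have hPc : Continuous fun a => (1 - ρ ^ 2) / pD ρ a :=
    continuous_const.div hpc fun a => (pD_pos hρ0 hρ1 a).ne'
  have hi : ∀ {f : TT → ℝ}, Continuous f → Integrable f muT :=
    fun hf => hf.integrable_of_hasCompactSupport (HasCompactSupport.of_compactSpace _)
  have hi' : ∀ {f : TT → ℂ}, Continuous f → Integrable f muT :=
    fun hf => hf.integrable_of_hasCompactSupport (HasCompactSupport.of_compactSpace _)
  have hPC : Continuous fun a => (((1 - ρ ^ 2) / pD ρ a : ℝ) : ℂ) :=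
    Complex.continuous_ofReal.comp hPc
  have hj1 : Integrable (fun a => (((1 - ρ ^ 2) / pD ρ a : ℝ) : ℂ) * K a) muT := hi' (hPC.mul hK)
  have hj2 : Integrable (fun a => (((1 - ρ ^ 2) / pD ρ a : ℝ) : ℂ) * k) muT :=
    hi' (hPC.mul continuous_const)
  have hsub : (∫ a, (((1 - ρ ^ 2) / pD ρ a : ℝ) : ℂ) * K a ∂muT) - k =
      ∫ a, (((1 - ρ ^ 2) / pD ρ a : ℝ) : ℂ) * (K a - k) ∂muT := by
    simp_rw [mul_sub]
    rw [integral_sub hj1 hj2, integral_mul_const,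
      integral_complex_ofReal, integral_poisson hρ0 hρ1, Complex.ofReal_one, one_mul]
  have h1 : 0 ≤ 1 - ρ ^ 2 := by nlinarith
  have hP0 : ∀ a, 0 ≤ (1 - ρ ^ 2) / pD ρ a := fun a => div_nonneg h1 (pD_nonneg _ _)
  have hCk : 0 ≤ C + ‖k‖ := add_nonneg ((norm_nonneg _).trans (hC 0)) (norm_nonneg _)
  have hb : ∀ a, ‖(((1 - ρ ^ 2) / pD ρ a : ℝ) : ℂ) * (K a - k)‖ ≤
      (1 - ρ ^ 2) / pD ρ a * ε + (1 - ρ ^ 2) / c * (C + ‖k‖) := by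
    intro a
    rw [norm_mul, Complex.norm_real, Real.norm_of_nonneg (hP0 a)]
    have hn2 : 0 ≤ (1 - ρ ^ 2) / c := div_nonneg h1 hc.le
    rcases h a with ha | ha
    · exact le_add_of_le_of_nonneg (mul_le_mul_of_nonneg_left ha (hP0 a)) (mul_nonneg hn2 hCk)
    · refine le_add_of_nonneg_of_le (mul_nonneg (hP0 a) hε) ?_
      exact mul_le_mul (div_le_div_of_nonneg_left h1 hc ha)
        ((norm_sub_le _ _).trans (add_le_add (hC a) le_rfl)) (norm_nonneg _) hn2
  have hi1 : Integrable (fun a => (1 - ρ ^ 2) / pD ρ a * ε) muT := hi (hPc.mul continuous_const)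
  have hi2 : Integrable (fun _ : TT => (1 - ρ ^ 2) / c * (C + ‖k‖)) muT := hi continuous_const
  have hr : ∫ a, ((1 - ρ ^ 2) / pD ρ a * ε + (1 - ρ ^ 2) / c * (C + ‖k‖)) ∂muT =
      ε + (1 - ρ ^ 2) / c * (C + ‖k‖) := by
    rw [integral_add hi1 hi2, integral_mul_const, integral_poisson hρ0 hρ1, one_mul,
      integral_const, probReal_univ, one_smul]
  rw [hsub, ← hr]
  exact norm_integral_le_of_norm_le (hi1.add hi2) (Eventually.of_forall hb)

/-- The Poisson kernel is an approximate identity, for families of functions. -/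
lemma tendsto_poisson {K : ℝ → TT → ℂ} {k : ℂ} {C : ℝ}
    (hC : ∀ᶠ ρ in 𝓝[<] 1, ∀ a, ‖K ρ a‖ ≤ C)
    (hm : ∀ᶠ ρ in 𝓝[<] 1, Continuous (K ρ))
    (hK : Tendsto (fun x : ℝ × TT => K x.1 x.2) (𝓝[<] 1 ×ˢ 𝓝 0) (𝓝 k)) :
    Tendsto (fun ρ : ℝ => ∫ a, (((1 - ρ ^ 2) / pD ρ a : ℝ) : ℂ) * K ρ a ∂muT) (𝓝[<] 1) (𝓝 k) := by
  rw [Metric.tendsto_nhds]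
  intro ε hε
  have h1 := Metric.tendsto_nhds.1 hK (ε / 2) (half_pos hε)
  rw [eventually_prod_iff] at h1
  obtain ⟨P, hP, Q, hQ, hPQ⟩ := h1
  obtain ⟨c, hc0, hc⟩ := exists_le_pD hQ
  have hev : ∀ᶠ ρ : ℝ in 𝓝[<] 1, (1 - ρ ^ 2) / c * (C + ‖k‖) < ε / 2 := by
    refine eventually_nhdsWithin_of_eventually_nhds ?_
    have : Continuous fun ρ : ℝ => (1 - ρ ^ 2) / c * (C + ‖k‖) := by fun_prop
    exact this.continuousAt.eventually_lt continuousAt_const (by simpa using hε)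
  have hpos : ∀ᶠ ρ : ℝ in 𝓝[<] 1, 0 < ρ := eventually_nhdsWithin_of_eventually_nhds
    (eventually_gt_nhds one_pos)
  filter_upwards [hC, hm, hP, hev, hpos, hc, self_mem_nhdsWithin] with ρ hC hm hP hev hρ0 hc hρ1
  rw [dist_eq_norm]
  refine (norm_poisson_sub_le hρ0.le hρ1 hm (half_pos hε).le hc0 hC fun a => ?_).trans_lt
    (by linarith)
  by_cases ha : Q a
  · left; rw [← dist_eq_norm]; exact (hPQ hP ha).le
  · exact Or.inr (hc a ha)

end Pinch

section Pinch

/-- The rational interaction factor. -/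
noncomputable def ratKer {N : ℕ} (v : Fin N → TT) : ℂ :=
  ∏ i, ∏ j, if i = j then 1 else 1 - eT (v i - v j)

lemma continuous_ratKer {N : ℕ} : Continuous (ratKer : (Fin N → TT) → ℂ) := by
  refine continuous_finsetProd _ fun i _ => continuous_finsetProd _ fun j _ => ?_
  split_ifs
  · exact continuous_const
  · exact continuous_const.sub
      (continuous_eT.comp ((continuous_apply i).sub (continuous_apply j)))

lemma ratKer_perm {N : ℕ} (σ : Equiv.Perm (Fin N)) (v : Fin N → TT) :
    ratKer (v ∘ σ) = ratKer v := by
  unfold ratKer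
  rw [← Equiv.prod_comp σ (fun i => ∏ j, if i = j then 1 else 1 - eT (v i - v j))]
  refine Finset.prod_congr rfl fun i _ => ?_
  rw [← Equiv.prod_comp σ (fun j => if σ i = j then 1 else 1 - eT (v (σ i) - v j))]
  refine Finset.prod_congr rfl fun j _ => ?_
  simp

lemma norm_ratKer_le {N : ℕ} (v : Fin N → TT) : ‖ratKer v‖ ≤ (2 ^ N) ^ N := by
  unfold ratKer
  rw [norm_prod]
  refine (Finset.prod_le_prod (g := fun _ => (2 : ℝ) ^ N) (fun i _ => norm_nonneg _)
    fun i _ => ?_).trans (by simp)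
  rw [norm_prod]
  refine (Finset.prod_le_prod (g := fun _ => (2 : ℝ)) (fun j _ => norm_nonneg _)
    fun j _ => ?_).trans (by simp)
  split_ifs
  · simp
  · refine (norm_sub_le _ _).trans ?_
    rw [norm_eT]; norm_num

lemma one_sub_eT_mul (a b : TT) :
    (1 - eT (a - b)) * (1 - eT (b - a)) = ((‖eT a - eT b‖ ^ 2 : ℝ) : ℂ) := by
  rw [Complex.ofReal_pow, ← Complex.mul_conj', map_sub, conj_eT, conj_eT, sub_eq_add_neg a b,
    sub_eq_add_neg b a, eT_add, eT_add, eT_neg, eT_neg]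
  have := eT_ne_zero a; have := eT_ne_zero b
  field_simp

lemma ratKer_cons {N : ℕ} (a : TT) (y : Fin N → TT) :
    ratKer (Fin.cons a y : Fin (N + 1) → TT) =
      ratKer y * ∏ j, ((‖eT a - eT (y j)‖ ^ 2 : ℝ) : ℂ) := by
  unfold ratKer
  rw [Fin.prod_univ_succ]
  simp_rw [Fin.prod_univ_succ]
  simp only [Fin.cons_zero, Fin.cons_succ, Fin.succ_inj, if_true, one_mul,
    (Fin.succ_ne_zero _), (Fin.succ_ne_zero _).symm, if_false, Finset.prod_mul_distrib]
  simp_rw [← one_sub_eT_mul, Finset.prod_mul_distrib]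
  ring

lemma prod_one_add_le {K : ℕ} (x : Fin K → ℝ) (hx : ∀ j, 0 ≤ x j) :
    ∏ j, (1 + x j) ≤ 2 ^ K * (1 + ∑ j, x j ^ K) := by
  have hs : ∀ j, x j ^ K ≤ ∑ j, x j ^ K := fun j =>
    Finset.single_le_sum (f := fun j => x j ^ K) (fun i _ => pow_nonneg (hx i) _)
      (Finset.mem_univ j)
  rcases K with _ | K
  · simp
  obtain ⟨j₀, -, hj⟩ := Finset.exists_max_image Finset.univ x ⟨0, Finset.mem_univ _⟩
  calc ∏ j, (1 + x j) ≤ (1 + x j₀) ^ (K + 1) := by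
        refine (Finset.prod_le_prod (g := fun _ => 1 + x j₀)
          (fun j _ => add_nonneg zero_le_one (hx j)) fun j h => ?_).trans (by simp)
        exact add_le_add le_rfl (hj j h)
    _ ≤ 2 ^ K * (1 ^ (K + 1) + x j₀ ^ (K + 1)) := add_pow_le zero_le_one (hx j₀) _
    _ ≤ 2 ^ (K + 1) * (1 + ∑ j, x j ^ (K + 1)) := by
        rw [one_pow]
        have := hs j₀
        have h0 : 0 ≤ x j₀ ^ (K + 1) := pow_nonneg (hx j₀) _
        exact mul_le_mul (pow_le_pow_right₀ one_le_two K.le_succ) (by linarith) (by linarith)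
          (by positivity)

lemma norm_eT_sub_sq_le {ρ₀ ρ : ℝ} (h0 : 0 < ρ₀) (h1 : ρ₀ ≤ ρ) (a b : TT) :
    ‖eT a - eT b‖ ^ 2 ≤ 2 / ρ₀ ^ 2 * (pD ρ a + pD ρ b) := by
  have hρ : 0 < ρ := h0.trans_le h1
  have e : ρ * ‖eT a - eT b‖ ≤ ‖1 - ρ * eT a‖ + ‖1 - ρ * eT b‖ := by
    have : (ρ : ℂ) * (eT a - eT b) = (1 - ρ * eT b) - (1 - ρ * eT a) := by ring
    calc ρ * ‖eT a - eT b‖ = ‖(ρ : ℂ) * (eT a - eT b)‖ := by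
          rw [norm_mul, Complex.norm_real, Real.norm_of_nonneg hρ.le]
      _ ≤ _ := by rw [this, add_comm]; exact norm_sub_le _ _
  rw [div_mul_eq_mul_div, le_div_iff₀ (by positivity)]
  unfold pD
  have e2 : (ρ * ‖eT a - eT b‖) ^ 2 ≤ (‖1 - ρ * eT a‖ + ‖1 - ρ * eT b‖) ^ 2 :=
    pow_le_pow_left₀ (by positivity) e 2
  have e3 : ρ₀ ^ 2 ≤ ρ ^ 2 := pow_le_pow_left₀ h0.le h1 2
  nlinarith [sq_nonneg (‖1 - ρ * eT a‖ - ‖1 - ρ * eT b‖), sq_nonneg ‖eT a - eT b‖,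
    mul_le_mul_of_nonneg_left e3 (sq_nonneg ‖eT a - eT b‖)]

/-- The partition-of-unity weight of the first coordinate. -/
noncomputable def pinchW {K : ℕ} (ρ : ℝ) (a : TT) (y : Fin K → TT) : ℝ :=
  (1 + ∑ j, (pD ρ a / pD ρ (y j)) ^ K)⁻¹

/-- The localised, desingularised interaction. -/
noncomputable def pinchR {K : ℕ} (ρ : ℝ) (a : TT) (y : Fin K → TT) : ℝ :=
  pinchW ρ a y * ∏ j, (‖eT a - eT (y j)‖ ^ 2 / pD ρ (y j))

lemma pinchW_den_pos {K : ℕ} (ρ : ℝ) (a : TT) (y : Fin K → TT) :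
    0 < 1 + ∑ j, (pD ρ a / pD ρ (y j)) ^ K :=
  add_pos_of_pos_of_nonneg one_pos
    (Finset.sum_nonneg fun _ _ => pow_nonneg (div_nonneg (pD_nonneg _ _) (pD_nonneg _ _)) _)

lemma norm_pinchR_le {K : ℕ} {ρ₀ ρ : ℝ} (h0 : 0 < ρ₀) (h1 : ρ₀ ≤ ρ) (hρ : ρ < 1) (a : TT)
    (y : Fin K → TT) : ‖pinchR ρ a y‖ ≤ (2 / ρ₀ ^ 2) ^ K * 2 ^ K := by
  have hρ0 : 0 ≤ ρ := h0.le.trans h1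
  have hp := pinchW_den_pos ρ a y
  have hn : 0 ≤ pinchR ρ a y := mul_nonneg (inv_nonneg.2 hp.le)
    (Finset.prod_nonneg fun j _ => div_nonneg (sq_nonneg _) (pD_nonneg _ _))
  rw [Real.norm_of_nonneg hn, pinchR, pinchW, inv_mul_le_iff₀ hp]
  calc _ ≤ ∏ j, (2 / ρ₀ ^ 2 * (1 + pD ρ a / pD ρ (y j))) := by
        refine Finset.prod_le_prod (fun j _ => div_nonneg (sq_nonneg _) (pD_nonneg _ _))
          fun j _ => ?_
        have hD := pD_pos hρ0 hρ (y j)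
        rw [div_le_iff₀ hD]
        refine (norm_eT_sub_sq_le h0 h1 a (y j)).trans (le_of_eq ?_)
        field_simp; ring
    _ = (2 / ρ₀ ^ 2) ^ K * ∏ j, (1 + pD ρ a / pD ρ (y j)) := by
        rw [Finset.prod_mul_distrib, Finset.prod_const, Finset.card_univ, Fintype.card_fin]
    _ ≤ (2 / ρ₀ ^ 2) ^ K * (2 ^ K * (1 + ∑ j, (pD ρ a / pD ρ (y j)) ^ K)) :=
        mul_le_mul_of_nonneg_left (prod_one_add_le _ fun j =>
          div_nonneg (pD_nonneg _ _) (pD_nonneg _ _)) (by positivity)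
    _ = _ := by ring

lemma continuous_pinchW {K : ℕ} {ρ : ℝ} (h0 : 0 ≤ ρ) (h1 : ρ < 1) :
    Continuous fun x : TT × (Fin K → TT) => pinchW ρ x.1 x.2 := by
  have hc := continuous_pD_right ρ
  have hcj : ∀ j, Continuous fun x : TT × (Fin K → TT) => pD ρ (x.2 j) := fun j =>
    hc.comp ((continuous_apply j).comp continuous_snd)
  have hc1 : Continuous fun x : TT × (Fin K → TT) => pD ρ x.1 := hc.comp continuous_fst
  have hq : ∀ j, Continuous fun x : TT × (Fin K → TT) => pD ρ x.1 / pD ρ (x.2 j) := fun j =>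
    hc1.div (hcj j) fun x => (pD_pos h0 h1 _).ne'
  have hs : Continuous fun x : TT × (Fin K → TT) => 1 + ∑ j, (pD ρ x.1 / pD ρ (x.2 j)) ^ K :=
    continuous_const.add (continuous_finsetSum _ fun j _ => (hq j).pow K)
  unfold pinchW
  exact hs.inv₀ fun x => (pinchW_den_pos _ _ _).ne'

lemma continuous_pinchR {K : ℕ} {ρ : ℝ} (h0 : 0 ≤ ρ) (h1 : ρ < 1) :
    Continuous fun x : TT × (Fin K → TT) => pinchR ρ x.1 x.2 := by
  have hc := continuous_pD_right ρ
  have hcj : ∀ j, Continuous fun x : TT × (Fin K → TT) => pD ρ (x.2 j) := fun j =>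
    hc.comp ((continuous_apply j).comp continuous_snd)
  have he : Continuous fun x : TT × (Fin K → TT) => eT x.1 := continuous_eT.comp continuous_fst
  have hej : ∀ j, Continuous fun x : TT × (Fin K → TT) => eT (x.2 j) := fun j =>
    continuous_eT.comp ((continuous_apply j).comp continuous_snd)
  have hf : ∀ j, Continuous fun x : TT × (Fin K → TT) =>
      ‖eT x.1 - eT (x.2 j)‖ ^ 2 / pD ρ (x.2 j) := fun j =>
    ((he.sub (hej j)).norm.pow 2).div (hcj j) fun x => (pD_pos h0 h1 _).ne'
  have hp : Continuous fun x : TT × (Fin K → TT) =>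
      ∏ j, (‖eT x.1 - eT (x.2 j)‖ ^ 2 / pD ρ (x.2 j)) := continuous_finsetProd _ fun j _ => hf j
  unfold pinchR
  exact (continuous_pinchW h0 h1).mul hp

lemma tendsto_pD {l : Filter (ℝ × TT)} {f : ℝ × TT → TT} {f₀ : TT}
    (h : Tendsto (fun x : ℝ × TT => x.1) l (𝓝 1)) (hf : Tendsto f l (𝓝 f₀)) :
    Tendsto (fun x => pD x.1 (f x)) l (𝓝 (pD 1 f₀)) := by
  have e : Tendsto (fun x => eT (f x)) l (𝓝 (eT f₀)) := (continuous_eT.tendsto f₀).comp hf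
  have r : Tendsto (fun x : ℝ × TT => (x.1 : ℂ)) l (𝓝 ((1 : ℝ) : ℂ)) :=
    (Complex.continuous_ofReal.tendsto 1).comp h
  unfold pD
  exact ((tendsto_const_nhds.sub (r.mul e)).norm).pow 2

lemma tendsto_pinchW {K : ℕ} (hK : K ≠ 0) {l : Filter (ℝ × TT)} {y : ℝ × TT → Fin K → TT}
    {y₀ : Fin K → TT} (h1 : Tendsto (fun x : ℝ × TT => x.1) l (𝓝 1))
    (h2 : Tendsto (fun x : ℝ × TT => x.2) l (𝓝 0))
    (hj : ∀ j, Tendsto (fun x => y x j) l (𝓝 (y₀ j))) (hy₀ : ∀ j, y₀ j ≠ 0) :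
    Tendsto (fun x : ℝ × TT => pinchW x.1 x.2 (y x)) l (𝓝 1) := by
  have hq : ∀ j, Tendsto (fun x : ℝ × TT => (pD x.1 x.2 / pD x.1 (y x j)) ^ K) l
      (𝓝 ((pD 1 0 / pD 1 (y₀ j)) ^ K)) := fun j =>
    ((tendsto_pD h1 h2).div (tendsto_pD h1 (hj j)) (pD_one_pos (hy₀ j)).ne').pow K
  have hs : Tendsto (fun x : ℝ × TT => 1 + ∑ j, (pD x.1 x.2 / pD x.1 (y x j)) ^ K) l
      (𝓝 (1 + ∑ j, (pD 1 0 / pD 1 (y₀ j)) ^ K)) :=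
    tendsto_const_nhds.add (tendsto_finsetSum _ fun j _ => hq j)
  have hD0 : pD 1 0 = 0 := by simp [pD, eT_zero]
  have hi := hs.inv₀ (pinchW_den_pos 1 0 y₀).ne'
  simp only [hD0, zero_div, zero_pow hK, Finset.sum_const_zero, add_zero, inv_one] at hi
  exact hi

lemma tendsto_pinchR {K : ℕ} (hK : K ≠ 0) {l : Filter (ℝ × TT)} {y : ℝ × TT → Fin K → TT}
    {y₀ : Fin K → TT} (h1 : Tendsto (fun x : ℝ × TT => x.1) l (𝓝 1))
    (h2 : Tendsto (fun x : ℝ × TT => x.2) l (𝓝 0))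
    (hj : ∀ j, Tendsto (fun x => y x j) l (𝓝 (y₀ j))) (hy₀ : ∀ j, y₀ j ≠ 0) :
    Tendsto (fun x : ℝ × TT => pinchR x.1 x.2 (y x)) l (𝓝 1) := by
  have e2 : Tendsto (fun x : ℝ × TT => eT x.2) l (𝓝 (eT 0)) := (continuous_eT.tendsto 0).comp h2
  have e : ∀ j, Tendsto (fun x : ℝ × TT => eT (y x j)) l (𝓝 (eT (y₀ j))) := fun j =>
    (continuous_eT.tendsto (y₀ j)).comp (hj j)
  have hf : ∀ j, Tendsto (fun x : ℝ × TT => ‖eT x.2 - eT (y x j)‖ ^ 2 / pD x.1 (y x j)) l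
      (𝓝 (‖eT 0 - eT (y₀ j)‖ ^ 2 / pD 1 (y₀ j))) := fun j =>
    ((e2.sub (e j)).norm.pow 2).div (tendsto_pD h1 (hj j)) (pD_one_pos (hy₀ j)).ne'
  have hP : Tendsto (fun x : ℝ × TT => ∏ j, (‖eT x.2 - eT (y x j)‖ ^ 2 / pD x.1 (y x j))) l
      (𝓝 (∏ j, (‖eT 0 - eT (y₀ j)‖ ^ 2 / pD 1 (y₀ j)))) := tendsto_finsetProd _ fun j _ => hf j
  have hP1 : ∏ j, (‖eT 0 - eT (y₀ j)‖ ^ 2 / pD 1 (y₀ j)) = 1 := by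
    refine Finset.prod_eq_one fun j _ => ?_
    have := (pD_one_pos (hy₀ j)).ne'
    rw [eT_zero, div_eq_one_iff_eq this, pD]; simp
  have hW := tendsto_pinchW hK h1 h2 hj hy₀
  rw [hP1] at hP
  have := hW.mul hP
  rw [mul_one] at this
  exact this

lemma sum_pinchW {K : ℕ} {ρ : ℝ} (h0 : 0 ≤ ρ) (h1 : ρ < 1) (v : Fin (K + 1) → TT) :
    ∑ i, pinchW ρ ((v ∘ Equiv.swap 0 i) 0) (Fin.tail (v ∘ Equiv.swap 0 i)) = 1 := by
  have hD : ∀ i, pD ρ (v i) ≠ 0 := fun i => (pD_pos h0 h1 _).ne'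
  have hS : 0 < ∑ k, (pD ρ (v k) ^ K)⁻¹ := Finset.sum_pos
    (fun k _ => inv_pos.2 (pow_pos (pD_pos h0 h1 _) _)) ⟨0, Finset.mem_univ _⟩
  have key : ∀ w : Fin (K + 1) → TT, pinchW ρ (w 0) (Fin.tail w) =
      (pD ρ (w 0) ^ K * ∑ k, (pD ρ (w k) ^ K)⁻¹)⁻¹ := fun w => by
    have : (pD ρ (w 0)) ≠ 0 := (pD_pos h0 h1 _).ne'
    rw [pinchW, Fin.sum_univ_succ, mul_add, mul_inv_cancel₀ (pow_ne_zero _ this), Finset.mul_sum]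
    simp only [div_eq_mul_inv, Fin.tail]
    simp [mul_pow]
  have hsum : ∀ i, ∑ k, (pD ρ ((v ∘ Equiv.swap 0 i) k) ^ K)⁻¹ = ∑ k, (pD ρ (v k) ^ K)⁻¹ :=
    fun i => Equiv.sum_comp (Equiv.swap 0 i) fun k => (pD ρ (v k) ^ K)⁻¹
  simp_rw [key, hsum]
  simp only [Function.comp, Equiv.swap_apply_left, mul_inv]
  rw [← Finset.sum_mul, mul_inv_cancel₀ hS.ne']

end Pinch

section Pinch

/-- The inner integral left after localising at the pinch. -/
noncomputable def pinchK {M : ℕ} (ζ : TT) (E : ℝ → (Fin (M + 2) → TT) → ℂ) (ρ : ℝ) (a : TT) : ℂ :=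
  torusInt M (ζ - a) fun y => E ρ (Fin.cons a y) * ratKer y * (pinchR ρ a y : ℂ)

lemma continuous_of_continuousOn_Icc {X : Type*} [TopologicalSpace X] {E : ℝ → X → ℂ} {ρ₀ : ℝ}
    (hE : ContinuousOn (fun x : ℝ × X => E x.1 x.2) (Icc ρ₀ 1 ×ˢ univ)) {ρ : ℝ}
    (h : ρ ∈ Icc ρ₀ 1) : Continuous (E ρ) :=
  hE.comp_continuous (Continuous.prodMk_right ρ) fun _ => ⟨h, mem_univ _⟩

lemma continuous_pinchW_tail {K : ℕ} {ρ : ℝ} (h0 : 0 ≤ ρ) (h1 : ρ < 1) :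
    Continuous fun v : Fin (K + 1) → TT => (pinchW ρ (v 0) (Fin.tail v) : ℂ) := by
  have ht : Continuous fun v : Fin (K + 1) → TT => (fun i : Fin K => v i.succ) :=
    continuous_pi fun i => continuous_apply i.succ
  have h0' : Continuous fun v : Fin (K + 1) → TT => v 0 := continuous_apply 0
  have htail : Continuous fun v : Fin (K + 1) → TT => (v 0, fun i : Fin K => v i.succ) :=
    h0'.prodMk ht
  have hW : Continuous fun x : TT × (Fin K → TT) => (pinchW ρ x.1 x.2 : ℂ) :=
    Complex.continuous_ofReal.comp (continuous_pinchW h0 h1)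
  have := hW.comp htail
  simp only [Function.comp_def] at this
  exact this

lemma torusInt_eq_mul_pinchW {M : ℕ} (ζ : TT) {F : (Fin (M + 2) → TT) → ℂ} {ρ : ℝ}
    (h0 : 0 ≤ ρ) (h1 : ρ < 1) (hFc : Continuous F)
    (hFs : ∀ (σ : Equiv.Perm (Fin (M + 2))) v, F (v ∘ σ) = F v) :
    torusInt (M + 1) ζ F = ((M : ℂ) + 2) * torusInt (M + 1) ζ
      fun v => F v * (pinchW ρ (v 0) (Fin.tail v) : ℂ) := by
  set G : (Fin (M + 2) → TT) → ℂ := fun v => F v * (pinchW ρ (v 0) (Fin.tail v) : ℂ) with hG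
  have hGc : Continuous G := hFc.mul (continuous_pinchW_tail h0 h1)
  have key : ∀ v, F v = ∑ i, G (v ∘ Equiv.swap 0 i) := fun v => by
    have := congrArg (fun x : ℝ => (x : ℂ)) (sum_pinchW h0 h1 v)
    simp only [Complex.ofReal_sum, Complex.ofReal_one] at this
    simp only [hG, hFs]
    rw [← Finset.mul_sum, this, mul_one]
  have hcomp : ∀ σ : Equiv.Perm (Fin (M + 2)), Continuous fun v : Fin (M + 2) → TT => v ∘ σ :=
    fun σ => continuous_pi fun i => continuous_apply (σ i)
  have hGi : ∀ i, Continuous fun v : Fin (M + 2) → TT => G (v ∘ Equiv.swap 0 i) := fun i =>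
    hGc.comp (hcomp _)
  have e : ∀ i, torusInt (M + 1) ζ (fun v => G (v ∘ Equiv.swap 0 i)) = torusInt (M + 1) ζ G :=
    fun i => torusInt_perm ζ _ hGc
  rw [torusInt_congr ζ fun v _ => key v, torusInt_finset_sum ζ _ fun i _ => hGi i,
    Finset.sum_congr rfl fun i _ => e i, Finset.sum_const, Finset.card_univ, Fintype.card_fin,
    nsmul_eq_mul]
  push_cast
  ring

lemma torusInt_eq_pinchK {M : ℕ} (ζ : TT) {E : ℝ → (Fin (M + 2) → TT) → ℂ} {ρ : ℝ}
    (h0 : 0 ≤ ρ) (h1 : ρ < 1) (hE : Continuous (E ρ))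
    (hsym : ∀ (σ : Equiv.Perm (Fin (M + 2))) v, E ρ (v ∘ σ) = E ρ v) :
    torusInt (M + 1) ζ (fun v => (1 - (ρ : ℂ) ^ 2) * (E ρ v * ratKer v / ∏ i, (pD ρ (v i) : ℂ))) =
      ((M : ℂ) + 2) * ∫ a, (((1 - ρ ^ 2) / pD ρ a : ℝ) : ℂ) * pinchK ζ E ρ a ∂muT := by
  have hD : ∀ a, (pD ρ a : ℂ) ≠ 0 := fun a => Complex.ofReal_ne_zero.2 (pD_pos h0 h1 a).ne'
  have hpD : Continuous fun a : TT => (pD ρ a : ℂ) :=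
    Complex.continuous_ofReal.comp (continuous_pD_right ρ)
  have hpc : ∀ i, Continuous fun v : Fin (M + 2) → TT => (pD ρ (v i) : ℂ) := fun i =>
    hpD.comp (continuous_apply i)
  have hpp : Continuous fun v : Fin (M + 2) → TT => ∏ i, (pD ρ (v i) : ℂ) :=
    continuous_finsetProd _ fun i _ => hpc i
  have hEr : Continuous fun v : Fin (M + 2) → TT => E ρ v * ratKer v := hE.mul continuous_ratKer
  have hq : Continuous fun v : Fin (M + 2) → TT => E ρ v * ratKer v / ∏ i, (pD ρ (v i) : ℂ) :=
    hEr.div hpp fun v => Finset.prod_ne_zero_iff.2 fun i _ => hD _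
  have hFc : Continuous fun v : Fin (M + 2) → TT =>
      (1 - (ρ : ℂ) ^ 2) * (E ρ v * ratKer v / ∏ i, (pD ρ (v i) : ℂ)) := continuous_const.mul hq
  have hFw : Continuous fun v : Fin (M + 2) → TT =>
      (1 - (ρ : ℂ) ^ 2) * (E ρ v * ratKer v / ∏ i, (pD ρ (v i) : ℂ)) *
        (pinchW ρ (v 0) (Fin.tail v) : ℂ) := hFc.mul (continuous_pinchW_tail h0 h1)
  rw [torusInt_eq_mul_pinchW ζ h0 h1 hFc fun σ v => by
    simp only [hsym σ v, ratKer_perm σ v, Function.comp]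
    rw [Equiv.prod_comp σ fun i => (pD ρ (v i) : ℂ)],
    torusInt_succ ζ hFw]
  refine congrArg _ (integral_congr_ae (Eventually.of_forall fun a => ?_))
  simp only [pinchK]
  rw [← torusInt_const_mul]
  refine congrArg _ (funext fun y => ?_)
  have hP : ∏ j, (pD ρ (y j) : ℂ) ≠ 0 := Finset.prod_ne_zero_iff.2 fun i _ => hD _
  have ha := hD a
  simp only [ratKer_cons, pinchR, Fin.prod_univ_succ (n := M + 1), Fin.cons_zero, Fin.cons_succ,
    Fin.tail_cons, Finset.prod_div_distrib, Complex.ofReal_mul, Complex.ofReal_div,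
    Complex.ofReal_prod, Complex.ofReal_sub, Complex.ofReal_one, Complex.ofReal_pow]
  field_simp

lemma tendsto_pinch {M : ℕ} (ζ : TT) (hζ : M ≠ 0 ∨ ζ ≠ 0)
    {E : ℝ → (Fin (M + 2) → TT) → ℂ} {ρ₀ : ℝ} (h0 : 0 < ρ₀) (h1 : ρ₀ < 1)
    (hE : ContinuousOn (fun x : ℝ × (Fin (M + 2) → TT) => E x.1 x.2) (Icc ρ₀ 1 ×ˢ univ))
    (hsym : ∀ ρ (σ : Equiv.Perm (Fin (M + 2))) v, E ρ (v ∘ σ) = E ρ v) :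
    Tendsto (fun ρ : ℝ => torusInt (M + 1) ζ
      (fun v => (1 - (ρ : ℂ) ^ 2) * (E ρ v * ratKer v / ∏ i, (pD ρ (v i) : ℂ)))) (𝓝[<] 1)
      (𝓝 (((M : ℂ) + 2) * torusInt M ζ fun y => E 1 (Fin.cons 0 y) * ratKer y)) := by
  have hev : ∀ᶠ ρ : ℝ in 𝓝[<] 1, ρ ∈ Ico ρ₀ 1 := Ico_mem_nhdsLT h1
  have hEρ : ∀ {ρ : ℝ}, ρ ∈ Icc ρ₀ 1 → Continuous (E ρ) := fun h =>
    continuous_of_continuousOn_Icc hE h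
  obtain ⟨C, hC⟩ := ((isCompact_Icc (a := ρ₀) (b := 1)).prod
    (isCompact_univ (X := Fin (M + 2) → TT))).exists_bound_of_continuousOn hE
  set B : ℝ := max C 0 * (2 ^ (M + 1)) ^ (M + 1) * ((2 / ρ₀ ^ 2) ^ (M + 1) * 2 ^ (M + 1)) with hB
  have hbd : ∀ ρ ∈ Ico ρ₀ 1, ∀ a (y : Fin (M + 1) → TT),
      ‖E ρ (Fin.cons a y) * ratKer y * (pinchR ρ a y : ℂ)‖ ≤ B := fun ρ hρ a y => by
    rw [norm_mul, norm_mul, Complex.norm_real]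
    have e1 : ‖E ρ (Fin.cons a y)‖ ≤ max C 0 :=
      (hC (ρ, Fin.cons a y) ⟨⟨hρ.1, hρ.2.le⟩, mem_univ _⟩).trans (le_max_left _ _)
    have e2 := norm_ratKer_le y
    have e3 := norm_pinchR_le h0 hρ.1 hρ.2 a y
    exact mul_le_mul (mul_le_mul e1 e2 (norm_nonneg _) (le_max_right _ _)) e3 (norm_nonneg _)
      (mul_nonneg (le_max_right _ _) (by positivity))
  have hcons : Continuous fun x : TT × (Fin (M + 1) → TT) => (Fin.cons x.1 x.2 : Fin (M + 2) → TT) :=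
    continuous_pi fun i => by
      refine Fin.cases ?_ (fun j => ?_) i
      · simpa using continuous_fst
      · exact (continuous_apply j).comp continuous_snd
  have hG : ∀ ρ ∈ Ico ρ₀ 1, Continuous fun x : TT × (Fin (M + 1) → TT) =>
      E ρ (Fin.cons x.1 x.2) * ratKer x.2 * (pinchR ρ x.1 x.2 : ℂ) := fun ρ hρ => by
    have c1 : Continuous fun x : TT × (Fin (M + 1) → TT) => E ρ (Fin.cons x.1 x.2) :=
      (hEρ ⟨hρ.1, hρ.2.le⟩).comp hcons
    have c2 : Continuous fun x : TT × (Fin (M + 1) → TT) => ratKer x.2 :=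
      continuous_ratKer.comp continuous_snd
    have c3 : Continuous fun x : TT × (Fin (M + 1) → TT) => (pinchR ρ x.1 x.2 : ℂ) :=
      Complex.continuous_ofReal.comp (continuous_pinchR (h0.le.trans hρ.1) hρ.2)
    exact (c1.mul c2).mul c3
  have hvec : Continuous fun x : TT × (Fin M → TT) => torusVec (ζ - x.1) x.2 :=
    continuous_torusVec.comp ((continuous_const.sub continuous_fst).prodMk continuous_snd)
  have hGv : ∀ ρ ∈ Ico ρ₀ 1, Continuous fun x : TT × (Fin M → TT) =>
      E ρ (Fin.cons x.1 (torusVec (ζ - x.1) x.2)) * ratKer (torusVec (ζ - x.1) x.2) *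
        (pinchR ρ x.1 (torusVec (ζ - x.1) x.2) : ℂ) := fun ρ hρ =>
    (hG ρ hρ).comp (continuous_fst.prodMk hvec)
  have hKc : ∀ ρ ∈ Ico ρ₀ 1, Continuous (pinchK ζ E ρ) := fun ρ hρ => by
    unfold pinchK torusInt
    refine continuous_of_dominated (bound := fun _ => B) (fun a => ?_)
      (fun a => Eventually.of_forall fun θ => hbd ρ hρ _ _) (integrable_const _)
      (Eventually.of_forall fun θ => (hGv ρ hρ).comp (Continuous.prodMk_left θ))
    exact ((hGv ρ hρ).comp (Continuous.prodMk_right a)).aestronglyMeasurable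
  have hKb : ∀ ρ ∈ Ico ρ₀ 1, ∀ a, ‖pinchK ζ E ρ a‖ ≤ B := fun ρ hρ a => by
    refine (norm_integral_le_of_norm_le_const
      (Eventually.of_forall fun θ => hbd ρ hρ _ _)).trans ?_
    simp
  set l : Filter (ℝ × TT) := 𝓝[<] 1 ×ˢ 𝓝 0 with hl
  have t1 : Tendsto (fun x : ℝ × TT => x.1) l (𝓝 1) := tendsto_fst.mono_right nhdsWithin_le_nhds
  have t2 : Tendsto (fun x : ℝ × TT => x.2) l (𝓝 0) := tendsto_snd
  have hevl : ∀ᶠ x in l, x.1 ∈ Ico ρ₀ 1 := tendsto_fst.eventually hev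
  have hlim : Tendsto (fun x : ℝ × TT => pinchK ζ E x.1 x.2) l
      (𝓝 (torusInt M ζ fun y => E 1 (Fin.cons 0 y) * ratKer y)) := by
    unfold pinchK torusInt
    refine tendsto_integral_filter_of_dominated_convergence (fun _ => B) ?_ ?_
      (integrable_const _) ?_
    · filter_upwards [hevl] with x hx
      exact ((hGv x.1 hx).comp (Continuous.prodMk_right x.2)).aestronglyMeasurable
    · filter_upwards [hevl] with x hx
      exact Eventually.of_forall fun θ => hbd x.1 hx _ _
    · have hne : ∀ᵐ θ ∂muP M, ∀ j, torusVec ζ θ j ≠ 0 := by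
        rcases eq_or_ne M 0 with rfl | hM
        · refine Eventually.of_forall fun θ j => ?_
          rw [Fin.fin_one_eq_zero j]
          simpa [torusVec] using hζ
        · exact ae_all_iff.2 fun j => ae_torusVec hM ζ j 0
      filter_upwards [hne] with θ hθ
      have ty : Tendsto (fun x : ℝ × TT => torusVec (ζ - x.2) θ) l (𝓝 (torusVec ζ θ)) := by
        have c : Continuous fun a : TT => torusVec (ζ - a) θ := hvec.comp (Continuous.prodMk_left θ)
        have := (c.tendsto 0).comp t2
        rwa [sub_zero] at this
      have tc : Tendsto (fun x : ℝ × TT => (Fin.cons x.2 (torusVec (ζ - x.2) θ) : Fin (M + 2) → TT))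
          l (𝓝 (Fin.cons 0 (torusVec ζ θ))) :=
        (hcons.tendsto (0, torusVec ζ θ)).comp (t2.prodMk_nhds ty)
      have tE : Tendsto (fun x : ℝ × TT => E x.1 (Fin.cons x.2 (torusVec (ζ - x.2) θ))) l
          (𝓝 (E 1 (Fin.cons 0 (torusVec ζ θ)))) := by
        have c := hE (1, Fin.cons 0 (torusVec ζ θ)) ⟨⟨h1.le, le_rfl⟩, mem_univ _⟩
        refine Tendsto.comp c (tendsto_nhdsWithin_iff.2 ⟨t1.prodMk_nhds tc, ?_⟩)
        filter_upwards [hevl] with x hx using ⟨⟨hx.1, hx.2.le⟩, mem_univ _⟩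
      have tr : Tendsto (fun x : ℝ × TT => ratKer (torusVec (ζ - x.2) θ)) l
          (𝓝 (ratKer (torusVec ζ θ))) := (continuous_ratKer.tendsto _).comp ty
      have tR : Tendsto (fun x : ℝ × TT => (pinchR x.1 x.2 (torusVec (ζ - x.2) θ) : ℂ)) l
          (𝓝 ((1 : ℝ) : ℂ)) := (Complex.continuous_ofReal.tendsto 1).comp
        (tendsto_pinchR M.succ_ne_zero t1 t2 (tendsto_pi_nhds.1 ty) hθ)
      have := (tE.mul tr).mul tR
      rwa [Complex.ofReal_one, mul_one] at this
  have hP := (tendsto_poisson (K := pinchK ζ E) (hev.mono hKb) (hev.mono hKc) hlim).const_mul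
    ((M : ℂ) + 2)
  refine hP.congr' ?_
  filter_upwards [hev] with ρ hρ
  exact (torusInt_eq_pinchK ζ (h0.le.trans hρ.1) hρ.2 (hEρ ⟨hρ.1, hρ.2.le⟩) (hsym ρ)).symm

end Pinch

section PinchLimit

variable {p q : ℂ}

/-- The regular part of `chiF`. -/
noncomputable def regPair (x p q : ℂ) : ℂ := sPoch (p * x) p * sPoch (q * x) q

/-- The regular part of the elliptic interaction kernel. -/
noncomputable def regKer {N : ℕ} (p q : ℂ) (v : Fin N → TT) : ℂ :=
  ∏ i, ∏ j, if i = j then 1 else regPair (eT (v i - v j)) p q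

lemma norm_mul_lt_one_of_le {a b : ℂ} (ha : ‖a‖ < 1) (hb : ‖b‖ ≤ 1) : ‖a * b‖ < 1 := by
  rw [norm_mul]; nlinarith [norm_nonneg a, norm_nonneg b]

lemma regGamma_mul_regPair (hp : ‖p‖ < 1) (hq : ‖q‖ < 1) {x : ℂ} (hx : ‖x‖ ≤ 1) :
    regGamma x p q * regPair x p q = dPoch (p * q / x) p q / dPoch (p * q * x) p q := by
  have h1 : sPoch (p * x) p ≠ 0 := sPoch_ne_zero_of_norm_lt hp (norm_mul_lt_one_of_le hp hx)
  have h2 : sPoch (q * x) q ≠ 0 := sPoch_ne_zero_of_norm_lt hq (norm_mul_lt_one_of_le hq hx)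
  rw [regGamma, regPair, dPoch_eq_sPoch_mul' hp hq (q * x), ← mul_assoc p q x]
  have h3 : dPoch (p * q * x) p q ≠ 0 := dPoch_ne_zero_of_norm_lt hp hq
    (norm_mul_lt_one_of_le (norm_mul_lt_one_of_le hp hq.le) hx)
  field_simp

lemma regGamma_mul_inv (hp : ‖p‖ < 1) (hq : ‖q‖ < 1) {x : ℂ} (hx : ‖x‖ = 1) :
    regGamma x p q * regGamma x⁻¹ p q * (regPair x p q * regPair x⁻¹ p q) = 1 := by
  have hx' : ‖x⁻¹‖ = 1 := by rw [norm_inv, hx, inv_one]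
  have hpq := norm_mul_lt_one_of_le hp hq.le
  have h1 : dPoch (p * q * x) p q ≠ 0 :=
    dPoch_ne_zero_of_norm_lt hp hq (norm_mul_lt_one_of_le hpq hx.le)
  have h2 : dPoch (p * q * x⁻¹) p q ≠ 0 :=
    dPoch_ne_zero_of_norm_lt hp hq (norm_mul_lt_one_of_le hpq hx'.le)
  rw [mul_mul_mul_comm, regGamma_mul_regPair hp hq hx.le, regGamma_mul_regPair hp hq hx'.le,
    div_inv_eq_mul, div_eq_mul_inv (p * q) x]
  generalize dPoch (p * q * x) p q = A at *
  generalize dPoch (p * q * x⁻¹) p q = B at *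
  field_simp

lemma regKer_perm {N : ℕ} (σ : Equiv.Perm (Fin N)) (v : Fin N → TT) :
    regKer p q (v ∘ σ) = regKer p q v := by
  unfold regKer
  rw [← Equiv.prod_comp σ (fun i => ∏ j, if i = j then 1 else regPair (eT (v i - v j)) p q)]
  refine Finset.prod_congr rfl fun i _ => ?_
  rw [← Equiv.prod_comp σ (fun j => if σ i = j then 1 else regPair (eT (v (σ i) - v j)) p q)]
  refine Finset.prod_congr rfl fun j _ => ?_
  simp

lemma continuous_regKer {N : ℕ} (hp : ‖p‖ < 1) (hq : ‖q‖ < 1) :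
    Continuous fun v : Fin N → TT => regKer p q v := by
  have hs : ∀ {a : ℂ}, ‖a‖ < 1 → Continuous fun x : ℂ => sPoch (a * x) a := fun {a} ha => by
    rw [← continuousOn_univ]
    exact (continuousOn_const.mul continuousOn_id).sPoch continuousOn_const fun _ _ => ha
  have hr : Continuous fun x : ℂ => regPair x p q := (hs hp).mul (hs hq)
  refine continuous_finsetProd _ fun i _ => continuous_finsetProd _ fun j _ => ?_
  split_ifs
  · exact continuous_const
  · have hd : Continuous fun v : Fin N → TT => eT (v i - v j) :=
      continuous_eT.comp ((continuous_apply i).sub (continuous_apply j))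
    exact hr.comp hd

lemma selKer_eq_ratKer_mul {N : ℕ} (hp : ‖p‖ < 1) (v : Fin (N + 1) → TT) :
    selKer p q v = ratKer v * regKer p q v := by
  unfold selKer ratKer regKer
  rw [← Finset.prod_mul_distrib]
  refine Finset.prod_congr rfl fun i _ => ?_
  rw [← Finset.prod_mul_distrib]
  refine Finset.prod_congr rfl fun j _ => ?_
  split_ifs
  · rw [mul_one]
  · rw [chiF_eq hp, regPair]

lemma regKer_cons {N : ℕ} (y : Fin N → TT) :
    regKer p q (Fin.cons 0 y : Fin (N + 1) → TT) =
      regKer p q y * ∏ j, (regPair (eT (y j)) p q * regPair (eT (y j))⁻¹ p q) := by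
  unfold regKer
  rw [Fin.prod_univ_succ]
  simp_rw [Fin.prod_univ_succ]
  simp only [Fin.cons_zero, Fin.cons_succ, Fin.succ_inj, if_true, one_mul,
    (Fin.succ_ne_zero _), (Fin.succ_ne_zero _).symm, if_false, Finset.prod_mul_distrib, zero_sub,
    sub_zero, eT_neg]
  ring

lemma selInt_rotate {N : ℕ} (ζ κ : TT) (w : ℂ → ℂ) :
    selInt N p q ζ (fun z => w (eT κ * z)) = selInt N p q (ζ + (N + 1) • κ) w := by
  have h := torusInt_add ζ (fun _ : Fin (N + 1) => κ)
    fun v => (∏ i, w (eT (v i))) * selKer p q v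
  rw [Finset.sum_const, Finset.card_univ, Fintype.card_fin] at h
  unfold selInt
  rw [← h]
  congr 2
  funext v
  simp only [selKer, Pi.add_apply, add_comm (v _) κ, eT_add,
    add_sub_add_left_eq_sub]

lemma tendsto_torusInt {N : ℕ} (ζ : TT) {F : ℝ → (Fin (N + 1) → TT) → ℂ} {ρ₀ : ℝ} (h1 : ρ₀ < 1)
    (hF : ContinuousOn (fun x : ℝ × (Fin (N + 1) → TT) => F x.1 x.2) (Icc ρ₀ 1 ×ˢ univ)) :
    Tendsto (fun ρ => torusInt N ζ (F ρ)) (𝓝[<] 1) (𝓝 (torusInt N ζ (F 1))) := by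
  obtain ⟨C, hC⟩ := ((isCompact_Icc (a := ρ₀) (b := 1)).prod
    (isCompact_univ (X := Fin (N + 1) → TT))).exists_bound_of_continuousOn hF
  have hev : ∀ᶠ ρ : ℝ in 𝓝[<] 1, ρ ∈ Icc ρ₀ 1 := by
    filter_upwards [Ico_mem_nhdsLT h1] with ρ hρ using ⟨hρ.1, hρ.2.le⟩
  unfold torusInt
  refine tendsto_integral_filter_of_dominated_convergence (fun _ => C) ?_ ?_ (integrable_const _) ?_
  · filter_upwards [hev] with ρ hρ
    exact ((continuous_of_continuousOn_Icc hF hρ).comp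
      (continuous_torusVec_right ζ)).aestronglyMeasurable
  · filter_upwards [hev] with ρ hρ
    exact Eventually.of_forall fun θ => hC (ρ, _) ⟨hρ, mem_univ _⟩
  · refine Eventually.of_forall fun θ => ?_
    have c := hF (1, torusVec ζ θ) ⟨⟨h1.le, le_rfl⟩, mem_univ _⟩
    have c' : Tendsto (fun ρ : ℝ => (ρ, torusVec ζ θ)) (𝓝[<] 1)
        (𝓝[Icc ρ₀ 1 ×ˢ univ] (1, torusVec ζ θ)) := by
      refine tendsto_nhdsWithin_iff.2 ⟨?_, ?_⟩
      · exact (tendsto_id.mono_left nhdsWithin_le_nhds).prodMk_nhds tendsto_const_nhds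
      · filter_upwards [hev] with ρ hρ using ⟨hρ, mem_univ _⟩
    exact Tendsto.comp c c'

lemma continuousOn_prod_eT {N : ℕ} {G : ℝ → ℂ → ℂ} {S : Set ℝ}
    (hG : ContinuousOn (fun x : ℝ × ℂ => G x.1 x.2) (S ×ˢ {z | ‖z‖ = 1})) :
    ContinuousOn (fun x : ℝ × (Fin N → TT) => ∏ i, G x.1 (eT (x.2 i))) (S ×ˢ univ) := by
  refine continuousOn_finsetProd _ fun i _ => ?_
  have ci : Continuous fun x : ℝ × (Fin N → TT) => x.2 i :=
    (continuous_apply i).comp continuous_snd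
  have ce : Continuous fun x : ℝ × (Fin N → TT) => eT (x.2 i) := continuous_eT.comp ci
  have c : Continuous fun x : ℝ × (Fin N → TT) => (x.1, eT (x.2 i)) := continuous_fst.prodMk ce
  have hm : MapsTo (fun x : ℝ × (Fin N → TT) => (x.1, eT (x.2 i))) (S ×ˢ univ)
    (S ×ˢ {z | ‖z‖ = 1}) := fun x hx => ⟨hx.1, norm_eT _⟩
  have := hG.comp c.continuousOn hm
  simp only [Function.comp_def] at this
  exact this

lemma tendsto_selInt_pinch {M : ℕ} (ζ : TT) (hζ : M ≠ 0 ∨ ζ ≠ 0) (hp : ‖p‖ < 1) (hq : ‖q‖ < 1)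
    {g : ℝ → ℂ → ℂ} {ρ₀ : ℝ} (h0 : 0 < ρ₀) (h1 : ρ₀ < 1)
    (hg : ContinuousOn (fun x : ℝ × ℂ => g x.1 x.2) (Icc ρ₀ 1 ×ˢ {z | ‖z‖ = 1})) :
    Tendsto (fun ρ : ℝ => (1 - (ρ : ℂ) ^ 2) * selInt (M + 1) p q ζ
        fun z => ellGamma (ρ * z) p q * ellGamma (ρ / z) p q * g ρ z) (𝓝[<] 1)
      (𝓝 ((qPoch p * qPoch q)⁻¹ * g 1 1 * selInt M p q ζ (g 1))) := by
  set G : ℝ → ℂ → ℂ := fun ρ z => regGamma (ρ * z) p q * regGamma (ρ / z) p q * g ρ z with hG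
  set E : ℝ → (Fin (M + 2) → TT) → ℂ := fun ρ v => (∏ i, G ρ (eT (v i))) * regKer p q v with hE
  have hGc : ContinuousOn (fun x : ℝ × ℂ => G x.1 x.2) (Icc ρ₀ 1 ×ˢ {z | ‖z‖ = 1}) := by
    have cρ : ContinuousOn (fun x : ℝ × ℂ => (x.1 : ℂ)) (Icc ρ₀ 1 ×ˢ {z | ‖z‖ = 1}) :=
      (Complex.continuous_ofReal.comp continuous_fst).continuousOn
    have hz : ∀ x ∈ Icc ρ₀ 1 ×ˢ {z : ℂ | ‖z‖ = 1}, x.2 ≠ 0 := fun x hx h => by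
      have : ‖x.2‖ = 1 := hx.2
      simp [h] at this
    have hρ : ∀ x ∈ Icc ρ₀ 1 ×ˢ {z : ℂ | ‖z‖ = 1}, (x.1 : ℂ) ≠ 0 := fun x hx =>
      Complex.ofReal_ne_zero.2 (h0.trans_le hx.1.1).ne'
    have hn : ∀ x ∈ Icc ρ₀ 1 ×ˢ {z : ℂ | ‖z‖ = 1}, ‖(x.1 : ℂ)‖ ≤ 1 := fun x hx => by
      rw [Complex.norm_real, Real.norm_of_nonneg (h0.le.trans hx.1.1)]; exact hx.1.2
    refine ((ContinuousOn.regGamma (cρ.mul continuousOn_snd) continuousOn_const continuousOn_const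
      (fun _ _ => hp) (fun _ _ => hq) (fun x hx => mul_ne_zero (hρ x hx) (hz x hx))
      fun x hx => ?_).mul (ContinuousOn.regGamma (cρ.div continuousOn_snd hz) continuousOn_const
      continuousOn_const (fun _ _ => hp) (fun _ _ => hq) (fun x hx => div_ne_zero (hρ x hx) (hz x hx))
      fun x hx => ?_)).mul hg
    · change ‖(x.1 : ℂ) * x.2‖ ≤ 1
      rw [norm_mul, show ‖x.2‖ = 1 from hx.2, mul_one]; exact hn x hx
    · change ‖(x.1 : ℂ) / x.2‖ ≤ 1
      rw [norm_div, show ‖x.2‖ = 1 from hx.2, div_one]; exact hn x hx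
  have hEc : ContinuousOn (fun x : ℝ × (Fin (M + 2) → TT) => E x.1 x.2) (Icc ρ₀ 1 ×ˢ univ) := by
    have ck : Continuous fun x : ℝ × (Fin (M + 2) → TT) => regKer p q x.2 :=
      (continuous_regKer hp hq).comp continuous_snd
    exact (continuousOn_prod_eT hGc).mul ck.continuousOn
  have hEs : ∀ ρ (σ : Equiv.Perm (Fin (M + 2))) v, E ρ (v ∘ σ) = E ρ v := fun ρ σ v => by
    simp only [hE, regKer_perm, Function.comp]
    rw [Equiv.prod_comp σ fun i => G ρ (eT (v i))]
  have key := (tendsto_pinch ζ hζ h0 h1 hEc hEs).const_mul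
    ((qPoch p * qPoch q) ^ (M + 1) / (((M + 1 + 1).factorial : ℕ) : ℂ))
  have hQ : qPoch p * qPoch q ≠ 0 := mul_ne_zero (qPoch_ne_zero hp) (qPoch_ne_zero hq)
  have hlim : (qPoch p * qPoch q) ^ (M + 1) / (((M + 1 + 1).factorial : ℕ) : ℂ) *
      (((M : ℂ) + 2) * torusInt M ζ fun y => E 1 (Fin.cons 0 y) * ratKer y) =
      (qPoch p * qPoch q)⁻¹ * g 1 1 * selInt M p q ζ (g 1) := by
    have e : ∀ y : Fin (M + 1) → TT, E 1 (Fin.cons 0 y) * ratKer y =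
        ((qPoch p * qPoch q)⁻¹ * (qPoch p * qPoch q)⁻¹ * g 1 1) *
          ((∏ i, g 1 (eT (y i))) * selKer p q y) := fun y => by
      have hr : (∏ i, (regGamma (eT (y i)) p q * regGamma (eT (y i))⁻¹ p q)) *
          ∏ i, (regPair (eT (y i)) p q * regPair (eT (y i))⁻¹ p q) = 1 := by
        rw [← Finset.prod_mul_distrib]
        exact Finset.prod_eq_one fun i _ => regGamma_mul_inv hp hq (norm_eT _)
      simp only [hE, hG, regKer_cons, Fin.prod_univ_succ (n := M + 1), Fin.cons_zero,
        Fin.cons_succ, eT_zero, Complex.ofReal_one, one_mul, div_one, regGamma_one hp hq,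
        one_div, selKer_eq_ratKer_mul hp]
      rw [Finset.prod_mul_distrib (f := fun i => regGamma (eT (y i)) p q * regGamma (eT (y i))⁻¹ p q)]
      linear_combination ((qPoch p * qPoch q)⁻¹ * (qPoch p * qPoch q)⁻¹ * g 1 1 *
        (∏ i, g 1 (eT (y i))) * regKer p q y * ratKer y) * hr
    simp_rw [e]
    rw [torusInt_const_mul, selInt, Nat.factorial_succ (M + 1)]
    have hf : (((M + 1).factorial : ℕ) : ℂ) ≠ 0 := Nat.cast_ne_zero.2 (Nat.factorial_ne_zero _)
    have hM : (M : ℂ) + 2 ≠ 0 := by exact_mod_cast (M + 1).succ_ne_zero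
    push_cast
    rw [show (M : ℂ) + 1 + 1 = M + 2 by ring]
    have hQp := qPoch_ne_zero hp
    have hQq := qPoch_ne_zero hq
    field_simp
    ring
  rw [hlim] at key
  refine key.congr' ?_
  filter_upwards [Ico_mem_nhdsLT h1] with ρ hρ
  rw [selInt, mul_left_comm (1 - (ρ : ℂ) ^ 2), ← torusInt_const_mul _ (1 - (ρ : ℂ) ^ 2)]
  refine congrArg _ (congrArg _ (funext fun v => ?_))
  simp only [selKer_eq_ratKer_mul hp, hE, hG, ofReal_pD, ellGamma_eq_regGamma hp hq]
  rw [show ∏ i, (regGamma (ρ * eT (v i)) p q / (1 - ρ * eT (v i)) *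
    (regGamma (ρ / eT (v i)) p q / (1 - ρ / eT (v i))) * g ρ (eT (v i))) =
    (∏ i, (regGamma (ρ * eT (v i)) p q * regGamma (ρ / eT (v i)) p q * g ρ (eT (v i)))) /
      ∏ i, ((1 - ρ * eT (v i)) * (1 - ρ * (eT (v i))⁻¹)) by
    rw [← Finset.prod_div_distrib]
    refine Finset.prod_congr rfl fun i _ => ?_
    rw [div_mul_div_comm, div_mul_eq_mul_div, div_eq_mul_inv (ρ : ℂ)]]
  ring

end PinchLimit

section PinchStep

variable {κ : Type} [Fintype κ] {p q : ℂ}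

/-- A family extended by two extra entries. -/
def optPar (x y : ℂ) (t : κ → ℂ) : Option (Option κ) → ℂ := fun o => o.elim x fun o => o.elim y t

lemma continuousAt_ellGamma (hp : ‖p‖ < 1) (hq : ‖q‖ < 1) {x : ℂ} (h1 : ‖x‖ < 1) (h0 : x ≠ 0) :
    ContinuousAt (fun x => ellGamma x p q) x := by
  have ho : IsOpen {x : ℂ | ‖x‖ < 1 ∧ x ≠ 0} :=
    (isOpen_lt continuous_norm continuous_const).inter isOpen_ne
  exact (ContinuousOn.ellGamma (s := {x : ℂ | ‖x‖ < 1 ∧ x ≠ 0}) continuousOn_id continuousOn_const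
    continuousOn_const (fun _ _ => hp) (fun _ _ => hq) (fun _ h => h.2)
    fun _ h => h.1).continuousAt (ho.mem_nhds ⟨h1, h0⟩)

lemma ellGamma_div_reflect (hp : ‖p‖ < 1) (hq : ‖q‖ < 1) (hpq : p * q ≠ 0) (x : ℂ) :
    ellGamma (p * q / x) p q = (1 - x) * (regGamma x p q)⁻¹ := by
  have h : ellGamma (p * q / x) p q = (ellGamma x p q)⁻¹ := by
    rw [ellGamma_eq_div hp hq, ellGamma_eq_div hp hq, div_div_cancel₀ hpq, inv_div]
  rw [h, ellGamma_eq_regGamma hp hq, inv_div, div_eq_mul_inv]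

lemma regGamma_one_ne_zero (hp : ‖p‖ < 1) (hq : ‖q‖ < 1) : regGamma 1 p q ≠ 0 := by
  rw [regGamma_one hp hq]
  exact inv_ne_zero (mul_ne_zero (qPoch_ne_zero hp) (qPoch_ne_zero hq))

lemma continuousAt_regGamma_sq (hp : ‖p‖ < 1) (hq : ‖q‖ < 1) :
    Tendsto (fun ρ : ℝ => regGamma ((ρ : ℂ) ^ 2) p q) (𝓝[<] 1) (𝓝 (regGamma 1 p q)) := by
  have hc : Continuous fun ρ : ℝ => (ρ : ℂ) ^ 2 := Complex.continuous_ofReal.pow 2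
  have h : ContinuousOn (fun ρ : ℝ => regGamma ((ρ : ℂ) ^ 2) p q) (Ioc 0 1) :=
    ContinuousOn.regGamma hc.continuousOn continuousOn_const continuousOn_const (fun _ _ => hp)
      (fun _ _ => hq) (fun ρ hρ => pow_ne_zero _ (Complex.ofReal_ne_zero.2 hρ.1.ne')) fun ρ hρ => by
        rw [norm_pow, Complex.norm_real, Real.norm_of_nonneg hρ.1.le]
        exact pow_le_one₀ hρ.1.le hρ.2
  have h1 := h 1 ⟨one_pos, le_rfl⟩
  have h2 := h1.mono_left (nhdsWithin_mono 1 Ioo_subset_Ioc_self)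
  rw [nhdsWithin_Ioo_eq_nhdsLT one_pos] at h2
  simpa using h2

lemma continuousOn_gamWt_real {ι : Type} [Fintype ι] (hp : ‖p‖ < 1) (hq : ‖q‖ < 1) {S : Set ℝ}
    {t u : ι → ℝ → ℂ} (ht : ∀ r, ContinuousOn (t r) S) (hu : ∀ r, ContinuousOn (u r) S)
    (ht0 : ∀ r, ∀ a ∈ S, t r a ≠ 0) (hu0 : ∀ r, ∀ a ∈ S, u r a ≠ 0)
    (ht1 : ∀ r, ∀ a ∈ S, ‖t r a‖ < 1) (hu1 : ∀ r, ∀ a ∈ S, ‖u r a‖ < 1) :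
    ContinuousOn (fun x : ℝ × ℂ => gamWt p q (fun r => t r x.1) (fun r => u r x.1) x.2)
      (S ×ˢ {z | ‖z‖ = 1}) := by
  have h1 : ∀ r, ContinuousOn (fun x : ℝ × ℂ => t r x.1) (S ×ˢ {z | ‖z‖ = 1}) := fun r => by
    have := (ht r).comp (s := S ×ˢ {z : ℂ | ‖z‖ = 1}) continuousOn_fst fun _ h => h.1
    exact this
  have h2 : ∀ r, ContinuousOn (fun x : ℝ × ℂ => u r x.1) (S ×ˢ {z | ‖z‖ = 1}) := fun r => by
    have := (hu r).comp (s := S ×ˢ {z : ℂ | ‖z‖ = 1}) continuousOn_fst fun _ h => h.1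
    exact this
  have h3 : ContinuousOn (fun x : ℝ × ℂ => x.2) (S ×ˢ {z | ‖z‖ = 1}) := continuousOn_snd
  exact ContinuousOn.gamWt (t := fun r (x : ℝ × ℂ) => t r x.1) (u := fun r (x : ℝ × ℂ) => u r x.1)
    (p := fun _ => p) (q := fun _ => q) (z := fun x : ℝ × ℂ => x.2)
    continuousOn_const continuousOn_const h1 h2 h3 (fun _ _ => hp) (fun _ _ => hq)
    (fun r a h => ht0 r _ h.1) (fun r a h => hu0 r _ h.1)
    (fun r a h => ht1 r _ h.1) (fun r a h => hu1 r _ h.1) fun _ h => h.2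

lemma tendsto_selInt_gamWt {ι : Type} [Fintype ι] {N : ℕ} (ζ : TT) (hp : ‖p‖ < 1) (hq : ‖q‖ < 1)
    {ρ₀ : ℝ} (h1 : ρ₀ < 1) {t u : ι → ℝ → ℂ} (ht : ∀ r, ContinuousOn (t r) (Icc ρ₀ 1))
    (hu : ∀ r, ContinuousOn (u r) (Icc ρ₀ 1))
    (ht0 : ∀ r, ∀ a ∈ Icc ρ₀ 1, t r a ≠ 0) (hu0 : ∀ r, ∀ a ∈ Icc ρ₀ 1, u r a ≠ 0)
    (ht1 : ∀ r, ∀ a ∈ Icc ρ₀ 1, ‖t r a‖ < 1) (hu1 : ∀ r, ∀ a ∈ Icc ρ₀ 1, ‖u r a‖ < 1) :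
    Tendsto (fun ρ => selInt N p q ζ (gamWt p q (fun r => t r ρ) fun r => u r ρ)) (𝓝[<] 1)
      (𝓝 (selInt N p q ζ (gamWt p q (fun r => t r 1) fun r => u r 1))) := by
  have hk : Continuous fun x : ℝ × (Fin (N + 1) → TT) => selKer p q x.2 := by
    have := (continuous_selKer (N := N) hp hq).comp (continuous_snd (X := ℝ))
    exact this
  have hg := continuousOn_prod_eT (N := N + 1)
    (G := fun ρ z => gamWt p q (fun r => t r ρ) (fun r => u r ρ) z)
    (continuousOn_gamWt_real hp hq ht hu ht0 hu0 ht1 hu1)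
  have hF : ContinuousOn (fun x : ℝ × (Fin (N + 1) → TT) =>
      (∏ i, gamWt p q (fun r => t r x.1) (fun r => u r x.1) (eT (x.2 i))) * selKer p q x.2)
      (Icc ρ₀ 1 ×ˢ univ) := hg.mul hk.continuousOn
  have h2 := tendsto_torusInt (F := fun ρ (v : Fin (N + 1) → TT) =>
      (∏ i, gamWt p q (fun r => t r ρ) (fun r => u r ρ) (eT (v i))) * selKer p q v) ζ h1 hF
  have h3 := h2.const_mul ((qPoch p * qPoch q) ^ N / (((N + 1).factorial : ℕ) : ℂ))
  simp only [selInt]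
  exact h3

lemma trDom_pinch {m n : ℕ} {τ υ t0 u0 τs υs α β : ℂ} {t u : κ → ℂ}
    (H : TrDom m n p q τ υ (fun o : Option κ => o.elim t0 t) fun o => o.elim u0 u)
    (hαβ : α * β = p * q) (hβ : ‖β‖ = ‖τ‖) (hτυs : τs * υs = p * q)
    (hτs : τs ^ (m + 2) = β * (t0 * ∏ k, t k)) :
    ∀ᶠ ρ : ℝ in 𝓝[<] 1, TrDom (m + 1) n p q τs υs (optPar (β / ρ) (t0 * ρ) t)
      (optPar (u0 * ρ) (α / ρ) u) := by
  have hpq : p * q ≠ 0 := mul_ne_zero H.hp0 H.hq0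
  have hτ0 := H.hτ0
  have hυ0 := H.hυ0
  have hβ0 : β ≠ 0 := right_ne_zero_of_mul (hαβ ▸ hpq)
  have hα0 : α ≠ 0 := left_ne_zero_of_mul (hαβ ▸ hpq)
  have hα : ‖α‖ = ‖υ‖ := by
    have h1 : ‖α‖ * ‖β‖ = ‖τ‖ * ‖υ‖ := by rw [← norm_mul, ← norm_mul, hαβ, H.hτυ]
    rw [hβ, mul_comm ‖τ‖] at h1
    exact mul_right_cancel₀ (norm_ne_zero_iff.2 hτ0) h1
  have hT : τ ^ (m + 1) = t0 * ∏ k, t k := by simpa [Fintype.prod_option] using H.hτ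
  have hU : υ ^ (m + 1) = u0 * ∏ k, u k := by simpa [Fintype.prod_option] using H.hυ
  have hnτ : ‖τs‖ = ‖τ‖ := by
    refine (pow_left_inj₀ (norm_nonneg _) (norm_nonneg _) (by omega : m + 2 ≠ 0)).1 ?_
    rw [← norm_pow, hτs, ← hT, norm_mul, hβ, norm_pow]; ring
  have hnυ : ‖υs‖ = ‖υ‖ := by
    have h1 : ‖τs‖ * ‖υs‖ = ‖τ‖ * ‖υ‖ := by rw [← norm_mul, ← norm_mul, hτυs, H.hτυ]
    rw [hnτ] at h1
    exact mul_left_cancel₀ (norm_ne_zero_iff.2 hτ0) h1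
  have hυs : υs ^ (m + 2) = α * (u0 * ∏ k, u k) := by
    have h1 : τs ^ (m + 2) * υs ^ (m + 2) = τs ^ (m + 2) * (α * (u0 * ∏ k, u k)) := by
      rw [← mul_pow, hτυs, hτs, ← hT, ← hU, mul_mul_mul_comm, mul_comm β α, hαβ, ← mul_pow, H.hτυ]
      ring
    refine mul_left_cancel₀ (pow_ne_zero _ ?_) h1
    exact left_ne_zero_of_mul (hτυs ▸ hpq)
  have ht0 : ‖t0‖ < 1 := H.ht none
  have hu0 : ‖u0‖ < 1 := H.hu none
  have hτt0 : ‖τ‖ < ‖t0‖ := H.hτt none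
  have hυu0 : ‖υ‖ < ‖u0‖ := H.hυu none
  have htp : 0 < ‖t0‖ := (norm_nonneg _).trans_lt hτt0
  have hup : 0 < ‖u0‖ := (norm_nonneg _).trans_lt hυu0
  have hmax : max (‖τ‖ / ‖t0‖) (‖υ‖ / ‖u0‖) < 1 :=
    max_lt ((div_lt_one htp).2 hτt0) ((div_lt_one hup).2 hυu0)
  filter_upwards [Ioo_mem_nhdsLT hmax] with ρ hρ
  have h1 : ‖τ‖ < ρ * ‖t0‖ := (div_lt_iff₀ htp).1 ((le_max_left _ _).trans_lt hρ.1)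
  have h2 : ‖υ‖ < ρ * ‖u0‖ := (div_lt_iff₀ hup).1 ((le_max_right _ _).trans_lt hρ.1)
  have hρ1 := hρ.2
  have hρ0 : 0 < ρ := lt_of_le_of_lt (by positivity) ((le_max_left _ _).trans_lt hρ.1)
  have hρn : ‖(ρ : ℂ)‖ = ρ := by rw [Complex.norm_real, Real.norm_of_nonneg hρ0.le]
  have hρc : (ρ : ℂ) ≠ 0 := Complex.ofReal_ne_zero.2 hρ0.ne'
  have hτp : 0 < ‖τ‖ := norm_pos_iff.2 hτ0
  have hυp : 0 < ‖υ‖ := norm_pos_iff.2 hυ0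
  refine ⟨?_, H.hp0, H.hq0, H.hp, H.hq, ?_, ?_, ?_, ?_, ?_, ?_, hτυs⟩
  · have := H.card
    rw [Fintype.card_option]
    omega
  · rintro (_ | _ | k)
    · change ‖β / ρ‖ < 1
      rw [norm_div, hρn, hβ, div_lt_one hρ0]; nlinarith
    · change ‖t0 * ρ‖ < 1
      rw [norm_mul, hρn]; nlinarith
    · exact H.ht (some k)
  · rintro (_ | _ | k)
    · change ‖u0 * ρ‖ < 1
      rw [norm_mul, hρn]; nlinarith
    · change ‖α / ρ‖ < 1
      rw [norm_div, hρn, hα, div_lt_one hρ0]; nlinarith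
    · exact H.hu (some k)
  · rw [hnτ]
    rintro (_ | _ | k)
    · change ‖τ‖ < ‖β / ρ‖
      rw [norm_div, hρn, hβ, lt_div_iff₀ hρ0]; nlinarith
    · change ‖τ‖ < ‖t0 * ρ‖
      rw [norm_mul, hρn, mul_comm]; exact h1
    · exact H.hτt (some k)
  · rw [hnυ]
    rintro (_ | _ | k)
    · change ‖υ‖ < ‖u0 * ρ‖
      rw [norm_mul, hρn, mul_comm]; exact h2
    · change ‖υ‖ < ‖α / ρ‖
      rw [norm_div, hρn, hα, lt_div_iff₀ hρ0]; nlinarith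
    · exact H.hυu (some k)
  · rw [hτs, Fintype.prod_option, Fintype.prod_option]
    simp only [optPar, Option.elim_none, Option.elim_some]
    field_simp
  · rw [hυs, Fintype.prod_option, Fintype.prod_option]
    simp only [optPar, Option.elim_none, Option.elim_some]
    field_simp

end PinchStep

section PinchLimit

variable {κ : Type} [Fintype κ] {p q : ℂ}

lemma selInt_congr {N : ℕ} (ζ : TT) {w w' : ℂ → ℂ} (h : ∀ z, ‖z‖ = 1 → w z = w' z) :
    selInt N p q ζ w = selInt N p q ζ w' := by
  unfold selInt
  congr 2
  funext v
  congr 1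
  exact Finset.prod_congr rfl fun i _ => h _ (norm_eT _)

lemma tendsto_ellGamma_comp (hp : ‖p‖ < 1) (hq : ‖q‖ < 1) {f : ℝ → ℂ} (hf : ContinuousAt f 1)
    (h1 : ‖f 1‖ < 1) (h0 : f 1 ≠ 0) :
    Tendsto (fun ρ => ellGamma (f ρ) p q) (𝓝[<] 1) (𝓝 (ellGamma (f 1) p q)) := by
  have h := (continuousAt_ellGamma hp hq h1 h0).tendsto.comp hf.tendsto
  exact h.mono_left nhdsWithin_le_nhds

/-- The product of all mixed values of a pinching family, without the pair that is singular in the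
limit. -/
noncomputable def pinchRest (p q α β t0 u0 : ℂ) (t u : κ → ℂ) (ρ : ℝ) : ℂ :=
  ellGamma (β * u0) p q * (∏ s, ellGamma (β / ρ * u s) p q) *
    ((ellGamma (t0 * ρ * (u0 * ρ)) p q * ellGamma (t0 * α) p q *
      ∏ s, ellGamma (t0 * ρ * u s) p q) *
    ∏ r, (ellGamma (t r * (u0 * ρ)) p q * ellGamma (t r * (α / ρ)) p q *
      ∏ s, ellGamma (t r * u s) p q))

lemma prod_optPar (hp : ‖p‖ < 1) (hq : ‖q‖ < 1) (hpq : p * q ≠ 0) {α β : ℂ}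
    (hαβ : α * β = p * q) (t0 u0 : ℂ) (t u : κ → ℂ) {ρ : ℝ} (hρ : ρ ≠ 0) :
    (∏ r, ∏ s, ellGamma (optPar (β / ρ) (t0 * ρ) t r * optPar (u0 * ρ) (α / ρ) u s) p q) =
      (1 - (ρ : ℂ) ^ 2) * (regGamma ((ρ : ℂ) ^ 2) p q)⁻¹ * pinchRest p q α β t0 u0 t u ρ := by
  have hρ' : (ρ : ℂ) ≠ 0 := Complex.ofReal_ne_zero.2 hρ
  have h1 : β / ρ * (α / ρ) = p * q / (ρ : ℂ) ^ 2 := by rw [← hαβ]; field_simp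
  have h2 : β / ρ * (u0 * ρ) = β * u0 := by field_simp
  have h3 : t0 * ρ * (α / ρ) = t0 * α := by field_simp
  simp only [Fintype.prod_option, optPar, Option.elim_none, Option.elim_some]
  rw [h1, h2, h3, ellGamma_div_reflect hp hq hpq]
  unfold pinchRest
  simp only [← mul_assoc]
  ring

lemma tendsto_pinchRest (hp : ‖p‖ < 1) (hq : ‖q‖ < 1) {α β t0 u0 : ℂ} {t u : κ → ℂ}
    (hα : ‖α‖ < 1) (hβ : ‖β‖ < 1) (hα0 : α ≠ 0) (hβ0 : β ≠ 0) (ht0 : t0 ≠ 0) (hu0 : u0 ≠ 0)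
    (ht : ∀ k, t k ≠ 0) (hu : ∀ k, u k ≠ 0) (h1t0 : ‖t0‖ < 1) (h1u0 : ‖u0‖ < 1)
    (h1t : ∀ k, ‖t k‖ < 1) (h1u : ∀ k, ‖u k‖ < 1) :
    Tendsto (pinchRest p q α β t0 u0 t u) (𝓝[<] 1) (𝓝 (pinchRest p q α β t0 u0 t u 1)) := by
  have hm : ∀ {a b : ℂ}, ‖a‖ < 1 → ‖b‖ < 1 → ‖a * b‖ < 1 := fun ha hb => by
    rw [norm_mul]; exact mul_lt_one_of_nonneg_of_lt_one_left (norm_nonneg _) ha hb.le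
  have hcm : ∀ a b : ℂ, ContinuousAt (fun ρ : ℝ => a * (b * ρ)) 1 := fun a b =>
    (continuous_const.mul (continuous_const.mul Complex.continuous_ofReal)).continuousAt
  have hcm' : ∀ a b : ℂ, ContinuousAt (fun ρ : ℝ => a * ρ * b) 1 := fun a b =>
    ((continuous_const.mul Complex.continuous_ofReal).mul continuous_const).continuousAt
  have hcmm : ∀ a b : ℂ, ContinuousAt (fun ρ : ℝ => a * ρ * (b * ρ)) 1 := fun a b =>
    ((continuous_const.mul Complex.continuous_ofReal).mul
      (continuous_const.mul Complex.continuous_ofReal)).continuousAt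
  have hcd : ∀ a : ℂ, ContinuousAt (fun ρ : ℝ => a / ρ) 1 := fun a =>
    continuousAt_const.div Complex.continuous_ofReal.continuousAt (by simp)
  have hcdm : ∀ a b : ℂ, ContinuousAt (fun ρ : ℝ => a * (b / ρ)) 1 := fun a b =>
    continuousAt_const.mul (hcd b)
  have hcdm' : ∀ a b : ℂ, ContinuousAt (fun ρ : ℝ => a / ρ * b) 1 := fun a b =>
    (hcd a).mul continuousAt_const
  unfold pinchRest
  refine (tendsto_const_nhds.mul (tendsto_finsetProd _ fun s _ => ?_)).mul
    (((Tendsto.mul ?_ tendsto_const_nhds).mul (tendsto_finsetProd _ fun s _ => ?_)).mul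
      (tendsto_finsetProd _ fun r _ => (Tendsto.mul ?_ ?_).mul tendsto_const_nhds))
  · exact tendsto_ellGamma_comp hp hq (hcdm' β (u s)) (by simpa using hm hβ (h1u s))
      (by simp [hβ0, hu s])
  · exact tendsto_ellGamma_comp hp hq (hcmm t0 u0) (by simpa using hm h1t0 h1u0)
      (by simp [ht0, hu0])
  · exact tendsto_ellGamma_comp hp hq (hcm' t0 (u s)) (by simpa using hm h1t0 (h1u s))
      (by simp [ht0, hu s])
  · exact tendsto_ellGamma_comp hp hq (hcm (t r) u0) (by simpa using hm (h1t r) h1u0)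
      (by simp [ht r, hu0])
  · exact tendsto_ellGamma_comp hp hq (hcdm (t r) α) (by simpa using hm (h1t r) hα)
      (by simp [ht r, hα0])

lemma gamWt_optPar_dual {τs υs α β ω t0 u0 : ℂ} {t u : κ → ℂ} (hτs : τs = β * ω)
    (hυs : υs = α / ω) (hα0 : α ≠ 0) (hβ0 : β ≠ 0) (hω : ω ≠ 0) {ρ : ℝ} (hρ : ρ ≠ 0) (z : ℂ) :
    gamWt p q (fun o => τs / optPar (β / ρ) (t0 * ρ) t o)
      (fun o => υs / optPar (u0 * ρ) (α / ρ) u o) z =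
    ellGamma (ρ * (ω * z)) p q * ellGamma (ρ / (ω * z)) p q *
      gamWt p q (fun o : Option κ => o.elim (β / (t0 * ρ)) fun k => β / t k)
        (fun o => o.elim (α / (u0 * ρ)) fun k => α / u k) (ω * z) := by
  have hρ' : (ρ : ℂ) ≠ 0 := Complex.ofReal_ne_zero.2 hρ
  subst hτs hυs
  unfold gamWt
  simp only [Fintype.prod_option, optPar, Option.elim_none, Option.elim_some]
  have e1 : β * ω / (β / ρ) * z = ρ * (ω * z) := by field_simp
  have e2 : α / ω / (u0 * ρ) / z = α / (u0 * ρ) / (ω * z) := by simp only [div_div]; ring_nf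
  have e3 : β * ω / (t0 * ρ) * z = β / (t0 * ρ) * (ω * z) := by ring
  have e4 : α / ω / (α / ρ) / z = ρ / (ω * z) := by
    rw [div_div_div_comm, div_self hα0, one_div_div, div_div]
  have e5 : ∀ k, β * ω / t k * z = β / t k * (ω * z) := fun k => by ring
  have e6 : ∀ k, α / ω / u k / z = α / u k / (ω * z) := fun k => by
    simp only [div_div]; ring_nf
  simp only [e1, e2, e3, e4, e5, e6]
  ring

lemma gamWt_optPar_one (hp : ‖p‖ < 1) (hq : ‖q‖ < 1) (hpq : p * q ≠ 0) {α β t0 u0 : ℂ}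
    {t u : κ → ℂ} (hαβ : α * β = p * q) (hα : ‖α‖ < 1) (hβ : ‖β‖ < 1) {z : ℂ} (hz : ‖z‖ = 1) :
    gamWt p q (optPar β t0 t) (optPar u0 α u) z =
      gamWt p q (fun o : Option κ => o.elim t0 t) (fun o => o.elim u0 u) z := by
  have hz0 : z ≠ 0 := norm_ne_zero_iff.1 (by rw [hz]; exact one_ne_zero)
  have h : ellGamma (β * z) p q * ellGamma (α / z) p q = 1 := by
    refine ellGamma_mul_reflect' hp hq ?_ ?_ ?_ hpq
    · rw [← hαβ]; field_simp
    · rwa [norm_mul, hz, mul_one]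
    · rwa [norm_div, hz, div_one]
  unfold gamWt
  simp only [Fintype.prod_option, optPar, Option.elim_none, Option.elim_some]
  linear_combination (ellGamma (t0 * z) p q * ellGamma (u0 / z) p q *
    ∏ r, ellGamma (t r * z) p q * ellGamma (u r / z) p q) * h

lemma pinchRest_one_mul (hp : ‖p‖ < 1) (hq : ‖q‖ < 1) (hpq : p * q ≠ 0) {α β t0 u0 : ℂ}
    {t u : κ → ℂ} (hαβ : α * β = p * q) (ht0 : t0 ≠ 0) (hu0 : u0 ≠ 0)
    (ht : ∀ k, t k ≠ 0) (hu : ∀ k, u k ≠ 0)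
    (hα : ‖α‖ < 1) (hβ : ‖β‖ < 1) (h1t0 : ‖t0‖ < 1) (h1u0 : ‖u0‖ < 1)
    (h1t : ∀ k, ‖t k‖ < 1) (h1u : ∀ k, ‖u k‖ < 1)
    (hβt0 : ‖β‖ < ‖t0‖) (hαu0 : ‖α‖ < ‖u0‖) (hβt : ∀ k, ‖β‖ < ‖t k‖) (hαu : ∀ k, ‖α‖ < ‖u k‖) :
    pinchRest p q α β t0 u0 t u 1 *
      gamWt p q (fun o : Option κ => o.elim (β / (t0 * (1 : ℝ))) fun k => β / t k)
        (fun o => o.elim (α / (u0 * (1 : ℝ))) fun k => α / u k) 1 =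
    ∏ r : Option κ, ∏ s : Option κ,
      ellGamma ((r.elim t0 t : ℂ) * (s.elim u0 u : ℂ)) p q := by
  have hm : ∀ {a b : ℂ}, ‖a‖ < 1 → ‖b‖ < 1 → ‖a * b‖ < 1 := fun ha hb => by
    rw [norm_mul]; exact mul_lt_one_of_nonneg_of_lt_one_left (norm_nonneg _) ha hb.le
  have hu' : ∀ {x : ℂ}, x ≠ 0 → ‖x‖ < 1 → ‖α‖ < ‖x‖ →
      ellGamma (β * x) p q * ellGamma (α / x) p q = 1 := fun h0 h1 h2 =>
    ellGamma_mul_reflect' hp hq (by rw [← hαβ]; field_simp) (hm hβ h1)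
      (by rwa [norm_div, div_lt_one (norm_pos_iff.2 h0)]) hpq
  have ht' : ∀ {x : ℂ}, x ≠ 0 → ‖x‖ < 1 → ‖β‖ < ‖x‖ →
      ellGamma (x * α) p q * ellGamma (β / x) p q = 1 := fun h0 h1 h2 =>
    ellGamma_mul_reflect' hp hq (by rw [← hαβ]; field_simp) (hm h1 hα)
      (by rwa [norm_div, div_lt_one (norm_pos_iff.2 h0)]) hpq
  have a1 := hu' hu0 h1u0 hαu0
  have a2 := ht' ht0 h1t0 hβt0
  have a3 : (∏ k, ellGamma (β * u k) p q) * ∏ k, ellGamma (α / u k) p q = 1 := by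
    rw [← Finset.prod_mul_distrib]
    exact Finset.prod_eq_one fun k _ => hu' (hu k) (h1u k) (hαu k)
  have a4 : (∏ k, ellGamma (t k * α) p q) * ∏ k, ellGamma (β / t k) p q = 1 := by
    rw [← Finset.prod_mul_distrib]
    exact Finset.prod_eq_one fun k _ => ht' (ht k) (h1t k) (hβt k)
  unfold pinchRest gamWt
  simp only [Fintype.prod_option, Option.elim_none, Option.elim_some, Complex.ofReal_one, mul_one,
    div_one, Finset.prod_mul_distrib]
  set A1 := ellGamma (β * u0) p q
  set A2 := ellGamma (α / u0) p q
  set A3 := ellGamma (t0 * α) p q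
  set A4 := ellGamma (β / t0) p q
  set B1 := ∏ k, ellGamma (β * u k) p q
  set B2 := ∏ k, ellGamma (α / u k) p q
  set B3 := ∏ k, ellGamma (t k * α) p q
  set B4 := ∏ k, ellGamma (β / t k) p q
  set X1 := ellGamma (t0 * u0) p q
  set X2 := ∏ s, ellGamma (t0 * u s) p q
  set X3 := ∏ r, ellGamma (t r * u0) p q
  set X4 := ∏ r, ∏ s, ellGamma (t r * u s) p q
  calc _ = (X1 * X2 * X3 * X4) * (A1 * A2) * (A3 * A4) * (B1 * B2) * (B3 * B4) := by ring
    _ = _ := by rw [a1, a2, a3, a4]; ring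

end PinchLimit

section PinchTr

variable {κ : Type} [Fintype κ] {p q : ℂ}

lemma selInt_dual_rotate {m n : ℕ} {τ υ τs α β t0 u0 : ℂ} {t u : κ → ℂ} (ζ κs : TT)
    (H : TrDom m n p q τ υ (fun o : Option κ => o.elim t0 t) fun o => o.elim u0 u)
    (hαβ : α * β = p * q) (hβ : ‖β‖ = ‖τ‖) (hτs : τs ^ (m + 2) = β * (t0 * ∏ k, t k))
    (hκ : eT κs = τs / β) :
    selInt m p q ζ (gamWt p q (fun o : Option κ => τ / o.elim t0 t) fun o => υ / o.elim u0 u) =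
      selInt m p q (ζ + (m + 2) • κs)
        (gamWt p q (fun o : Option κ => o.elim (β / (t0 * (1 : ℝ))) fun k => β / t k)
          (fun o => o.elim (α / (u0 * (1 : ℝ))) fun k => α / u k)) := by
  have hpq : p * q ≠ 0 := mul_ne_zero H.hp0 H.hq0
  have hβ0 : β ≠ 0 := right_ne_zero_of_mul (hαβ ▸ hpq)
  have hα0 : α ≠ 0 := left_ne_zero_of_mul (hαβ ▸ hpq)
  have hτ0 := H.hτ0
  have hT : τ ^ (m + 1) = t0 * ∏ k, t k := by simpa [Fintype.prod_option] using H.hτ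
  obtain ⟨a, ha⟩ := exists_eT_eq (κ := τ / β) (by
    rw [norm_div, hβ, div_self (norm_ne_zero_iff.2 hτ0)])
  have hnat : ∀ (k : ℕ) (x : TT), eT (k • x) = eT x ^ k := fun k x => by
    have := eT_zsmul (k : ℤ) x
    rwa [natCast_zsmul, zpow_natCast] at this
  have hak : (m + 1) • a = (m + 2) • κs := by
    apply eT_injective
    rw [hnat, hnat, ha, hκ, div_pow, div_pow, hT, hτs, pow_succ β (m + 1)]
    have hβm := pow_ne_zero (m + 1) hβ0
    field_simp
  rw [← hak, ← selInt_rotate, ha]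
  congr 1
  funext z
  have hυ : υ = α / (τ / β) := by
    rw [div_div_eq_mul_div, hαβ, ← H.hτυ]; field_simp
  unfold gamWt
  simp only [Fintype.prod_option, Option.elim_none, Option.elim_some, Complex.ofReal_one, mul_one]
  obtain ⟨ω, hω⟩ : ∃ ω, ω = τ / β := ⟨_, rfl⟩
  have hτω : τ = β * ω := by rw [hω]; field_simp
  have e1 : ∀ x, τ / x * z = β / x * (ω * z) := fun x => by rw [hτω]; ring
  have e2 : ∀ x, υ / x / z = α / x / (ω * z) := fun x => by
    rw [hυ, ← hω]; simp only [div_div]; ring_nf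
  rw [← hω]
  simp only [e1, e2]

theorem tr_of_pinch {m n : ℕ} {τ υ τs υs α β t0 u0 : ℂ} {t u : κ → ℂ} (ζ κs : TT)
    (H : TrDom m n p q τ υ (fun o : Option κ => o.elim t0 t) fun o => o.elim u0 u)
    (hαβ : α * β = p * q) (hβ : ‖β‖ = ‖τ‖) (hτυs : τs * υs = p * q)
    (hτs : τs ^ (m + 2) = β * (t0 * ∏ k, t k)) (hκ : eT κs = τs / β)
    (hζ : m ≠ 0 ∨ ζ + (m + 2) • κs ≠ 0)
    (hsrc : ∀ᶠ ρ : ℝ in 𝓝[<] 1, Tr (m + 1) n p q ζ τs υs (optPar (β / ρ) (t0 * ρ) t)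
      (optPar (u0 * ρ) (α / ρ) u)) :
    Tr m n p q ζ τ υ (fun o : Option κ => o.elim t0 t) fun o => o.elim u0 u := by
  have hp := H.hp
  have hq := H.hq
  have hpq : p * q ≠ 0 := mul_ne_zero H.hp0 H.hq0
  have hβ0 : β ≠ 0 := right_ne_zero_of_mul (hαβ ▸ hpq)
  have hα0 : α ≠ 0 := left_ne_zero_of_mul (hαβ ▸ hpq)
  have hτ0 := H.hτ0
  have hα : ‖α‖ = ‖υ‖ := by
    have h1 : ‖α‖ * ‖β‖ = ‖τ‖ * ‖υ‖ := by rw [← norm_mul, ← norm_mul, hαβ, H.hτυ]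
    rw [hβ, mul_comm ‖τ‖] at h1
    exact mul_right_cancel₀ (norm_ne_zero_iff.2 hτ0) h1
  have ht00 : t0 ≠ 0 := H.ht0 none
  have hu00 : u0 ≠ 0 := H.hu0 none
  have ht0 : ∀ k, t k ≠ 0 := fun k => H.ht0 (some k)
  have hu0 : ∀ k, u k ≠ 0 := fun k => H.hu0 (some k)
  have h1t0 : ‖t0‖ < 1 := H.ht none
  have h1u0 : ‖u0‖ < 1 := H.hu none
  have h1t : ∀ k, ‖t k‖ < 1 := fun k => H.ht (some k)
  have h1u : ∀ k, ‖u k‖ < 1 := fun k => H.hu (some k)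
  have hβt0 : ‖β‖ < ‖t0‖ := hβ ▸ H.hτt none
  have hαu0 : ‖α‖ < ‖u0‖ := hα ▸ H.hυu none
  have hβt : ∀ k, ‖β‖ < ‖t k‖ := fun k => hβ ▸ H.hτt (some k)
  have hαu : ∀ k, ‖α‖ < ‖u k‖ := fun k => hα ▸ H.hυu (some k)
  have hβ1 : ‖β‖ < 1 := hβt0.trans h1t0
  have hα1 : ‖α‖ < 1 := hαu0.trans h1u0
  have htp : 0 < ‖t0‖ := norm_pos_iff.2 ht00
  have hup : 0 < ‖u0‖ := norm_pos_iff.2 hu00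
  obtain ⟨ρ₀, hρ₀, hρ₁⟩ := exists_between (max_lt ((div_lt_one htp).2 hβt0)
    ((div_lt_one hup).2 hαu0))
  have hρp : 0 < ρ₀ := lt_of_le_of_lt (by positivity) ((le_max_left _ _).trans_lt hρ₀)
  have hI : ∀ ρ ∈ Icc ρ₀ 1, (ρ : ℂ) ≠ 0 ∧ ‖(ρ : ℂ)‖ = ρ ∧ 0 < ρ ∧ ρ ≤ 1 ∧ ‖β‖ < ρ * ‖t0‖ ∧
      ‖α‖ < ρ * ‖u0‖ ∧ ‖β‖ < ρ ∧ ‖α‖ < ρ := fun ρ hρ => by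
    have h0 : 0 < ρ := hρp.trans_le hρ.1
    have hb := (div_lt_iff₀ htp).1 (((le_max_left _ _).trans_lt hρ₀).trans_le hρ.1)
    have ha := (div_lt_iff₀ hup).1 (((le_max_right _ _).trans_lt hρ₀).trans_le hρ.1)
    refine ⟨Complex.ofReal_ne_zero.2 h0.ne', ?_, h0, hρ.2, hb, ha, ?_, ?_⟩
    · rw [Complex.norm_real, Real.norm_of_nonneg h0.le]
    · nlinarith
    · nlinarith
  have hco : ContinuousOn (fun ρ : ℝ => (ρ : ℂ)) (Icc ρ₀ 1) := Complex.continuous_ofReal.continuousOn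
  have hcd : ∀ c : ℂ, ContinuousOn (fun ρ : ℝ => c / ρ) (Icc ρ₀ 1) := fun c =>
    continuousOn_const.div hco fun ρ hρ => (hI ρ hρ).1
  have hcm : ∀ c : ℂ, ContinuousOn (fun ρ : ℝ => c * ρ) (Icc ρ₀ 1) := fun c =>
    continuousOn_const.mul hco
  have hcdm : ∀ b : ℂ, ∀ c : ℂ, c ≠ 0 → ContinuousOn (fun ρ : ℝ => b / (c * ρ)) (Icc ρ₀ 1) :=
    fun b c hc => continuousOn_const.div (hcm c) fun ρ hρ => mul_ne_zero hc (hI ρ hρ).1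
  have hleft := tendsto_selInt_gamWt (N := n) (ι := Option (Option κ)) ζ hp hq hρ₁
    (t := fun o ρ => optPar (β / ρ) (t0 * ρ) t o) (u := fun o ρ => optPar (u0 * ρ) (α / ρ) u o)
    (by
      rintro (_ | _ | k)
      · exact hcd β
      · exact hcm t0
      · exact continuousOn_const)
    (by
      rintro (_ | _ | k)
      · exact hcm u0
      · exact hcd α
      · exact continuousOn_const)
    (by
      rintro (_ | _ | k) ρ hρ
      · exact div_ne_zero hβ0 (hI ρ hρ).1
      · exact mul_ne_zero ht00 (hI ρ hρ).1
      · exact ht0 k)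
    (by
      rintro (_ | _ | k) ρ hρ
      · exact mul_ne_zero hu00 (hI ρ hρ).1
      · exact div_ne_zero hα0 (hI ρ hρ).1
      · exact hu0 k)
    (by
      rintro (_ | _ | k) ρ hρ <;> obtain ⟨-, e, h0, h1, -, -, hb, -⟩ := hI ρ hρ
      · change ‖β / ρ‖ < 1
        rwa [norm_div, e, div_lt_one h0]
      · change ‖t0 * ρ‖ < 1
        rw [norm_mul, e]; nlinarith
      · exact h1t k)
    (by
      rintro (_ | _ | k) ρ hρ <;> obtain ⟨-, e, h0, h1, -, -, -, ha⟩ := hI ρ hρ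
      · change ‖u0 * ρ‖ < 1
        rw [norm_mul, e]; nlinarith
      · change ‖α / ρ‖ < 1
        rwa [norm_div, e, div_lt_one h0]
      · exact h1u k)
  set g : ℝ → ℂ → ℂ := fun ρ z =>
    gamWt p q (fun o : Option κ => o.elim (β / (t0 * ρ)) fun k => β / t k)
      (fun o => o.elim (α / (u0 * ρ)) fun k => α / u k) z with hg
  have hgc : ContinuousOn (fun x : ℝ × ℂ => g x.1 x.2) (Icc ρ₀ 1 ×ˢ {z | ‖z‖ = 1}) := by
    refine continuousOn_gamWt_real (ι := Option κ) hp hq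
      (t := fun o ρ => o.elim (β / (t0 * ρ)) fun k => β / t k)
      (u := fun o ρ => o.elim (α / (u0 * ρ)) fun k => α / u k) ?_ ?_ ?_ ?_ ?_ ?_
    · rintro (_ | k)
      · exact hcdm β t0 ht00
      · exact continuousOn_const
    · rintro (_ | k)
      · exact hcdm α u0 hu00
      · exact continuousOn_const
    · rintro (_ | k) ρ hρ
      · exact div_ne_zero hβ0 (mul_ne_zero ht00 (hI ρ hρ).1)
      · exact div_ne_zero hβ0 (ht0 k)
    · rintro (_ | k) ρ hρ
      · exact div_ne_zero hα0 (mul_ne_zero hu00 (hI ρ hρ).1)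
      · exact div_ne_zero hα0 (hu0 k)
    · rintro (_ | k) ρ hρ <;> obtain ⟨-, e, h0, -, hb, -, -, -⟩ := hI ρ hρ
      · change ‖β / (t0 * ρ)‖ < 1
        rw [norm_div, norm_mul, e, div_lt_one (by positivity), mul_comm]; exact hb
      · change ‖β / t k‖ < 1
        rw [norm_div, div_lt_one (norm_pos_iff.2 (ht0 k))]; exact hβt k
    · rintro (_ | k) ρ hρ <;> obtain ⟨-, e, h0, -, -, ha, -, -⟩ := hI ρ hρ
      · change ‖α / (u0 * ρ)‖ < 1
        rw [norm_div, norm_mul, e, div_lt_one (by positivity), mul_comm]; exact ha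
      · change ‖α / u k‖ < 1
        rw [norm_div, div_lt_one (norm_pos_iff.2 (hu0 k))]; exact hαu k
  have hpinch := tendsto_selInt_pinch (M := m) (ζ + (m + 2) • κs) hζ hp hq hρp hρ₁ hgc
  have hrest := tendsto_pinchRest hp hq hα1 hβ1 hα0 hβ0 ht00 hu00 ht0 hu0 h1t0 h1u0 h1t h1u
  have hreg := (continuousAt_regGamma_sq hp hq).inv₀ (regGamma_one_ne_zero hp hq)
  have hright := (hrest.mul hreg).mul hpinch
  have hω : τs / β ≠ 0 := hκ ▸ eT_ne_zero κs
  have hτs' : τs = β * (τs / β) := by field_simp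
  have hτs0 : τs ≠ 0 := left_ne_zero_of_mul (hτυs ▸ hpq)
  have hυs' : υs = α / (τs / β) := by
    rw [div_div_eq_mul_div, hαβ, ← hτυs]; field_simp
  have hev : (fun ρ : ℝ => selInt n p q ζ
        (gamWt p q (fun o => optPar (β / ρ) (t0 * ρ) t o) fun o => optPar (u0 * ρ) (α / ρ) u o))
      =ᶠ[𝓝[<] 1] fun ρ : ℝ => pinchRest p q α β t0 u0 t u ρ * (regGamma ((ρ : ℂ) ^ 2) p q)⁻¹ *
        ((1 - (ρ : ℂ) ^ 2) * selInt (m + 1) p q (ζ + (m + 2) • κs)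
        fun z => ellGamma (ρ * z) p q * ellGamma (ρ / z) p q * g ρ z) := by
    filter_upwards [hsrc, Ioo_mem_nhdsLT hρ₁] with ρ h hρ
    have hρ0 : ρ ≠ 0 := (hρp.trans hρ.1).ne'
    have h' : selInt n p q ζ _ = _ := h
    rw [prod_optPar hp hq hpq hαβ t0 u0 t u hρ0] at h'
    rw [show (fun o => optPar (β / ρ) (t0 * ρ) t o) = optPar (β / ρ) (t0 * ρ) t from rfl,
      show (fun o => optPar (u0 * ρ) (α / ρ) u o) = optPar (u0 * ρ) (α / ρ) u from rfl, h']
    have hr := selInt_rotate (p := p) (q := q) (N := m + 1) ζ κs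
      fun z => ellGamma (ρ * z) p q * ellGamma (ρ / z) p q * g ρ z
    rw [show (m + 1 + 1) • κs = (m + 2) • κs from rfl] at hr
    rw [← hr, hκ]
    have hz : ∀ z, gamWt p q (fun o => τs / optPar (β / ρ) (t0 * ρ) t o)
      (fun o => υs / optPar (u0 * ρ) (α / ρ) u o) z =
        ellGamma (ρ * (τs / β * z)) p q * ellGamma (ρ / (τs / β * z)) p q *
          g ρ (τs / β * z) :=
      fun z => gamWt_optPar_dual hτs' hυs' hα0 hβ0 hω hρ0 z
    rw [show gamWt p q (fun o => τs / optPar (β / ρ) (t0 * ρ) t o)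
      (fun o => υs / optPar (u0 * ρ) (α / ρ) u o) = _ from funext hz]
    ring
  have hlim := tendsto_nhds_unique (hleft.congr' hev) hright
  have hL : selInt n p q ζ (gamWt p q (fun o => optPar (β / ((1 : ℝ) : ℂ)) (t0 * ((1 : ℝ) : ℂ)) t o)
      fun o => optPar (u0 * ((1 : ℝ) : ℂ)) (α / ((1 : ℝ) : ℂ)) u o) =
      selInt n p q ζ (gamWt p q (fun o : Option κ => o.elim t0 t) fun o => o.elim u0 u) := by
    refine selInt_congr ζ fun z hz => ?_
    rw [Complex.ofReal_one, div_one, div_one, mul_one, mul_one]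
    exact gamWt_optPar_one hp hq hpq hαβ hα1 hβ1 hz
  have hP := pinchRest_one_mul hp hq hpq hαβ ht00 hu00 ht0 hu0 hα1 hβ1 h1t0 h1u0 h1t h1u hβt0
    hαu0 hβt hαu
  unfold Tr
  rw [← hL, hlim, ← hP, selInt_dual_rotate ζ κs H hαβ hβ hτs hκ, regGamma_one hp hq, inv_inv]
  have hQ : qPoch p * qPoch q ≠ 0 := mul_ne_zero (qPoch_ne_zero hp) (qPoch_ne_zero hq)
  change _ = pinchRest p q α β t0 u0 t u 1 * g 1 1 * selInt m p q (ζ + (m + 2) • κs) (g 1)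
  rw [show ∀ a b c Q : ℂ, a * Q * (Q⁻¹ * b * c) = Q * Q⁻¹ * (a * b * c) from fun a b c Q => by ring,
    mul_inv_cancel₀ hQ, one_mul]

end PinchTr

section Moves

variable {ι : Type} [Fintype ι] {m n : ℕ} {p q τ υ h : ℂ} {t u a b : ι → ℂ}

lemma trDomAt_of_norm (H : TrDom m n p q τ υ t u) (hs : ∑ r, a r + ∑ r, b r = (m + 1) * h) {s : ℂ}
    (h1 : ‖p * Complex.exp (h * s)‖ < 1) (h2 : ∀ r, ‖t r * Complex.exp (a r * s)‖ < 1)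
    (h3 : ∀ r, ‖u r * Complex.exp (b r * s)‖ < 1)
    (h4 : ∀ r, ‖τ * Complex.exp ((∑ r, a r) / (m + 1) * s)‖ < ‖t r * Complex.exp (a r * s)‖)
    (h5 : ∀ r, ‖υ * Complex.exp ((∑ r, b r) / (m + 1) * s)‖ < ‖u r * Complex.exp (b r * s)‖) :
    TrDomAt m n p q τ υ h t u a b s :=
  (trDomAt_iff H hs s).2 ⟨h1, mem_iInter.2 fun r => ⟨⟨⟨h2 r, h3 r⟩,
    (norm_mul_exp_lt_iff (H.ht0 r)).1 (h4 r)⟩, (norm_mul_exp_lt_iff (H.hu0 r)).1 (h5 r)⟩⟩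

lemma frequently_line {P : ℂ → Prop} (z w : ℂ) (hw : w ≠ 0)
    (h : ∃ᶠ y : ℝ in 𝓝[≠] 0, P (z + y * w)) : ∃ᶠ s in 𝓝[≠] z, P s := by
  have hc : Continuous fun y : ℝ => z + y * w := by fun_prop
  have ht : Tendsto (fun y : ℝ => z + y * w) (𝓝[≠] 0) (𝓝[≠] z) := by
    refine tendsto_nhdsWithin_iff.2 ⟨?_, ?_⟩
    · have := (hc.tendsto 0).mono_left (nhdsWithin_le_nhds (s := {(0 : ℝ)}ᶜ))
      simpa using this
    · filter_upwards [self_mem_nhdsWithin] with y hy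
      have : (y : ℂ) * w ≠ 0 := mul_ne_zero (Complex.ofReal_ne_zero.2 hy) hw
      simpa using this
  exact ht.frequently h

lemma norm_exp_ofReal_mul_I_mul (x y : ℝ) : ‖Complex.exp (Complex.I * x * y)‖ = 1 := by
  rw [show Complex.I * x * y = ((x * y : ℝ) : ℂ) * Complex.I by push_cast; ring]
  exact Complex.norm_exp_ofReal_mul_I _

theorem tr_of_rotation (ζ : TT) (θ : ι → ℝ) (H : TrDom m n p q τ υ t u)
    (hθ : ∃ᶠ y : ℝ in 𝓝[≠] 0, ∀ τ' υ' : ℂ, ∀ t' u' : ι → ℂ, TrDom m n p q τ' υ' t' u' →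
      τ' = τ * Complex.exp (Complex.I * ((∑ r, θ r) / (m + 1) : ℝ) * y) →
      (∀ r, t' r = t r * Complex.exp (Complex.I * θ r * y)) →
      (∀ r, u' r = u r * (Complex.exp (Complex.I * θ r * y))⁻¹) → Tr m n p q ζ τ' υ' t' u') :
    Tr m n p q ζ τ υ t u := by
  have hs : ∑ r, Complex.I * (θ r : ℂ) + ∑ r, -(Complex.I * (θ r : ℂ)) = (m + 1) * 0 := by
    rw [Finset.sum_neg_distrib]; ring
  have hsum : (∑ r, Complex.I * (θ r : ℂ)) / (m + 1) =
      Complex.I * (((∑ r, θ r) / (m + 1) : ℝ) : ℂ) := by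
    rw [← Finset.mul_sum]; push_cast; ring
  have hsum' : (∑ r, -(Complex.I * (θ r : ℂ))) / (m + 1) =
      -(Complex.I * (((∑ r, θ r) / (m + 1) : ℝ) : ℂ)) := by
    rw [Finset.sum_neg_distrib, neg_div, hsum]
  have hdom : ∀ y : ℝ, TrDomAt m n p q τ υ 0 t u (fun r => Complex.I * θ r)
      (fun r => -(Complex.I * θ r)) y := fun y => by
    have hneg : ∀ x : ℝ, ‖Complex.exp (-(Complex.I * x) * y)‖ = 1 := fun x => by
      rw [neg_mul, Complex.exp_neg, norm_inv, norm_exp_ofReal_mul_I_mul, inv_one]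
    refine trDomAt_of_norm H hs ?_ ?_ ?_ ?_ ?_
    · simpa using H.hp
    · intro r; rw [norm_mul, norm_exp_ofReal_mul_I_mul, mul_one]; exact H.ht r
    · intro r; rw [norm_mul, hneg, mul_one]; exact H.hu r
    · intro r
      rw [hsum, norm_mul, norm_mul, norm_exp_ofReal_mul_I_mul, norm_exp_ofReal_mul_I_mul, mul_one,
        mul_one]
      exact H.hτt r
    · intro r
      rw [hsum', norm_mul, norm_mul, hneg, hneg, mul_one, mul_one]
      exact H.hυu r
  refine tr_of_frequently ζ H hs (z₀ := 0) (by simpa using hdom 0) ?_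
  refine frequently_line 0 1 one_ne_zero (hθ.mono fun y hy => ?_)
  rw [zero_add, mul_one]
  have hd := hdom y
  unfold TrDomAt at hd
  unfold TrAt
  have hp : p * Complex.exp (0 * y) = p := by simp
  rw [hp] at hd ⊢
  refine hy _ _ _ _ hd (by rw [hsum]) (fun r => rfl) fun r => ?_
  rw [neg_mul, Complex.exp_neg]

theorem tr_of_norm_eq (ζ : TT) {X : ι → ℝ} {Y : ℝ} (H : TrDom m n p q τ υ t u)
    (hX0 : ∀ r, 0 < X r) (hY0 : 0 < Y) (hX1 : ∀ r, X r < 1) (hYX : ∀ r, Y < X r)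
    (hcX : ∀ r, ‖t r * u r‖ < X r) (hXc : ∀ r, X r * ‖p * q‖ < Y * ‖t r * u r‖)
    (hY : Y ^ (m + 1) = ∏ r, X r)
    (hall : ∀ τ' υ' : ℂ, ∀ t' u' : ι → ℂ, TrDom m n p q τ' υ' t' u' → ‖τ'‖ = Y →
      (∀ r, ‖t' r‖ = X r) → (∀ r, t' r * u' r = t r * u r) → Tr m n p q ζ τ' υ' t' u') :
    Tr m n p q ζ τ υ t u := by
  set a : ι → ℝ := fun r => Real.log (X r / ‖t r‖) with ha
  have htp : ∀ r, 0 < ‖t r‖ := fun r => norm_pos_iff.2 (H.ht0 r)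
  have hs : ∑ r, (a r : ℂ) + ∑ r, -(a r : ℂ) = (m + 1) * 0 := by
    rw [Finset.sum_neg_distrib]; ring
  have hre : ∀ (x : ℝ) (y : ℝ), ‖Complex.exp (x * (1 + y * Complex.I))‖ = Real.exp x := fun x y => by
    rw [Complex.norm_exp]; simp
  have ht : ∀ (y : ℝ) r, ‖t r * Complex.exp (a r * (1 + y * Complex.I))‖ = X r := fun y r => by
    rw [norm_mul, hre, ha, Real.exp_log (div_pos (hX0 r) (htp r))]
    field_simp [(htp r).ne']
  have hsum : (∑ r, (a r : ℂ)) / (m + 1) = (((∑ r, a r) / (m + 1) : ℝ) : ℂ) := by push_cast; rfl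
  have hsum' : (∑ r, -(a r : ℂ)) / (m + 1) = -(((∑ r, a r) / (m + 1) : ℝ) : ℂ) := by
    rw [Finset.sum_neg_distrib, neg_div, hsum]
  have hτ : ∀ y : ℝ, ‖τ * Complex.exp ((∑ r, (a r : ℂ)) / (m + 1) * (1 + y * Complex.I))‖ = Y := by
    intro y
    rw [hsum, norm_mul, hre]
    refine (pow_left_inj₀ (by positivity) hY0.le (m.succ_ne_zero)).1 ?_
    rw [Nat.succ_eq_add_one, hY, mul_pow, ← norm_pow, H.hτ, norm_prod, ← Real.exp_nat_mul]
    have : ((m + 1 : ℕ) : ℝ) * ((∑ r, a r) / (m + 1)) = ∑ r, a r := by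
      push_cast; field_simp
    rw [this, Real.exp_sum, ← Finset.prod_mul_distrib]
    refine Finset.prod_congr rfl fun r _ => ?_
    rw [ha, Real.exp_log (div_pos (hX0 r) (htp r))]
    field_simp [(htp r).ne']
  have hpq0 : 0 < ‖p * q‖ := norm_pos_iff.2 (mul_ne_zero H.hp0 H.hq0)
  have hu : ∀ (y : ℝ) r, ‖u r * Complex.exp (-(a r : ℂ) * (1 + y * Complex.I))‖ =
      ‖t r * u r‖ / X r := fun y r => by
    rw [eq_div_iff (hX0 r).ne', ← ht y r, ← norm_mul, neg_mul, Complex.exp_neg]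
    congr 1
    field_simp [Complex.exp_ne_zero]
  have hυ : ∀ y : ℝ, ‖υ * Complex.exp ((∑ r, -(a r : ℂ)) / (m + 1) * (1 + y * Complex.I))‖ =
      ‖p * q‖ / Y := fun y => by
    rw [eq_div_iff hY0.ne', ← hτ y, ← norm_mul, hsum', hsum, neg_mul, Complex.exp_neg, ← H.hτυ]
    congr 1
    field_simp [Complex.exp_ne_zero]
  have hdom : ∀ y : ℝ, TrDomAt m n p q τ υ 0 t u (fun r => (a r : ℂ))
      (fun r => -(a r : ℂ)) (1 + y * Complex.I) := fun y => by
    refine trDomAt_of_norm H hs ?_ ?_ ?_ ?_ ?_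
    · simpa using H.hp
    · intro r; rw [ht]; exact hX1 r
    · intro r; rw [hu, div_lt_one (hX0 r)]; exact hcX r
    · intro r; rw [ht, hτ]; exact hYX r
    · intro r
      rw [hu, hυ, div_lt_div_iff₀ hY0 (hX0 r)]
      have := hXc r
      linarith
  refine tr_of_frequently ζ H hs (z₀ := 1) (by simpa using hdom 0) ?_
  refine frequently_line 1 Complex.I Complex.I_ne_zero (Eventually.frequently (.of_forall ?_))
  intro y
  have hd := hdom y
  unfold TrDomAt at hd
  unfold TrAt
  have hp : p * Complex.exp (0 * (1 + y * Complex.I)) = p := by simp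
  rw [hp] at hd ⊢
  refine hall _ _ _ _ hd (hτ y) (ht y) fun r => ?_
  rw [neg_mul, Complex.exp_neg]
  field_simp [Complex.exp_ne_zero]

end Moves

section Merge

variable {κ : Type} [Fintype κ] {m n : ℕ} {p q τ υ : ℂ}

lemma tr_merge_of_norm_eq_of_ne {t u : Option κ → ℂ} {A B : ℂ} (ζ : TT)
    (H : TrDom m n p q τ υ t u) (hAB : A * B = t none * u none * (p * q))
    (hB : ‖B‖ = ‖τ‖ * ‖u none‖) (hnd : m ≠ 0 ∨ eT ζ * (τ * u none / B) ≠ 1)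
    (hsrc : ∀ τs υs : ℂ, ∀ t' u' : Option (Option κ) → ℂ, TrDom (m + 1) n p q τs υs t' u' →
      (∀ o, t' o * u' o = optPar B A (fun k => t (some k) * u (some k)) o) →
      Tr (m + 1) n p q ζ τs υs t' u') :
    Tr m n p q ζ τ υ t u := by
  have et : (fun o : Option κ => o.elim (t none) fun k => t (some k)) = t := by
    funext o; cases o <;> rfl
  have eu : (fun o : Option κ => o.elim (u none) fun k => u (some k)) = u := by
    funext o; cases o <;> rfl
  have hpq : p * q ≠ 0 := mul_ne_zero H.hp0 H.hq0
  have ht0 := H.ht0 none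
  have hu0 := H.hu0 none
  have hτ0 := H.hτ0
  have hB0 : B ≠ 0 := right_ne_zero_of_mul (hAB ▸ mul_ne_zero (mul_ne_zero ht0 hu0) hpq)
  have hαβ : A / t none * (B / u none) = p * q := by
    rw [div_mul_div_comm, hAB]; field_simp
  have hβ : ‖B / u none‖ = ‖τ‖ := by
    rw [norm_div, hB, mul_div_cancel_right₀ _ (norm_ne_zero_iff.2 hu0)]
  have hβ0 : B / u none ≠ 0 := div_ne_zero hB0 hu0
  have hT : τ ^ (m + 1) = t none * ∏ k, t (some k) := by
    rw [H.hτ, Fintype.prod_option]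
  obtain ⟨τs, hτs⟩ := IsAlgClosed.exists_pow_nat_eq (B / u none * (t none * ∏ k, t (some k)))
    (Nat.succ_pos (m + 1))
  have hτs' : τs ^ (m + 2) = B / u none * (t none * ∏ k, t (some k)) := hτs
  have hτs0 : τs ≠ 0 := by
    rintro rfl
    rw [← hT, zero_pow (by omega)] at hτs'
    exact mul_ne_zero hβ0 (pow_ne_zero _ hτ0) hτs'.symm
  have hτυs : τs * (p * q / τs) = p * q := by field_simp
  have hnτ : ‖τs‖ = ‖B / u none‖ := by
    refine (pow_left_inj₀ (norm_nonneg _) (norm_nonneg _) (by omega : m + 2 ≠ 0)).1 ?_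
    rw [← norm_pow, hτs', ← hT, norm_mul, norm_pow, ← hβ]; ring
  obtain ⟨κs, hκs⟩ := exists_eT_eq (κ := τs / (B / u none)) (by
    rw [norm_div, hnτ, div_self (norm_ne_zero_iff.2 hβ0)])
  have H' : TrDom m n p q τ υ (fun o : Option κ => o.elim (t none) fun k => t (some k))
      fun o : Option κ => o.elim (u none) fun k => u (some k) := by rwa [et, eu]
  rw [← et, ← eu]
  refine tr_of_pinch ζ κs H' hαβ hβ hτυs hτs' hκs ?_ ?_
  · by_cases hm : m = 0
    · subst hm
      refine Or.inr fun h0 => (hnd.resolve_left fun h => h rfl) ?_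
      have h1 : eT (ζ + (0 + 2) • κs) = 1 := by rw [h0, eT_zero]
      rw [eT_add, zero_add, two_nsmul, eT_add, hκs] at h1
      rw [← h1]
      have h2 : τs * τs = B / u none * τ := by
        have := hτs'
        rw [← hT] at this
        simpa [pow_two] using this
      rw [div_mul_div_comm, h2]
      field_simp
    · exact Or.inl hm
  · filter_upwards [trDom_pinch H' hαβ hβ hτυs hτs', Ioo_mem_nhdsLT (zero_lt_one' ℝ)] with ρ D hρ
    have hρ' : (ρ : ℂ) ≠ 0 := Complex.ofReal_ne_zero.2 hρ.1.ne'
    refine hsrc _ _ _ _ D ?_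
    rintro (_ | _ | k)
    · change B / u none / ρ * (u none * ρ) = B
      field_simp
    · change t none * ρ * (A / t none / ρ) = A
      field_simp
    · rfl

theorem tr_merge_of_norm_eq {t u : Option κ → ℂ} {A B : ℂ} (ζ : TT)
    (H : TrDom m n p q τ υ t u) (hAB : A * B = t none * u none * (p * q))
    (hB : ‖B‖ = ‖τ‖ * ‖u none‖)
    (hsrc : ∀ τs υs : ℂ, ∀ t' u' : Option (Option κ) → ℂ, TrDom (m + 1) n p q τs υs t' u' →
      (∀ o, t' o * u' o = optPar B A (fun k => t (some k) * u (some k)) o) →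
      Tr (m + 1) n p q ζ τs υs t' u') :
    Tr m n p q ζ τ υ t u := by
  by_cases hm : m ≠ 0
  · exact tr_merge_of_norm_eq_of_ne ζ H hAB hB (Or.inl hm) hsrc
  push Not at hm
  subst hm
  classical
  have hcard := H.card
  rw [Fintype.card_option] at hcard
  obtain ⟨k₀⟩ : Nonempty κ := Fintype.card_pos_iff.1 (by omega)
  have hpq : p * q ≠ 0 := mul_ne_zero H.hp0 H.hq0
  have hB0 : B ≠ 0 := right_ne_zero_of_mul
    (hAB ▸ mul_ne_zero (mul_ne_zero (H.ht0 none) (H.hu0 none)) hpq)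
  refine tr_of_rotation ζ (fun o : Option κ => if o = some k₀ then 1 else 0) H ?_
  have hsum : (∑ o : Option κ, if o = some k₀ then (1 : ℝ) else 0) = 1 := by simp
  have hd : HasDerivAt (fun y : ℝ => eT ζ * (τ * u none / B) * Complex.exp (Complex.I * y))
      (eT ζ * (τ * u none / B) * (Complex.exp (Complex.I * (0 : ℝ)) * (Complex.I * 1))) 0 :=
    (((Complex.ofRealCLM.hasDerivAt).const_mul Complex.I).cexp).const_mul _
  have hne := hd.eventually_ne (c := 1) (mul_ne_zero (mul_ne_zero (eT_ne_zero _)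
    (div_ne_zero (mul_ne_zero H.hτ0 (H.hu0 none)) hB0))
    (mul_ne_zero (Complex.exp_ne_zero _) (mul_ne_zero Complex.I_ne_zero one_ne_zero)))
  refine Eventually.frequently (hne.mono fun y hy τ' υ' t' u' H' hτ' ht' hu' => ?_)
  have hc : ∀ o, t' o * u' o = t o * u o := fun o => by
    rw [ht', hu']; field_simp [Complex.exp_ne_zero]
  have hu'0 : u' none = u none := by rw [hu']; simp
  have hτ'' : τ' = τ * Complex.exp (Complex.I * y) := by
    rw [hτ', hsum]; simp
  refine tr_merge_of_norm_eq_of_ne ζ H' (A := A) (B := B) (by rw [hc, hAB]) ?_ (Or.inr ?_) ?_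
  · have h1 := norm_exp_ofReal_mul_I_mul 1 y
    rw [Complex.ofReal_one, mul_one] at h1
    rw [hB, hu'0, hτ'', norm_mul, h1, mul_one]
  · rw [hu'0, hτ'']
    intro h
    apply hy
    rw [← h]; ring
  · simpa only [hc] using hsrc

lemma exists_merge_point {γ : κ → ℝ} {P α β γ₀ : ℝ} (hα : P < α) (hβ : P < β)
    (hγ₀ : γ₀ = α + β - P) (hγ₀0 : γ₀ < 0) (hγP : ∀ k, P < γ k) (hγ0 : ∀ k, γ k < 0)
    (hsum : γ₀ + ∑ k, γ k = (m + 1) * P) :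
    ∃ (y : ℝ) (x : κ → ℝ), β < y ∧ y < P - α ∧ (α - P + y) + ∑ k, x k = (m + 1) * y ∧
      (∀ k, y < x k) ∧ (∀ k, x k < 0) ∧ (∀ k, γ k < x k) ∧ ∀ k, x k + P < y + γ k := by
  obtain ⟨y, hy1, hy2⟩ := exists_between (show β < P - α by linarith)
  set lo : κ → ℝ := fun k => max y (γ k) with hlo
  set hi : κ → ℝ := fun k => min 0 (γ k - P + y) with hhi
  have hlt : ∀ k, lo k < hi k := fun k => by
    have := hγP k
    have := hγ0 k
    exact max_lt (lt_min (by linarith) (by linarith)) (lt_min (by linarith) (by linarith))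
  have hcount : ∀ (Q : κ → Prop) [DecidablePred Q] (z : ℝ),
      (∑ k, if Q k then z else 0) = (((Finset.univ.filter Q).card : ℕ) : ℝ) * z := fun Q _ z => by
    rw [← Finset.sum_filter, Finset.sum_const, nsmul_eq_mul]
  have hL : (α - P + y) + ∑ k, lo k - (m + 1) * y < 0 := by
    have b1 : ∑ k, lo k ≤ ∑ k, if γ k ≤ y then y else 0 := Finset.sum_le_sum fun k _ => by
      have := hγ0 k
      by_cases h : γ k ≤ y
      · rw [if_pos h]; exact max_le le_rfl h
      · rw [if_neg h]; exact max_le (by linarith) this.le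
    have b2 : ∑ k, lo k ≤ ∑ k, γ k + ∑ k, if γ k ≤ y then y - P else 0 := by
      rw [← Finset.sum_add_distrib]
      refine Finset.sum_le_sum fun k _ => ?_
      have := hγP k
      by_cases h : γ k ≤ y
      · rw [if_pos h]; exact max_le (by linarith) (by linarith)
      · rw [if_neg h]; exact max_le (by linarith) (by linarith)
    rw [hcount] at b1 b2
    set c := (Finset.univ.filter fun k => γ k ≤ y).card
    rcases Nat.lt_or_ge m c with h | h
    · have h' : (m : ℝ) + 1 ≤ c := by exact_mod_cast h
      nlinarith
    · have h' : (c : ℝ) ≤ m := by exact_mod_cast h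
      nlinarith
  have hU : 0 < (α - P + y) + ∑ k, hi k - (m + 1) * y := by
    have b1 : (∑ k, if γ k ≤ P - y then y else 0) ≤ ∑ k, hi k := Finset.sum_le_sum fun k _ => by
      have := hγP k
      by_cases h : γ k ≤ P - y
      · rw [if_pos h]; exact le_min (by linarith) (by linarith)
      · rw [if_neg h]; exact le_min le_rfl (by linarith)
    have b2 : (∑ k, γ k + ∑ k, if γ k ≤ P - y then y - P else 0) ≤ ∑ k, hi k := by
      rw [← Finset.sum_add_distrib]
      refine Finset.sum_le_sum fun k _ => ?_
      have := hγ0 k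
      by_cases h : γ k ≤ P - y
      · rw [if_pos h]; exact le_min (by linarith) (by linarith)
      · rw [if_neg h]; exact le_min (by linarith) (by linarith)
    rw [hcount] at b1 b2
    set c := (Finset.univ.filter fun k => γ k ≤ P - y).card
    rcases Nat.lt_or_ge m c with h | h
    · have h' : (m : ℝ) + 1 ≤ c := by exact_mod_cast h
      nlinarith
    · have h' : (c : ℝ) ≤ m := by exact_mod_cast h
      nlinarith
  set L := (α - P + y) + ∑ k, lo k - (m + 1) * y with hLdef
  set U := (α - P + y) + ∑ k, hi k - (m + 1) * y with hUdef
  set θ := -L / (U - L) with hθ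
  have hUL : 0 < U - L := by linarith
  have hθ0 : 0 < θ := div_pos (by linarith) hUL
  have hθ1 : θ < 1 := (div_lt_one hUL).2 (by linarith)
  have hx : ∀ k, lo k < (1 - θ) * lo k + θ * hi k ∧ (1 - θ) * lo k + θ * hi k < hi k := fun k => by
    have := hlt k
    constructor <;> nlinarith
  refine ⟨y, fun k => (1 - θ) * lo k + θ * hi k, hy1, hy2, ?_,
    fun k => (le_max_left _ _).trans_lt (hx k).1, fun k => (hx k).2.trans_le (min_le_left _ _),
    fun k => (le_max_right _ _).trans_lt (hx k).1, fun k => ?_⟩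
  · rw [Finset.sum_add_distrib, ← Finset.mul_sum, ← Finset.mul_sum]
    have h1 : θ * (U - L) = -L := div_mul_cancel₀ _ hUL.ne'
    rw [hLdef, hUdef] at h1
    linarith
  · have := (hx k).2.trans_le (min_le_right _ _)
    linarith

theorem tr_merge {t u : Option κ → ℂ} {A B : ℂ} (ζ : TT)
    (H : TrDom m n p q τ υ t u) (hAB : A * B = t none * u none * (p * q))
    (hA : ‖p * q‖ < ‖A‖) (hB : ‖p * q‖ < ‖B‖)
    (hsrc : ∀ τs υs : ℂ, ∀ t' u' : Option (Option κ) → ℂ, TrDom (m + 1) n p q τs υs t' u' →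
      (∀ o, t' o * u' o = optPar B A (fun k => t (some k) * u (some k)) o) →
      Tr (m + 1) n p q ζ τs υs t' u') :
    Tr m n p q ζ τ υ t u := by
  have hpq : 0 < ‖p * q‖ := norm_pos_iff.2 (mul_ne_zero H.hp0 H.hq0)
  have hA0 := hpq.trans hA
  have hB0 := hpq.trans hB
  have hc0 : ∀ o, 0 < ‖t o * u o‖ := fun o => hpq.trans (H.lt_norm_mul o o)
  have hγ₀ : Real.log ‖t none * u none‖ = Real.log ‖A‖ + Real.log ‖B‖ - Real.log ‖p * q‖ := by
    rw [← Real.log_mul hA0.ne' hB0.ne', ← norm_mul, hAB, norm_mul (t none * u none),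
      Real.log_mul (hc0 none).ne' hpq.ne', add_sub_cancel_right]
  have hprod : ‖t none * u none‖ * ∏ k, ‖t (some k) * u (some k)‖ = ‖p * q‖ ^ (m + 1) := by
    have h := Fintype.prod_option fun o => ‖t o * u o‖
    rw [← h, ← norm_prod, Finset.prod_mul_distrib, ← H.hτ, ← H.hυ, ← mul_pow, H.hτυ, norm_pow]
  have hsum : Real.log ‖t none * u none‖ + ∑ k, Real.log ‖t (some k) * u (some k)‖ =
      (m + 1) * Real.log ‖p * q‖ := by
    rw [← Real.log_prod fun k _ => (hc0 (some k)).ne',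
      ← Real.log_mul (hc0 none).ne' (Finset.prod_pos fun k _ => hc0 (some k)).ne', hprod,
      Real.log_pow]
    push_cast; rfl
  obtain ⟨y, x, hy1, hy2, hx, hx1, hx2, hx3, hx4⟩ := exists_merge_point (m := m)
    (γ := fun k => Real.log ‖t (some k) * u (some k)‖)
    (Real.log_lt_log hpq hA) (Real.log_lt_log hpq hB) hγ₀
    (Real.log_neg (hc0 none) (H.norm_mul_lt none none))
    (fun k => Real.log_lt_log hpq (H.lt_norm_mul (some k) (some k)))
    (fun k => Real.log_neg (hc0 _) (H.norm_mul_lt (some k) (some k))) hsum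
  set P := Real.log ‖p * q‖ with hP
  have hPe : Real.exp P = ‖p * q‖ := Real.exp_log hpq
  have hPα : P < Real.log ‖A‖ := Real.log_lt_log hpq hA
  have hPβ : P < Real.log ‖B‖ := Real.log_lt_log hpq hB
  have hce : ∀ o, Real.exp (Real.log ‖t o * u o‖) = ‖t o * u o‖ := fun o => Real.exp_log (hc0 o)
  set X : Option κ → ℝ := fun o => o.elim (Real.log ‖A‖ - P + y) x with hX
  refine tr_of_norm_eq (X := fun o => Real.exp (X o)) (Y := Real.exp y) ζ H
    (fun _ => Real.exp_pos _) (Real.exp_pos _) ?_ ?_ ?_ ?_ ?_ ?_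
  · rintro (_ | k) <;> refine Real.exp_lt_one_iff.2 ?_
    · change Real.log ‖A‖ - P + y < 0
      linarith
    · exact hx2 k
  · rintro (_ | k) <;> refine Real.exp_lt_exp.2 ?_
    · change y < Real.log ‖A‖ - P + y
      linarith
    · exact hx1 k
  · rintro (_ | k) <;> rw [← hce] <;> refine Real.exp_lt_exp.2 ?_
    · change _ < Real.log ‖A‖ - P + y
      linarith
    · exact hx3 k
  · rintro (_ | k) <;> rw [← hce, ← hPe, ← Real.exp_add, ← Real.exp_add] <;>
      refine Real.exp_lt_exp.2 ?_
    · change Real.log ‖A‖ - P + y + P < _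
      linarith
    · exact hx4 k
  · rw [← Real.exp_nat_mul, ← Real.exp_sum, Fintype.sum_option]
    congr 1
    push_cast
    exact hx.symm
  · intro τ' υ' t' u' H' hτ' ht' hc
    refine tr_merge_of_norm_eq (A := A) (B := B) ζ H' (by rw [hc, hAB]) ?_ ?_
    · have h1 := ht' none
      have h2 : ‖t' none‖ * ‖u' none‖ = ‖t none * u none‖ := by rw [← norm_mul, hc]
      have h3 : ‖A‖ * ‖B‖ = ‖t none * u none‖ * ‖p * q‖ := by rw [← norm_mul, hAB, norm_mul]
      have h4 : Real.exp (X none) * ‖p * q‖ = ‖A‖ * Real.exp y := by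
        change Real.exp (Real.log ‖A‖ - P + y) * _ = _
        rw [Real.exp_add, Real.exp_sub, Real.exp_log hA0, hPe]
        field_simp
      rw [hτ']
      have h5 : ‖A‖ * ‖B‖ = ‖A‖ * (Real.exp y * ‖u' none‖) := by
        rw [h3, ← h2, h1, ← mul_assoc, ← h4]; ring
      exact mul_left_cancel₀ hA0.ne' h5
    · simpa only [hc] using hsrc

end Merge

section BaseGeneral

variable {m n : ℕ} {p q τ υ : ℂ}

lemma eventually_injective_rotation {N : ℕ} {x : Fin N → ℂ} (hx : ∀ k, x k ≠ 0) :
    ∀ᶠ y : ℝ in 𝓝[≠] 0, Function.Injective fun k : Fin N =>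
      x k * Complex.exp (Complex.I * ((k : ℕ) : ℝ) * y) := by
  have h : ∀ k l : Fin N, ∀ᶠ y : ℝ in 𝓝[≠] 0, k ≠ l →
      x k * Complex.exp (Complex.I * ((k : ℕ) : ℝ) * y) ≠
        x l * Complex.exp (Complex.I * ((l : ℕ) : ℝ) * y) := fun k l => by
    by_cases hkl : k = l
    · exact .of_forall fun y h => absurd hkl h
    set c : ℂ := Complex.I * (((k : ℕ) : ℝ) - ((l : ℕ) : ℝ) : ℝ) with hc
    have hc0 : c ≠ 0 := mul_ne_zero Complex.I_ne_zero (Complex.ofReal_ne_zero.2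
      (sub_ne_zero.2 fun h => hkl (Fin.ext (by exact_mod_cast h))))
    have hd : HasDerivAt (fun y : ℝ => x k * Complex.exp (c * y))
        (x k * (Complex.exp (c * (0 : ℝ)) * (c * 1))) 0 :=
      (((Complex.ofRealCLM.hasDerivAt).const_mul c).cexp).const_mul _
    filter_upwards [hd.eventually_ne (c := x l) (mul_ne_zero (hx k)
      (mul_ne_zero (Complex.exp_ne_zero _) (mul_ne_zero hc0 one_ne_zero)))] with y hy _ he
    apply hy
    have h1 : c * y = Complex.I * ((k : ℕ) : ℝ) * y - Complex.I * ((l : ℕ) : ℝ) * y := by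
      rw [hc]; push_cast; ring
    rw [h1, Complex.exp_sub, ← mul_div_assoc, he, mul_div_assoc, div_self (Complex.exp_ne_zero _),
      mul_one]
  filter_upwards [eventually_all.2 fun k => eventually_all.2 (h k)] with y hy k l hkl
  by_contra hne
  exact hy k l hne hkl

theorem tr_base_of_norm_eq (ζ : TT) {x y : Fin (n + 1) → ℂ} {a b : ℝ}
    (H : TrDom n n p q τ υ (Sum.elim x y) (Sum.elim (fun k => q / x k) fun k => p / y k))
    (hxa : ∀ k, ‖x k‖ = a) (hyb : ∀ k, ‖y k‖ = b) (hqa : ‖q‖ = a * a) (hpb : ‖p‖ = b * b) :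
    Tr n n p q ζ τ υ (Sum.elim x y) (Sum.elim (fun k => q / x k) fun k => p / y k) := by
  refine tr_of_rotation ζ (Sum.elim (fun k : Fin (n + 1) => ((k : ℕ) : ℝ)) fun k => ((k : ℕ) : ℝ)) H
    ?_
  refine Eventually.frequently ?_
  filter_upwards [eventually_injective_rotation (x := x) fun k => H.ht0 (Sum.inl k),
    eventually_injective_rotation (x := y) fun k => H.ht0 (Sum.inr k)]
    with s h1 h2 τ' υ' t' u' H' hτ' ht' hu'
  have et : t' = Sum.elim (fun k => x k * Complex.exp (Complex.I * ((k : ℕ) : ℝ) * s))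
      fun k => y k * Complex.exp (Complex.I * ((k : ℕ) : ℝ) * s) := by
    funext r; rw [ht' r]; cases r <;> rfl
  have eu : u' = Sum.elim (fun k => q / (x k * Complex.exp (Complex.I * ((k : ℕ) : ℝ) * s)))
      fun k => p / (y k * Complex.exp (Complex.I * ((k : ℕ) : ℝ) * s)) := by
    funext r; rw [hu' r]
    cases r
    · simp only [Sum.elim_inl, div_mul_eq_div_div]; rfl
    · simp only [Sum.elim_inr, div_mul_eq_div_div]; rfl
  subst et eu
  refine tr_base H' (a := a) (b := b) (fun k => ?_) (fun k => ?_) hqa hpb h1 h2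
  · rw [norm_mul, norm_exp_ofReal_mul_I_mul, mul_one, hxa]
  · rw [norm_mul, norm_exp_ofReal_mul_I_mul, mul_one, hyb]

theorem tr_base_sum (ζ : TT) {x y : Fin (n + 1) → ℂ}
    (H : TrDom n n p q τ υ (Sum.elim x y) (Sum.elim (fun k => q / x k) fun k => p / y k)) :
    Tr n n p q ζ τ υ (Sum.elim x y) (Sum.elim (fun k => q / x k) fun k => p / y k) := by
  set a := √‖q‖ with ha
  set b := √‖p‖ with hb
  have hqa : ‖q‖ = a * a := (Real.mul_self_sqrt (norm_nonneg _)).symm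
  have hpb : ‖p‖ = b * b := (Real.mul_self_sqrt (norm_nonneg _)).symm
  have ha0 : 0 < a := Real.sqrt_pos.2 (norm_pos_iff.2 H.hq0)
  have hb0 : 0 < b := Real.sqrt_pos.2 (norm_pos_iff.2 H.hp0)
  have ha1 : a < 1 := by have := H.hq; nlinarith
  have hb1 : b < 1 := by have := H.hp; nlinarith
  have hx0 : ∀ k, x k ≠ 0 := fun k => H.ht0 (Sum.inl k)
  have hy0 : ∀ k, y k ≠ 0 := fun k => H.ht0 (Sum.inr k)
  have hcx : ∀ k, x k * (q / x k) = q := fun k => mul_div_cancel₀ _ (hx0 k)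
  have hcy : ∀ k, y k * (p / y k) = p := fun k => mul_div_cancel₀ _ (hy0 k)
  refine tr_of_norm_eq (X := Sum.elim (fun _ => a) fun _ => b) (Y := a * b) ζ H ?_ (by positivity)
    ?_ ?_ ?_ ?_ ?_ ?_
  · rintro (k | k)
    exacts [ha0, hb0]
  · rintro (k | k)
    exacts [ha1, hb1]
  · rintro (k | k)
    · change a * b < a
      nlinarith
    · change a * b < b
      nlinarith
  · rintro (k | k)
    · change ‖x k * (q / x k)‖ < a
      rw [hcx, hqa]; nlinarith
    · change ‖y k * (p / y k)‖ < b
      rw [hcy, hpb]; nlinarith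
  · rintro (k | k)
    · change a * ‖p * q‖ < a * b * ‖x k * (q / x k)‖
      rw [hcx, norm_mul, hpb, hqa]
      have : 0 < a * b * (a * a) * (1 - b) := mul_pos (by positivity) (by linarith)
      nlinarith
    · change b * ‖p * q‖ < a * b * ‖y k * (p / y k)‖
      rw [hcy, norm_mul, hpb, hqa]
      have : 0 < a * b * (b * b) * (1 - a) := mul_pos (by positivity) (by linarith)
      nlinarith
  · rw [Fintype.prod_sum_type]
    simp [mul_pow]
  · intro τ' υ' t' u' H' hτ' ht' hc
    have et : t' = Sum.elim (fun k => t' (Sum.inl k)) fun k => t' (Sum.inr k) := by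
      funext r; cases r <;> rfl
    have eu : u' = Sum.elim (fun k => q / t' (Sum.inl k)) fun k => p / t' (Sum.inr k) := by
      funext r
      rcases r with k | k
      · exact eq_div_of_mul_eq (H'.ht0 _) (by rw [mul_comm, hc]; exact hcx k)
      · exact eq_div_of_mul_eq (H'.ht0 _) (by rw [mul_comm, hc]; exact hcy k)
    have H'' := H'
    rw [et, eu] at H'' ⊢
    exact tr_base_of_norm_eq ζ H'' (fun k => ht' (Sum.inl k)) (fun k => ht' (Sum.inr k)) hqa hpb

theorem tr_of_mul_eq_or {ι : Type} [Fintype ι] {t u : ι → ℂ} (ζ : TT)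
    (hgen : ∀ a b : ℕ, ∀ c : ℕ, p ^ a * q ^ b = (p * q) ^ c → a = c ∧ b = c)
    (H : TrDom m n p q τ υ t u) (hc : ∀ r, t r * u r = q ∨ t r * u r = p) :
    Tr m n p q ζ τ υ t u := by
  classical
  have hprod : ∏ r, t r * u r = (p * q) ^ (m + 1) := by
    rw [Finset.prod_mul_distrib, ← H.hτ, ← H.hυ, ← mul_pow, H.hτυ]
  have h1 : ∏ r, t r * u r = p ^ Fintype.card {r // ¬ t r * u r = q} *
      q ^ Fintype.card {r // t r * u r = q} := by
    rw [← Fintype.prod_subtype_mul_prod_subtype (fun r => t r * u r = q), mul_comm]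
    congr 1
    · rw [Finset.prod_congr rfl fun r _ => (hc r.1).resolve_left r.2, Finset.prod_const,
        Finset.card_univ]
    · rw [Finset.prod_congr rfl fun r _ => r.2, Finset.prod_const, Finset.card_univ]
  obtain ⟨hp, hq⟩ := hgen _ _ _ (h1.symm.trans hprod)
  have hmn : m = n := by
    have h2 := Fintype.card_congr (Equiv.sumCompl fun r => t r * u r = q)
    rw [Fintype.card_sum, hp, hq, H.card] at h2
    omega
  subst hmn
  set e : Fin (m + 1) ⊕ Fin (m + 1) ≃ ι :=
    (Equiv.sumCongr (Fintype.equivFinOfCardEq hq).symm (Fintype.equivFinOfCardEq hp).symm).trans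
      (Equiv.sumCompl fun r => t r * u r = q) with he
  have hl : ∀ k, t (e (Sum.inl k)) * u (e (Sum.inl k)) = q := fun k =>
    ((Fintype.equivFinOfCardEq hq).symm k).2
  have hr : ∀ k, t (e (Sum.inr k)) * u (e (Sum.inr k)) = p := fun k =>
    (hc _).resolve_left ((Fintype.equivFinOfCardEq hp).symm k).2
  have H' := H.congr_equiv e
  rw [← tr_congr_equiv e]
  have et : t ∘ e = Sum.elim (fun k => t (e (Sum.inl k))) fun k => t (e (Sum.inr k)) := by
    funext r; cases r <;> rfl
  have eu : u ∘ e = Sum.elim (fun k => q / t (e (Sum.inl k))) fun k => p / t (e (Sum.inr k)) := by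
    funext r
    rcases r with k | k
    · exact eq_div_of_mul_eq (H.ht0 _) (by rw [mul_comm]; exact hl k)
    · exact eq_div_of_mul_eq (H.ht0 _) (by rw [mul_comm]; exact hr k)
  rw [et, eu] at H' ⊢
  exact tr_base_sum ζ H'

end BaseGeneral

section Lattice

variable {m n : ℕ} {p q τ υ : ℂ}

lemma tr_of_dual {ι : Type} [Fintype ι] {t u : ι → ℂ} (ζ : TT) (H : TrDom m n p q τ υ t u)
    (h : Tr n m p q ζ τ υ (fun r => τ / t r) fun r => υ / u r) : Tr m n p q ζ τ υ t u := by
  unfold Tr at h ⊢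
  simp only [div_div_cancel₀ H.hτ0, div_div_cancel₀ H.hυ0] at h
  have hpq : p * q ≠ 0 := mul_ne_zero H.hp0 H.hq0
  rw [h, ← mul_assoc, ← Finset.prod_mul_distrib]
  simp_rw [← Finset.prod_mul_distrib]
  rw [Finset.prod_eq_one fun r _ => Finset.prod_eq_one fun s _ => ?_, one_mul]
  refine ellGamma_mul_reflect' H.hp H.hq ?_ (H.norm_mul_lt r s) (H.dual.norm_mul_lt r s) hpq
  have h1 := H.ht0 r
  have h2 := H.hu0 s
  rw [← H.hτυ]
  field_simp

/-- The additive valuation `x ↦ -log ‖x‖` of `p ^ a * q ^ b`. -/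
lemma neg_log_norm_zpow_mul (hp0 : p ≠ 0) (hq0 : q ≠ 0) (a b : ℤ) :
    -Real.log ‖p ^ a * q ^ b‖ = a * -Real.log ‖p‖ + b * -Real.log ‖q‖ := by
  rw [norm_mul, norm_zpow, norm_zpow, Real.log_mul (zpow_ne_zero _ (norm_ne_zero_iff.2 hp0))
    (zpow_ne_zero _ (norm_ne_zero_iff.2 hq0)), Real.log_zpow, Real.log_zpow]
  ring

lemma tr_of_split {ι : Type} [Fintype ι] {t u : ι → ℂ} (ζ : TT) (N : ℕ)
    (ih : ∀ (m n : ℕ) (τ υ : ℂ) (ι : Type) [Fintype ι] (t u : ι → ℂ) (a b : ι → ℤ),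
      TrDom m n p q τ υ t u → (∀ r, t r * u r = p ^ a r * q ^ b r) →
      ∑ r, ((a r - b r).natAbs - 1) ≤ N → Tr m n p q ζ τ υ t u)
    {a b : ι → ℤ} (H : TrDom m n p q τ υ t u) (hc : ∀ r, t r * u r = p ^ a r * q ^ b r)
    (hN : ∑ r, ((a r - b r).natAbs - 1) ≤ N + 1) (r₀ : ι) {a₁ a₂ b₁ b₂ : ℤ}
    (ha : a₁ + a₂ = a r₀ + 1) (hb : b₁ + b₂ = b r₀ + 1)
    (h1 : ‖p * q‖ < ‖p ^ a₁ * q ^ b₁‖) (h2 : ‖p * q‖ < ‖p ^ a₂ * q ^ b₂‖)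
    (hlt : ((a₁ - b₁).natAbs - 1) + ((a₂ - b₂).natAbs - 1) < (a r₀ - b r₀).natAbs - 1) :
    Tr m n p q ζ τ υ t u := by
  classical
  set e : Option {r // r ≠ r₀} ≃ ι := Equiv.optionSubtypeNe r₀ with he
  have e0 : e none = r₀ := by simp [he]
  have e1 : ∀ k, e (some k) = k := fun k => by simp [he]
  refine (tr_congr_equiv e).1 (tr_merge ζ (H.congr_equiv e) (A := p ^ a₁ * q ^ b₁)
    (B := p ^ a₂ * q ^ b₂) ?_ h1 h2 fun τs υs t' u' D hD => ?_)
  · simp only [Function.comp, e0, hc]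
    rw [mul_mul_mul_comm, ← zpow_add₀ H.hp0, ← zpow_add₀ H.hq0, ha, hb, zpow_add_one₀ H.hp0,
      zpow_add_one₀ H.hq0]
    ring
  · refine ih _ _ _ _ _ t' u' (fun o => o.elim a₂ fun o => o.elim a₁ fun k => a k)
      (fun o => o.elim b₂ fun o => o.elim b₁ fun k => b k) D (fun o => ?_) ?_
    · rw [hD]
      rcases o with _ | _ | k
      · rfl
      · rfl
      · exact hc _
    · rw [Fintype.sum_option, Fintype.sum_option]
      simp only [Option.elim]
      rw [← e.sum_comp, Fintype.sum_option, e0] at hN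
      simp only [e1] at hN
      omega

theorem tr_of_lattice (ζ : TT) (hp0 : p ≠ 0) (hq0 : q ≠ 0) (hp : ‖p‖ < 1) (hq : ‖q‖ < 1)
    (hirr : ∀ a b : ℤ, a * Real.log ‖p‖ + b * Real.log ‖q‖ = 0 → a = 0 ∧ b = 0) (N : ℕ) :
    ∀ (m n : ℕ) (τ υ : ℂ) (ι : Type) [Fintype ι] (t u : ι → ℂ) (a b : ι → ℤ),
      TrDom m n p q τ υ t u → (∀ r, t r * u r = p ^ a r * q ^ b r) →
      ∑ r, ((a r - b r).natAbs - 1) ≤ N → Tr m n p q ζ τ υ t u := by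
  set α := -Real.log ‖p‖ with hα
  set β := -Real.log ‖q‖ with hβ
  have hα0 : 0 < α := neg_pos.2 (Real.log_neg (norm_pos_iff.2 hp0) hp)
  have hβ0 : 0 < β := neg_pos.2 (Real.log_neg (norm_pos_iff.2 hq0) hq)
  have hirr' : ∀ a b : ℤ, a * α + b * β = 0 → a = 0 ∧ b = 0 := fun a b h =>
    hirr a b (by simp only [hα, hβ] at h; linarith)
  have hval : ∀ a b : ℤ, -Real.log ‖p ^ a * q ^ b‖ = a * α + b * β :=
    neg_log_norm_zpow_mul hp0 hq0
  have hpos : ∀ a b : ℤ, 0 < ‖p ^ a * q ^ b‖ := fun a b =>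
    norm_pos_iff.2 (mul_ne_zero (zpow_ne_zero _ hp0) (zpow_ne_zero _ hq0))
  have hpq : p * q = p ^ (1 : ℤ) * q ^ (1 : ℤ) := by simp
  have hlt1 : ∀ a b : ℤ, ‖p ^ a * q ^ b‖ < 1 ↔ 0 < a * α + b * β := fun a b => by
    rw [← hval, neg_pos, Real.log_neg_iff (hpos a b)]
  have hgt : ∀ a b : ℤ, ‖p * q‖ < ‖p ^ a * q ^ b‖ ↔ a * α + b * β < α + β := fun a b => by
    have h := hval 1 1
    rw [← hpq] at h
    push_cast at h
    rw [← hval, ← Real.log_lt_log_iff (by rw [hpq]; exact hpos 1 1) (hpos a b)]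
    constructor <;> intro h' <;> linarith
  have split : ∀ a b : ℤ, 0 < a * α + b * β → a * α + b * β < α + β → 2 ≤ (a - b).natAbs →
      ∃ a₁ a₂ b₁ b₂ : ℤ, ∃ i : ℤ, (i = 0 ∨ i = 1) ∧ a₁ + a₂ = a + i ∧ b₁ + b₂ = b + i ∧
        0 < a₁ * α + b₁ * β ∧ a₁ * α + b₁ * β < α + β ∧
        0 < a₂ * α + b₂ * β ∧ a₂ * α + b₂ * β < α + β ∧
        ((a₁ - b₁).natAbs - 1) + ((a₂ - b₂).natAbs - 1) < (a - b).natAbs - 1 := by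
    intro a b h1 h2 hk
    obtain ⟨a₁, b₁, hv1, hv1', hk1, hk1'⟩ : ∃ a₁ b₁ : ℤ, 0 < a₁ * α + b₁ * β ∧
        a₁ * α + b₁ * β < α + β ∧ (a₁ - b₁).natAbs = 1 ∧
        (a - b - (a₁ - b₁)).natAbs + 1 = (a - b).natAbs := by
      rcases le_or_gt 0 (a - b) with h | h
      · exact ⟨1, 0, by simpa using hα0, by simpa using hβ0, rfl, by omega⟩
      · exact ⟨0, 1, by simpa using hβ0, by simpa using hα0, rfl, by omega⟩
    have hP : 0 < α + β := add_pos hα0 hβ0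
    set x : ℝ := (a - a₁ : ℤ) * α + (b - b₁ : ℤ) * β with hx
    set i : ℤ := -⌊x / (α + β)⌋ with hi
    have hi1 : 0 ≤ x + i * (α + β) := by
      have := Int.floor_le (x / (α + β))
      rw [le_div_iff₀ hP] at this
      rw [hi]; push_cast; linarith
    have hi2 : x + i * (α + β) < α + β := by
      have := Int.lt_floor_add_one (x / (α + β))
      rw [div_lt_iff₀ hP] at this
      rw [hi]; push_cast; linarith
    have hxi : x + i * (α + β) = (a - a₁ + i : ℤ) * α + (b - b₁ + i : ℤ) * β := by
      rw [hx]; push_cast; ring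
    have hi0 : x + i * (α + β) ≠ 0 := fun h0 => by
      rw [hxi] at h0
      have := hirr' _ _ h0
      omega
    have hi1' := lt_of_le_of_ne hi1 hi0.symm
    have hsum : x + i * (α + β) + (a₁ * α + b₁ * β) = a * α + b * β + i * (α + β) := by
      rw [hx]; push_cast; ring
    refine ⟨a₁, a - a₁ + i, b₁, b - b₁ + i, i, ?_, by ring, by ring, hv1, hv1', hxi ▸ hi1',
      hxi ▸ hi2, by omega⟩
    have hl : (-1 : ℝ) < i := by
      by_contra! hcon
      nlinarith
    have hu : (i : ℝ) < 2 := by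
      by_contra! hcon
      nlinarith
    have hl' : (-1 : ℤ) < i := by exact_mod_cast hl
    have hu' : i < (2 : ℤ) := by exact_mod_cast hu
    omega
  have hgen : ∀ a b c : ℕ, p ^ a * q ^ b = (p * q) ^ c → a = c ∧ b = c := fun a b c h => by
    have h1 := hval a b
    have h2 := hval c c
    simp only [zpow_natCast] at h1 h2
    rw [h, mul_pow, h2] at h1
    have := hirr' (a - c) (b - c) (by push_cast at h1 ⊢; linarith)
    omega
  have hannulus : ∀ {m n : ℕ} {τ υ : ℂ} {ι : Type} [Fintype ι] {t u : ι → ℂ} {a b : ι → ℤ},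
      TrDom m n p q τ υ t u → (∀ r, t r * u r = p ^ a r * q ^ b r) → ∀ r,
      0 < a r * α + b r * β ∧ a r * α + b r * β < α + β := fun {m n τ υ ι _ t u a b} H hc r => by
    rw [← hlt1, ← hgt, ← hc r]
    exact ⟨H.norm_mul_lt r r, H.lt_norm_mul r r⟩
  have base : ∀ (m n : ℕ) (τ υ : ℂ) (ι : Type) [Fintype ι] (t u : ι → ℂ) (a b : ι → ℤ),
      TrDom m n p q τ υ t u → (∀ r, t r * u r = p ^ a r * q ^ b r) →
      (∀ r, (a r - b r).natAbs ≤ 1) → Tr m n p q ζ τ υ t u := by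
    intro m n τ υ ι _ t u a b H hc hk
    refine tr_of_mul_eq_or ζ hgen H fun r => ?_
    obtain ⟨h1, h2⟩ := hannulus H hc r
    have hP : 0 < α + β := add_pos hα0 hβ0
    have hcase : a r = b r ∨ a r = b r + 1 ∨ b r = a r + 1 := by have := hk r; omega
    rcases hcase with h | h | h
    · rw [h] at h1 h2
      have h3 : (0 : ℝ) < b r := by by_contra! hcon; nlinarith
      have h4 : (b r : ℝ) < 1 := by by_contra! hcon; nlinarith
      have h3' : (0 : ℤ) < b r := by exact_mod_cast h3
      have h4' : b r < (1 : ℤ) := by exact_mod_cast h4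
      omega
    · rw [h] at h1 h2
      push_cast at h1 h2
      have h3 : (-1 : ℝ) < b r := by by_contra! hcon; nlinarith
      have h4 : (b r : ℝ) < 1 := by by_contra! hcon; nlinarith
      have h3' : (-1 : ℤ) < b r := by exact_mod_cast h3
      have h4' : b r < (1 : ℤ) := by exact_mod_cast h4
      have h5 : b r = 0 := by omega
      right
      rw [hc, h, h5]; simp
    · rw [h] at h1 h2
      push_cast at h1 h2
      have h3 : (-1 : ℝ) < a r := by by_contra! hcon; nlinarith
      have h4 : (a r : ℝ) < 1 := by by_contra! hcon; nlinarith
      have h3' : (-1 : ℤ) < a r := by exact_mod_cast h3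
      have h4' : a r < (1 : ℤ) := by exact_mod_cast h4
      have h5 : a r = 0 := by omega
      left
      rw [hc, h, h5]; simp
  induction N with
  | zero =>
    intro m n τ υ ι _ t u a b H hc hN
    refine base m n τ υ ι t u a b H hc fun r => ?_
    have := (Finset.sum_eq_zero_iff.1 (Nat.le_zero.1 hN)) r (Finset.mem_univ r)
    omega
  | succ N ih =>
    intro m n τ υ ι _ t u a b H hc hN
    by_cases hk : ∀ r, (a r - b r).natAbs ≤ 1
    · exact base m n τ υ ι t u a b H hc hk
    push Not at hk
    obtain ⟨r₀, hr₀⟩ := hk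
    obtain ⟨h1, h2⟩ := hannulus H hc r₀
    obtain ⟨a₁, a₂, b₁, b₂, i, hi, ha, hb, hA, hA', hB, hB', hlt⟩ := split _ _ h1 h2 hr₀
    rcases hi with rfl | rfl
    · refine tr_of_dual ζ H (tr_of_split ζ N ih H.dual (a := fun r => 1 - a r)
        (b := fun r => 1 - b r) (fun r => ?_) ?_ r₀ (a₁ := 1 - a₁) (a₂ := 1 - a₂)
        (b₁ := 1 - b₁) (b₂ := 1 - b₂) (by omega) (by omega) ?_ ?_ (by omega))
      · rw [div_mul_div_comm, H.hτυ, hc, zpow_sub₀ hp0, zpow_sub₀ hq0, zpow_one, zpow_one,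
          div_mul_div_comm]
      · refine le_of_eq_of_le (Finset.sum_congr rfl fun r _ => ?_) hN
        omega
      · rw [hgt]; push_cast; linarith
      · rw [hgt]; push_cast; linarith
    · exact tr_of_split ζ N ih H hc hN r₀ ha hb ((hgt _ _).2 hA') ((hgt _ _).2 hB') hlt

end Lattice

section Generic

variable {ι : Type} [Fintype ι] {m n : ℕ} {p q τ υ : ℂ} {t u : ι → ℂ}

lemma trDomAt_of_re_eq {h : ℂ} {a b : ι → ℂ} (H : TrDom m n p q τ υ t u)
    (hs : ∑ r, a r + ∑ r, b r = (m + 1) * h) (hh : h.im = 0) (ha : ∀ r, (a r).im = 0)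
    (hb : ∀ r, (b r).im = 0) {s s' : ℂ} (hss : s.re = s'.re)
    (D : TrDomAt m n p q τ υ h t u a b s) : TrDomAt m n p q τ υ h t u a b s' := by
  have key : ∀ x c : ℂ, c.im = 0 → ‖x * Complex.exp (c * s')‖ = ‖x * Complex.exp (c * s)‖ :=
    fun x c hc => by
      rw [norm_mul, norm_mul, Complex.norm_exp, Complex.norm_exp, Complex.mul_re, Complex.mul_re,
        hc, hss]
      simp
  have hsum : ∀ c : ι → ℂ, (∀ r, (c r).im = 0) → ((∑ r, c r) / (m + 1)).im = 0 := fun c hc => by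
    have h1 : (∑ r, c r).im = 0 := by
      rw [Complex.im_sum]; exact Finset.sum_eq_zero fun r _ => hc r
    have h2 : ((m : ℂ) + 1) = ((m + 1 : ℝ) : ℂ) := by push_cast; rfl
    rw [h2, Complex.div_ofReal_im, h1, zero_div]
  refine trDomAt_of_norm H hs ?_ (fun r => ?_) (fun r => ?_) (fun r => ?_) fun r => ?_
  · rw [key _ _ hh]; exact D.hp
  · rw [key _ _ (ha r)]; exact D.ht r
  · rw [key _ _ (hb r)]; exact D.hu r
  · rw [key _ _ (hsum a ha), key _ _ (ha r)]; exact D.hτt r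
  · rw [key _ _ (hsum b hb), key _ _ (hb r)]; exact D.hυu r

lemma exists_frequently_mul_exp_lattice (hp0 : p ≠ 0) (hq0 : q ≠ 0)
    (hirr : Irrational (Real.log ‖p‖ / Real.log ‖q‖)) {c : ℂ} (hc : c ≠ 0) {ε : ℝ} (hε : 0 < ε) :
    ∃ z₀ : ℂ, |z₀.re| ≤ ε ∧
      ∃ᶠ s in 𝓝[≠] z₀, ∃ a b : ℤ, c * Complex.exp s = p ^ a * q ^ b := by
  set S : Set ℂ := {s | (|s.re| < ε ∧ |s.im| ≤ π) ∧ ∃ a b : ℤ, c * Complex.exp s = p ^ a * q ^ b}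
    with hS
  have hdense := (dense_addSubgroupClosure_pair_iff.2 hirr)
  set D := (AddSubgroup.closure {Real.log ‖p‖, Real.log ‖q‖} : Set ℝ) with hD
  have hinf : (D ∩ Ioo (Real.log ‖c‖ - ε) (Real.log ‖c‖ + ε)).Infinite := by
    intro hfin
    obtain ⟨x, hx1, hx2⟩ := (hdense.sdiff_finite hfin).inter_open_nonempty
      (Ioo (Real.log ‖c‖ - ε) (Real.log ‖c‖ + ε)) isOpen_Ioo ⟨Real.log ‖c‖, by linarith, by linarith⟩
    exact hx2.2 ⟨hx2.1, hx1⟩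
  have hSinf : S.Infinite := by
    refine Set.Infinite.of_image (fun s => s.re + Real.log ‖c‖) (hinf.mono ?_)
    rintro x ⟨hxD, hx⟩
    obtain ⟨a, b, hab⟩ := AddSubgroup.mem_closure_pair.1 hxD
    have hg0 : p ^ a * q ^ b / c ≠ 0 :=
      div_ne_zero (mul_ne_zero (zpow_ne_zero _ hp0) (zpow_ne_zero _ hq0)) hc
    have hre : (Complex.log (p ^ a * q ^ b / c)).re = x - Real.log ‖c‖ := by
      have h := neg_log_norm_zpow_mul hp0 hq0 a b
      rw [Complex.log_re, norm_div, Real.log_div (norm_ne_zero_iff.2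
        (mul_ne_zero (zpow_ne_zero _ hp0) (zpow_ne_zero _ hq0))) (norm_ne_zero_iff.2 hc), ← hab,
        zsmul_eq_mul, zsmul_eq_mul]
      linarith
    refine ⟨Complex.log (p ^ a * q ^ b / c), ⟨⟨?_, ?_⟩, a, b, ?_⟩, ?_⟩
    · rw [hre, abs_lt]
      exact ⟨by linarith [hx.1], by linarith [hx.2]⟩
    · rw [Complex.log_im]; exact Complex.abs_arg_le_pi _
    · rw [Complex.exp_log hg0, mul_div_cancel₀ _ hc]
    · simp only [hre]; ring
  obtain ⟨z₀, hz₀, hacc⟩ := hSinf.exists_accPt_of_subset_isCompact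
    (K := Icc (-ε) ε ×ℂ Icc (-π) π) (isCompact_Icc.reProdIm isCompact_Icc) fun s hs =>
      ⟨abs_le.1 hs.1.1.le, abs_le.1 hs.1.2⟩
  exact ⟨z₀, abs_le.2 hz₀.1, (accPt_iff_frequently_nhdsNE.1 hacc).mono fun s hs => hs.2⟩

theorem tr_of_irrational (ζ : TT) (hirr : Irrational (Real.log ‖p‖ / Real.log ‖q‖))
    (H : TrDom m n p q τ υ t u) : Tr m n p q ζ τ υ t u := by
  classical
  have hcard := H.card
  obtain ⟨r₀⟩ : Nonempty ι := Fintype.card_pos_iff.1 (by omega)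
  have hp0 := H.hp0
  have hq0 := H.hq0
  have hlq : Real.log ‖q‖ ≠ 0 := (Real.log_neg (norm_pos_iff.2 hq0) H.hq).ne
  have hInt : ∀ a b : ℤ, a * Real.log ‖p‖ + b * Real.log ‖q‖ = 0 → a = 0 ∧ b = 0 := fun a b h => by
    have ha : a = 0 := by
      by_contra ha
      have ha' : (a : ℝ) ≠ 0 := by exact_mod_cast ha
      refine hirr ⟨-b / a, ?_⟩
      push_cast
      rw [div_eq_div_iff ha' hlq]
      linarith
    subst ha
    have : (b : ℝ) = 0 := by simpa [hlq] using h
    exact ⟨rfl, by exact_mod_cast this⟩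
  suffices key : ∀ S : Finset ι, ∀ t u : ι → ℂ, TrDom m n p q τ υ t u →
      (∀ r, r ∉ S → r ≠ r₀ → ∃ a b : ℤ, t r * u r = p ^ a * q ^ b) → Tr m n p q ζ τ υ t u from
    key Finset.univ t u H fun r hr => absurd (Finset.mem_univ r) hr
  intro S
  induction S using Finset.induction_on with
  | empty =>
    intro t u H hc
    have hc' : ∀ r, ∃ ab : ℤ × ℤ, r ≠ r₀ → t r * u r = p ^ ab.1 * q ^ ab.2 := fun r => by
      by_cases hr : r = r₀
      · exact ⟨0, fun h => absurd hr h⟩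
      · obtain ⟨a, b, h⟩ := hc r (Finset.notMem_empty r) hr
        exact ⟨(a, b), fun _ => h⟩
    choose ab hab using hc'
    set a : ι → ℤ := fun r => if r = r₀ then m + 1 - ∑ x ∈ Finset.univ.erase r₀, (ab x).1
      else (ab r).1 with ha
    set b : ι → ℤ := fun r => if r = r₀ then m + 1 - ∑ x ∈ Finset.univ.erase r₀, (ab x).2
      else (ab r).2 with hb
    refine tr_of_lattice ζ hp0 hq0 H.hp H.hq hInt _ m n τ υ ι t u a b H (fun r => ?_) le_rfl
    by_cases hr : r = r₀
    · subst hr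
      have hprod : ∏ x, t x * u x = (p * q) ^ (m + 1) := by
        rw [Finset.prod_mul_distrib, ← H.hτ, ← H.hυ, ← mul_pow, H.hτυ]
      have hzs : ∀ {x : ℂ} (hx : x ≠ 0) (f : ι → ℤ) (s : Finset ι),
          ∏ i ∈ s, x ^ f i = x ^ ∑ i ∈ s, f i := fun {x} hx f s => by
        induction s using Finset.induction_on with
        | empty => simp
        | insert i s hi ih => rw [Finset.prod_insert hi, Finset.sum_insert hi, ih, zpow_add₀ hx]
      rw [← Finset.mul_prod_erase _ _ (Finset.mem_univ r),
        Finset.prod_congr rfl fun x hx => hab x (Finset.ne_of_mem_erase hx),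
        Finset.prod_mul_distrib, hzs hp0, hzs hq0] at hprod
      simp only [ha, hb, if_true]
      rw [zpow_sub₀ hp0, zpow_sub₀ hq0, div_mul_div_comm, eq_div_iff (mul_ne_zero
        (zpow_ne_zero _ hp0) (zpow_ne_zero _ hq0)), hprod, mul_pow]
      norm_cast
    · simp only [ha, hb, if_neg hr]
      exact hab r hr
  | insert r₁ S hr₁ ih =>
    intro t u H hc
    by_cases h01 : r₁ = r₀
    · refine ih t u H fun r hr hr0 => hc r (fun h => ?_) hr0
      rcases Finset.mem_insert.1 h with h | h
      · exact hr0 (h.trans h01)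
      · exact hr h
    set b : ι → ℂ := fun r => if r = r₁ then 1 else if r = r₀ then -1 else 0 with hb
    have hbsum : ∑ r, b r = 0 := by
      have : b = fun r => (if r = r₁ then 1 else 0) - if r = r₀ then 1 else 0 := by
        funext r
        simp only [hb]
        by_cases h1 : r = r₁
        · have h0 : r ≠ r₀ := fun h => h01 (h1.symm.trans h)
          simp [h1, h01]
        · by_cases h0 : r = r₀ <;> simp [h1, h0]
          simp [Ne.symm h01]
      rw [this, Finset.sum_sub_distrib]
      simp
    have hs : ∑ r : ι, (fun _ => 0 : ι → ℂ) r + ∑ r, b r = (m + 1) * 0 := by rw [hbsum]; simp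
    have hopen := isOpen_trDomAt H hs
    have hmem : (0 : ℂ) ∈ {s | TrDomAt m n p q τ υ 0 t u (fun _ => 0) b s} := by
      simpa [TrDomAt] using H
    obtain ⟨ε, hε, hball⟩ := Metric.nhds_basis_closedBall.mem_iff.1 (hopen.mem_nhds hmem)
    have hstrip : ∀ s : ℂ, |s.re| ≤ ε → TrDomAt m n p q τ υ 0 t u (fun _ => 0) b s := fun s hsε => by
      refine trDomAt_of_re_eq H hs rfl (fun _ => rfl) (fun r => ?_) (s := (s.re : ℂ)) (by simp)
        (hball ?_)
      · simp only [hb]; split_ifs <;> simp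
      · rw [mem_closedBall_zero_iff, Complex.norm_real]; exact hsε
    obtain ⟨z₀, hz₀, hfr⟩ := exists_frequently_mul_exp_lattice hp0 hq0 hirr
      (mul_ne_zero (H.ht0 r₁) (H.hu0 r₁)) hε
    have hev : ∀ᶠ s in 𝓝[≠] z₀, TrDomAt m n p q τ υ 0 t u (fun _ => 0) b s :=
      nhdsWithin_le_nhds (hopen.mem_nhds (hstrip z₀ hz₀))
    refine tr_of_frequently ζ H hs (hstrip z₀ hz₀) ((hfr.and_eventually hev).mono ?_)
    rintro s ⟨⟨a', b', hab⟩, D⟩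
    unfold TrDomAt at D
    unfold TrAt
    simp only [hbsum, Finset.sum_const_zero, zero_div, zero_mul, Complex.exp_zero, mul_one] at D ⊢
    refine ih _ _ D fun r hr hr0 => ?_
    by_cases h1 : r = r₁
    · subst h1
      exact ⟨a', b', by rw [← hab]; simp [hb]; ring⟩
    · obtain ⟨a'', b'', h⟩ := hc r (by simp [h1, hr]) hr0
      exact ⟨a'', b'', by rw [← h]; simp [hb, h1, hr0]⟩

/-- The transformation for all admissible parameters. -/
theorem TrDom.tr (ζ : TT) (H : TrDom m n p q τ υ t u) : Tr m n p q ζ τ υ t u := by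
  classical
  have hcard := H.card
  obtain ⟨r₀⟩ : Nonempty ι := Fintype.card_pos_iff.1 (by omega)
  set b : ι → ℂ := fun r => if r = r₀ then (m + 1 : ℂ) else 0 with hb
  have hs : ∑ r : ι, (fun _ => 0 : ι → ℂ) r + ∑ r, b r = (m + 1) * 1 := by simp [hb]
  have hopen := isOpen_trDomAt H hs
  have hmem : TrDomAt m n p q τ υ 1 t u (fun _ => 0) b 0 := by simpa [TrDomAt] using H
  refine tr_of_frequently ζ H hs hmem (frequently_line 0 1 one_ne_zero ?_)
  simp only [zero_add, mul_one]
  have hev : ∀ᶠ y : ℝ in 𝓝[≠] 0, TrDomAt m n p q τ υ 1 t u (fun _ => 0) b (y : ℂ) :=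
    nhdsWithin_le_nhds (Complex.continuous_ofReal.continuousAt.eventually
      (by rw [Complex.ofReal_zero]; exact hopen.mem_nhds hmem))
  have hlq : Real.log ‖q‖ ≠ 0 := (Real.log_neg (norm_pos_iff.2 H.hq0) H.hq).ne
  have hfr : ∃ᶠ y : ℝ in 𝓝[≠] 0, Irrational ((Real.log ‖p‖ + y) / Real.log ‖q‖) := by
    have hd : Dense {y : ℝ | Irrational ((Real.log ‖p‖ + y) / Real.log ‖q‖)} :=
      dense_irrational.preimage ((Homeomorph.addLeft (Real.log ‖p‖)).trans
        (Homeomorph.mulRight₀ (Real.log ‖q‖)⁻¹ (inv_ne_zero hlq))).isOpenMap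
    exact mem_closure_ne_iff_frequently_within.1 (hd.sdiff_singleton 0 0)
  refine (hfr.and_eventually hev).mono fun y hy => ?_
  refine tr_of_irrational ζ ?_ hy.2
  have : Real.log ‖p * Complex.exp (1 * y)‖ = Real.log ‖p‖ + y := by
    rw [norm_mul, Real.log_mul (norm_ne_zero_iff.2 H.hp0) (norm_ne_zero_iff.2
      (Complex.exp_ne_zero _)), Complex.norm_exp, Real.log_exp]
    simp
  rw [this]
  exact hy.1

end Generic

section Radius

lemma integral_pi_Icc_eq {N : ℕ} {f : (Fin N → TT) → ℂ} (hf : Continuous f) :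
    ((1 / (2 * Real.pi) : ℝ) : ℂ) ^ N *
      ∫ θ in univ.pi fun _ : Fin N => Icc (0 : ℝ) (2 * Real.pi), f (fun j => (θ j : TT)) =
    ∫ v, f v ∂muP N := by
  have h1 : MeasurePreserving (fun x : ℝ => (x : TT)) (volume.restrict (Icc 0 (2 * Real.pi)))
      (volume : Measure TT) := by
    have := AddCircle.measurePreserving_mk (2 * Real.pi) 0
    rwa [zero_add, Measure.restrict_congr_set Ioc_ae_eq_Icc] at this
  have h2 := measurePreserving_pi (fun _ : Fin N => volume.restrict (Icc 0 (2 * Real.pi)))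
    (fun _ : Fin N => (volume : Measure TT)) fun _ => h1
  have h3 : Measure.pi (fun _ : Fin N => (volume : Measure TT)) =
      (ENNReal.ofReal (2 * Real.pi)) ^ N • muP N := by
    refine Measure.pi_eq fun s _ => ?_
    rw [Measure.smul_apply, Measure.pi_pi, AddCircle.volume_eq_smul_haarAddCircle]
    simp [Finset.prod_mul_distrib]
  rw [volume_pi, Measure.restrict_pi_pi]
  have h4 := integral_map (μ := Measure.pi fun _ : Fin N => volume.restrict (Icc 0 (2 * Real.pi)))
    h2.measurable.aemeasurable (f := f) hf.aestronglyMeasurable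
  rw [← h4, h2.map_eq, h3, integral_smul_measure, ENNReal.toReal_pow,
    ENNReal.toReal_ofReal Real.two_pi_pos.le, Complex.real_smul, ← mul_assoc, Complex.ofReal_pow,
    ← mul_pow, ← Complex.ofReal_mul, one_div, inv_mul_cancel₀ Real.two_pi_pos.ne',
    Complex.ofReal_one, one_pow, one_mul]

lemma prod_div_prod_pairs_eq {ι : Type} [Fintype ι] {N : ℕ} {p q : ℂ} (hp : ‖p‖ < 1) (hq : ‖q‖ < 1)
    {l : ℂ} (hl : l ≠ 0) (s v : ι → ℂ) (x : Fin (N + 1) → TT) :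
    (∏ i, ∏ r, ellGamma (s r * (l * eT (x i))) p q * ellGamma (v r / (l * eT (x i))) p q) /
      (∏ i, ∏ j, if i < j then ellGamma (l * eT (x i) / (l * eT (x j))) p q *
        ellGamma (l * eT (x j) / (l * eT (x i))) p q else 1) =
    (∏ i, gamWt p q (fun r => l * s r) (fun r => v r / l) (eT (x i))) * selKer p q x := by
  have h1 : ∀ i j, l * eT (x i) / (l * eT (x j)) = eT (x i - x j) := fun i j => by
    rw [mul_div_mul_left _ _ hl, sub_eq_add_neg, eT_add, eT_neg, div_eq_mul_inv]
  rw [div_eq_mul_inv]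
  congr 1
  · refine Finset.prod_congr rfl fun i _ => Finset.prod_congr rfl fun r _ => ?_
    rw [div_div, ← mul_assoc, mul_comm (s r) l]
  · rw [selKer, prod_pairs, ← Finset.prod_inv_distrib]
    refine Finset.prod_congr rfl fun i _ => ?_
    rw [← Finset.prod_inv_distrib]
    refine Finset.prod_congr rfl fun j _ => ?_
    split_ifs
    · have h2 : eT (x j - x i) = (eT (x i - x j))⁻¹ := by rw [← eT_neg, neg_sub]
      rw [h1, h1, h2, inv_ellGamma_mul hp hq (norm_eT _)]
    · exact inv_one

lemma rpow_inv_pow_succ {Z : ℂ} (N : ℕ) : (‖Z‖ ^ (((N : ℝ) + 1)⁻¹)) ^ (N + 1) = ‖Z‖ := by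
  have := Real.rpow_inv_natCast_pow (norm_nonneg Z) (Nat.succ_ne_zero N)
  simpa using this

lemma I_A_eq_selInt {N d : ℕ} {p q Z : ℂ} (hp : ‖p‖ < 1) (hq : ‖q‖ < 1) (hZ : Z ≠ 0)
    {s v : Fin d → ℂ} (hs0 : ∀ r, s r ≠ 0) (hv0 : ∀ r, v r ≠ 0) {ζ : TT} (hζ : eT ζ = Z / ‖Z‖)
    {l : ℂ} (hl : l = ((‖Z‖ ^ (((N : ℝ) + 1)⁻¹) : ℝ) : ℂ))
    (hs : ∀ r, ‖l * s r‖ < 1) (hv : ∀ r, ‖v r / l‖ < 1) :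
    I_A N d Z s v p q = selInt N p q ζ (gamWt p q (fun r => l * s r) fun r => v r / l) := by
  have hl0 : l ≠ 0 := by
    rw [hl, Complex.ofReal_ne_zero]
    exact (Real.rpow_pos_of_pos (norm_pos_iff.2 hZ) _).ne'
  have hpow : l ^ (N + 1) = ‖Z‖ := by rw [hl, ← Complex.ofReal_pow, rpow_inv_pow_succ]
  have hcont : Continuous fun x : Fin N → TT =>
      (∏ i, gamWt p q (fun r => l * s r) (fun r => v r / l) (eT (torusVec ζ x i))) *
        selKer p q (torusVec ζ x) := by
    have hg : Continuous fun y : TT => gamWt p q (fun r => l * s r) (fun r => v r / l) (eT y) := by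
      rw [← continuousOn_univ]
      exact ContinuousOn.gamWt continuousOn_const continuousOn_const (fun _ => continuousOn_const)
        (fun _ => continuousOn_const) continuous_eT.continuousOn (fun _ _ => hp) (fun _ _ => hq)
        (fun r _ _ => mul_ne_zero hl0 (hs0 r)) (fun r _ _ => div_ne_zero (hv0 r) hl0)
        (fun r _ _ => hs r) (fun r _ _ => hv r) fun _ _ => norm_eT _
    have ht := continuous_torusVec_right (N := N) ζ
    have hF : Continuous fun w : Fin (N + 1) → TT =>
        (∏ i, gamWt p q (fun r => l * s r) (fun r => v r / l) (eT (w i))) * selKer p q w :=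
      (continuous_finsetProd _ fun i _ => hg.comp (continuous_apply i)).mul
        (continuous_selKer hp hq)
    exact hF.comp ht
  have hvec : ∀ θ : Fin N → ℝ,
      (Fin.cons (Z / ∏ j : Fin N, l * Complex.exp (Complex.I * θ j))
        (fun j => l * Complex.exp (Complex.I * θ j)) : Fin (N + 1) → ℂ) =
      fun i => l * eT (torusVec ζ (fun j => (θ j : TT)) i) := fun θ => by
    have hexp : ∀ (S : Finset (Fin N)), eT (∑ j ∈ S, (θ j : TT)) =
        ∏ j ∈ S, Complex.exp (Complex.I * θ j) := fun S => by
      induction S using Finset.induction_on with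
      | empty => simp [eT_zero]
      | insert a S ha ih => rw [Finset.sum_insert ha, Finset.prod_insert ha, eT_add, eT_coe, ih]
    funext i
    refine Fin.cases ?_ (fun j => ?_) i
    · rw [torusVec, Fin.cons_zero, Fin.cons_zero, sub_eq_add_neg, eT_add, eT_neg, hexp, hζ,
        Finset.prod_mul_distrib, Finset.prod_const, Finset.card_univ, Fintype.card_fin, ← hpow,
        pow_succ]
      have hP : ∏ j : Fin N, Complex.exp (Complex.I * θ j) ≠ 0 :=
        Finset.prod_ne_zero_iff.2 fun j _ => Complex.exp_ne_zero _
      have := pow_ne_zero N hl0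
      field_simp
    · rw [torusVec, Fin.cons_succ, Fin.cons_succ, eT_coe]
  rw [I_A, selInt, mul_assoc, torusInt, ← integral_pi_Icc_eq hcont]
  simp only [← hl, hvec, prod_div_prod_pairs_eq hp hq hl0]

end Radius

end Development

/-- Theorem (the `A_n ↔ A_m` transformation). -/
theorem an_transformation (m n : ℕ) (p q Z : ℂ)
    (hp0 : 0 < ‖p‖) (hp1 : ‖p‖ < 1)
    (hq0 : 0 < ‖q‖) (hq1 : ‖q‖ < 1)
    (hZ : Z ≠ 0)
    (t u : Fin (m + n + 2) → ℂ)
    (ht0 : ∀ r, t r ≠ 0) (hu0 : ∀ r, u r ≠ 0)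
    (hbal : ∏ r, t r * u r = (p * q) ^ (m + 1))
    (τ υ : ℂ) (hτ0 : τ ≠ 0) (hυ0 : υ ≠ 0)
    (hτ : τ ^ (m + 1) = ∏ r, t r) (hυ : υ ^ (m + 1) = ∏ r, u r)
    (hτυ : τ * υ = p * q)
    (hradn : ∀ r, ‖u r‖ < ‖Z‖ ^ (((n : ℝ) + 1)⁻¹) ∧
      ‖Z‖ ^ (((n : ℝ) + 1)⁻¹) < 1 / ‖t r‖)
    (hradm : ∀ r, ‖υ / u r‖ < ‖Z‖ ^ (((m : ℝ) + 1)⁻¹) ∧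
      ‖Z‖ ^ (((m : ℝ) + 1)⁻¹) < ‖t r‖ / ‖τ‖) :
    I_A n (m + n + 2) Z t u p q =
      (∏ r, ∏ s, ellGamma (t r * u s) p q) *
        I_A m (m + n + 2) Z (fun r => τ / t r) (fun r => υ / u r) p q := by
  have hp0' : p ≠ 0 := norm_pos_iff.1 hp0
  have hq0' : q ≠ 0 := norm_pos_iff.1 hq0
  have hZn : 0 < ‖Z‖ := norm_pos_iff.2 hZ
  obtain ⟨ζ, hζ⟩ := exists_eT_eq (κ := Z / ‖Z‖) (by
    rw [norm_div, Complex.norm_real, norm_norm, div_self hZn.ne'])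
  set x : ℝ := ‖Z‖ ^ (((n : ℝ) + 1)⁻¹) with hx
  set y : ℝ := ‖Z‖ ^ (((m : ℝ) + 1)⁻¹) with hy
  have hx0 : 0 < x := Real.rpow_pos_of_pos hZn _
  have hy0 : 0 < y := Real.rpow_pos_of_pos hZn _
  have hxc : (x : ℂ) ≠ 0 := Complex.ofReal_ne_zero.2 hx0.ne'
  have hyc : (y : ℂ) ≠ 0 := Complex.ofReal_ne_zero.2 hy0.ne'
  have hxpow : (x : ℂ) ^ (n + 1) = ‖Z‖ := by rw [← Complex.ofReal_pow, hx, rpow_inv_pow_succ]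
  have hypow : (y : ℂ) ^ (m + 1) = ‖Z‖ := by rw [← Complex.ofReal_pow, hy, rpow_inv_pow_succ]
  have hpow : (x : ℂ) ^ (m + n + 2) = (y * x) ^ (m + 1) := by
    rw [mul_pow, hypow, ← hxpow, ← pow_add]
    congr 1
    ring
  have ht1 : ∀ r, ‖x * t r‖ < 1 := fun r => by
    rw [norm_mul, Complex.norm_of_nonneg hx0.le]
    exact (lt_div_iff₀ (norm_pos_iff.2 (ht0 r))).1 (hradn r).2
  have hu1 : ∀ r, ‖u r / x‖ < 1 := fun r => by
    rw [norm_div, Complex.norm_of_nonneg hx0.le, div_lt_one hx0]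
    exact (hradn r).1
  have hτ1 : ∀ r, ‖y * (τ / t r)‖ < 1 := fun r => by
    rw [norm_mul, Complex.norm_of_nonneg hy0.le, norm_div]
    have h := (lt_div_iff₀ (norm_pos_iff.2 hτ0)).1 (hradm r).2
    rwa [← mul_div_assoc, div_lt_one (norm_pos_iff.2 (ht0 r))]
  have hυ1 : ∀ r, ‖υ / u r / y‖ < 1 := fun r => by
    rw [norm_div, Complex.norm_of_nonneg hy0.le, div_lt_one hy0]
    exact (hradm r).1
  have eτ : ∀ r, y * x * τ / (x * t r) = y * (τ / t r) := fun r => by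
    have := ht0 r
    field_simp
  have eυ : ∀ r, υ / (y * x) / (u r / x) = υ / u r / y := fun r => by
    have := hu0 r
    field_simp
  have H : TrDom m n p q (y * x * τ) (υ / (y * x)) (fun r => x * t r) fun r => u r / x := by
    refine ⟨Fintype.card_fin _, hp0', hq0', hp1, hq1, ht1, hu1, fun r => ?_, fun r => ?_, ?_, ?_, ?_⟩
    · have h := hτ1 r
      rwa [← eτ, norm_div, div_lt_one (norm_pos_iff.2 (mul_ne_zero hxc (ht0 r)))] at h
    · have h := hυ1 r
      rwa [← eυ, norm_div, div_lt_one (norm_pos_iff.2 (div_ne_zero (hu0 r) hxc))] at h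
    · rw [mul_pow, hτ, Finset.prod_mul_distrib, Finset.prod_const, Finset.card_univ,
        Fintype.card_fin, hpow]
    · rw [div_pow, hυ, Finset.prod_div_distrib, Finset.prod_const, Finset.card_univ,
        Fintype.card_fin, hpow]
    · rw [← hτυ]
      field_simp
  have key := H.tr ζ
  unfold Tr at key
  simp only [eτ, eυ] at key
  have eprod : ∀ r s, x * t r * (u s / x) = t r * u s := fun r s => by field_simp
  simp only [eprod] at key
  rw [I_A_eq_selInt hp1 hq1 hZ ht0 hu0 hζ rfl ht1 hu1, I_A_eq_selInt hp1 hq1 hZ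
    (fun r => div_ne_zero hτ0 (ht0 r)) (fun r => div_ne_zero hυ0 (hu0 r)) hζ rfl hτ1 hυ1]
  exact key
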